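/- The homomorphisms on fundamental groups induced by the inclusions 𝒰ℛ_n ↪ ℛ_n, 𝒰ℛ_n ↪ 𝒱ℛ_n and 𝒰𝒲_n ↪ 𝒲_n are all injective (basepoints taken in the smaller space; all spaces involved are path-connected). -/

import Mathlib

noncomputable section

open CategoryTheory

abbrev E2 : Type := EuclideanSpace ℝ (Fin 2)
abbrev E3 : Type := EuclideanSpace ℝ (Fin 3)

/-- The round circle in `ℝ³` with center `c`, radius `r` and normal `v`. -/
def circleSet (c : E3) (r : ℝ) (v : E3) : Set E3 :=
  {x | ‖x - c‖ = r ∧ inner ℝ (x - c) v = (0 : ℝ)}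

/-- The spanning disk of the round circle with center `c`, radius `r` and normal `v`. -/
def diskSet (c : E3) (r : ℝ) (v : E3) : Set E3 :=
  {x | ‖x - c‖ ≤ r ∧ inner ℝ (x - c) v = (0 : ℝ)}

/-- The circle determined by a parameter pair (center, normal vector `w`):
it has radius `‖w‖` and unit normal `w / ‖w‖` (so `w` and `-w` give the same circle). -/
def pCircle (p : E3 × E3) : Set E3 := circleSet p.1 ‖p.2‖ p.2

/-- The spanning disk of the circle determined by a parameter pair. -/
def pDisk (p : E3 × E3) : Set E3 := diskSet p.1 ‖p.2‖ p.2

/-- The first circle meets the spanning disk of the second in exactly one point. -/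
def LinksOnce (p q : E3 × E3) : Prop := ∃! x, x ∈ pCircle p ∩ pDisk q

/-- Two round circles are unlinked if neither meets the spanning disk of the other in
exactly one point. -/
def UnlinkedPair (p q : E3 × E3) : Prop := ¬ LinksOnce p q ∧ ¬ LinksOnce q p

/-- An `n`-tuple of parameters of (nondegenerate) pairwise disjoint, pairwise unlinked
round circles. -/
def IsRingTuple {n : ℕ} (f : Fin n → E3 × E3) : Prop :=
  (∀ i, (f i).2 ≠ 0) ∧
  (∀ i j, i ≠ j → Disjoint (pCircle (f i)) (pCircle (f j))) ∧
  (∀ i j, i ≠ j → UnlinkedPair (f i) (f j))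

/-- The space of ordered `n`-tuples of disjoint pairwise unlinked round circles. -/
abbrev RingTuple (n : ℕ) : Type := {f : Fin n → E3 × E3 // IsRingTuple f}

/-- Two tuples are identified iff they determine the same `n`-element set of circles
(this identifies `w` with `-w` and permutes the circles). -/
def ringSetoid (n : ℕ) : Setoid (RingTuple n) where
  r f g := (Set.range fun i => pCircle (f.1 i)) = Set.range fun i => pCircle (g.1 i)
  iseqv := ⟨fun _ => rfl, Eq.symm, Eq.trans⟩

/-- The space `ℛ_n` of configurations of `n` disjoint pairwise unlinked round circles
in `ℝ³`, with the quotient topology. -/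
abbrev RingConf (n : ℕ) : Type := Quotient (ringSetoid n)

/-- All circles of the tuple lie in planes parallel to the `yz`-plane, i.e. every
normal vector is parallel to `(1,0,0)`. -/
def IsUntwistedTuple {n : ℕ} (f : RingTuple n) : Prop :=
  ∀ i, (f.1 i).2 1 = 0 ∧ (f.1 i).2 2 = 0

/-- All circles of the tuple lie in vertical planes, i.e. every normal vector is
horizontal (third coordinate zero). -/
def IsVerticalTuple {n : ℕ} (f : RingTuple n) : Prop := ∀ i, (f.1 i).2 2 = 0

/-- The untwisted ring space `𝒰ℛ_n ⊆ ℛ_n`: configurations of rings parallel to the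
`yz`-plane. -/
def URConf (n : ℕ) : Set (RingConf n) :=
  {x | ∃ f, Quotient.mk (ringSetoid n) f = x ∧ IsUntwistedTuple f}

/-- The vertical ring space `𝒱ℛ_n ⊆ ℛ_n`: configurations of rings in vertical planes. -/
def VRConf (n : ℕ) : Set (RingConf n) :=
  {x | ∃ f, Quotient.mk (ringSetoid n) f = x ∧ IsVerticalTuple f}

/-- The point of `ℝ³` with the given coordinates. -/
def e3mk (x y z : ℝ) : E3 := (WithLp.equiv 2 (Fin 3 → ℝ)).symm ![x, y, z]

/-- The wicket with endpoints `a, b ∈ ℝ²`: the semicircle in upper half-space lying in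
the vertical plane through `(a,0)` and `(b,0)`, with center `m = ((a+b)/2, 0)` and
radius `‖a-b‖/2`. -/
def wicket (a b : E2) : Set E3 :=
  {x | 0 ≤ x 2 ∧ dist x (e3mk ((a 0 + b 0) / 2) ((a 1 + b 1) / 2) 0) = dist a b / 2 ∧
    ∃ t : ℝ, x 0 = a 0 + t * (b 0 - a 0) ∧ x 1 = a 1 + t * (b 1 - a 1)}

/-- An `n`-tuple of endpoint pairs of pairwise disjoint wickets. -/
def IsWicketTuple {n : ℕ} (f : Fin n → E2 × E2) : Prop :=
  (∀ i, (f i).1 ≠ (f i).2) ∧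
  (∀ i j, i ≠ j → Disjoint (wicket (f i).1 (f i).2) (wicket (f j).1 (f j).2))

/-- The space of ordered `n`-tuples of pairwise disjoint wickets. -/
abbrev WicketTuple (n : ℕ) : Type := {f : Fin n → E2 × E2 // IsWicketTuple f}

/-- Two tuples are identified iff they determine the same `n`-element set of wickets
(this permutes the wickets and swaps endpoints). -/
def wicketSetoid (n : ℕ) : Setoid (WicketTuple n) where
  r f g := (Set.range fun i => wicket (f.1 i).1 (f.1 i).2) =
    Set.range fun i => wicket (g.1 i).1 (g.1 i).2
  iseqv := ⟨fun _ => rfl, Eq.symm, Eq.trans⟩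

/-- The wicket space `𝒲_n`: configurations of `n` disjoint wickets, with the quotient
topology. -/
abbrev WConf (n : ℕ) : Type := Quotient (wicketSetoid n)

/-- All wickets of the tuple lie in planes perpendicular to the `x`-axis: both endpoints
of each wicket have the same `x`-coordinate. -/
def IsUWTuple {n : ℕ} (f : WicketTuple n) : Prop := ∀ i, (f.1 i).1 0 = (f.1 i).2 0

/-- The untwisted wicket space `𝒰𝒲_n ⊆ 𝒲_n`. -/
def UWConf (n : ℕ) : Set (WConf n) :=
  {x | ∃ f, Quotient.mk (wicketSetoid n) f = x ∧ IsUWTuple f}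

/-- The homomorphism on fundamental groups induced by a continuous map. -/
def pi1Map {X Y : Type} [TopologicalSpace X] [TopologicalSpace Y] (f : C(X, Y)) (x : X) :
    Aut (FundamentalGroupoid.mk x) →* Aut (FundamentalGroupoid.mk (f x)) :=
  CategoryTheory.Functor.mapAut (FundamentalGroupoid.mk x)
    (FundamentalGroupoid.fundamentalGroupoidFunctor.map
      (show TopCat.of X ⟶ TopCat.of Y from TopCat.ofHom f))

lemma UR_subset_VR (n : ℕ) : URConf n ⊆ VRConf n := by
  rintro x ⟨f, hf, hu⟩
  exact ⟨f, hf, fun i => (hu i).2⟩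

/-- The inclusion `𝒰ℛ_n ↪ ℛ_n`. -/
def inclURtoR (n : ℕ) : C(↥(URConf n), RingConf n) := ⟨Subtype.val, continuous_subtype_val⟩

/-- The inclusion `𝒰ℛ_n ↪ 𝒱ℛ_n`. -/
def inclURtoVR (n : ℕ) : C(↥(URConf n), ↥(VRConf n)) :=
  ⟨Set.inclusion (UR_subset_VR n), continuous_inclusion (UR_subset_VR n)⟩

/-- The inclusion `𝒰𝒲_n ↪ 𝒲_n`. -/
def inclUWtoW (n : ℕ) : C(↥(UWConf n), WConf n) := ⟨Subtype.val, continuous_subtype_val⟩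


noncomputable section
open CategoryTheory

namespace PESec
open scoped unitInterval
variable {X Y Z : Type} [TopologicalSpace X] [TopologicalSpace Y] [TopologicalSpace Z]

/-- A continuous map inducing an equivalence of fundamental groupoids. -/
def PE (f : C(X, Y)) : Prop := (FundamentalGroupoid.map f).IsEquivalence

theorem PE.comp {g : C(Y, Z)} {f : C(X, Y)} (hg : PE g) (hf : PE f) : PE (g.comp f) := by
  unfold PE at *
  rw [FundamentalGroupoid.map_comp]
  exact Functor.isEquivalence_trans _ _

theorem PE.of_comp_right {g : C(Y, Z)} {f : C(X, Y)} (hg : PE g) (h : PE (g.comp f)) : PE f := by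
  unfold PE at *
  rw [FundamentalGroupoid.map_comp] at h
  exact Functor.isEquivalence_of_comp_right _ (FundamentalGroupoid.map g)

theorem PE.of_comp_left {g : C(Y, Z)} {f : C(X, Y)} (hf : PE f) (h : PE (g.comp f)) : PE g := by
  unfold PE at *
  rw [FundamentalGroupoid.map_comp] at h
  exact Functor.isEquivalence_of_comp_left (FundamentalGroupoid.map f) _

theorem PE.of_homotopic {f g : C(X, Y)} (hf : PE f) (h : f.Homotopic g) : PE g := by
  obtain ⟨H⟩ := h
  unfold PE at *
  exact Functor.isEquivalence_of_iso (asIso (FundamentalGroupoidFunctor.homotopicMapsNatIso H))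

theorem PE.id : PE (ContinuousMap.id X) := by
  unfold PE
  rw [FundamentalGroupoid.map_id]
  infer_instance

theorem PE.of_inverse (f : C(X, Y)) (g : C(Y, X))
    (h₁ : (g.comp f).Homotopic (ContinuousMap.id X))
    (h₂ : (f.comp g).Homotopic (ContinuousMap.id Y)) : PE f := by
  let e : ContinuousMap.HomotopyEquiv X Y := ⟨f, g, h₁, h₂⟩
  exact (inferInstance :
    (FundamentalGroupoidFunctor.equivOfHomotopyEquiv e).functor.IsEquivalence)

/-- Concrete form. -/
theorem pe_iff {f : C(X, Y)} : PE f ↔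
    (∀ y, ∃ x, Joined (f x) y) ∧
    (∀ x x' (γ : Path (f x) (f x')), ∃ δ : Path x x', (δ.map f.continuous).Homotopic γ) ∧
    (∀ x x' (δ δ' : Path x x'), (δ.map f.continuous).Homotopic (δ'.map f.continuous) →
      δ.Homotopic δ') := by
  constructor
  · intro h
    unfold PE at h
    refine ⟨fun y => ?_, fun x x' γ => ?_, fun x x' δ δ' hh => ?_⟩
    · obtain ⟨x, ⟨i⟩⟩ := (inferInstance : (FundamentalGroupoid.map f).EssSurj).mem_essImage
        (FundamentalGroupoid.mk y)
      obtain ⟨p, hp⟩ := Path.Homotopic.Quotient.mk_surjective i.hom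
      exact ⟨x.as, ⟨p⟩⟩
    · obtain ⟨d, hd⟩ := (FundamentalGroupoid.map f).map_surjective
        (X := FundamentalGroupoid.mk x) (Y := FundamentalGroupoid.mk x')
        (Path.Homotopic.Quotient.mk γ)
      obtain ⟨δ, rfl⟩ := Path.Homotopic.Quotient.mk_surjective d
      exact ⟨δ, Path.Homotopic.Quotient.exact hd⟩
    · have := (FundamentalGroupoid.map f).map_injective
        (X := FundamentalGroupoid.mk x) (Y := FundamentalGroupoid.mk x')
        (a₁ := Path.Homotopic.Quotient.mk δ) (a₂ := Path.Homotopic.Quotient.mk δ')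
        (Path.Homotopic.Quotient.eq.2 hh)
      exact Path.Homotopic.Quotient.exact this
  · rintro ⟨h1, h2, h3⟩
    unfold PE
    refine @Functor.IsEquivalence.mk _ _ _ _ (FundamentalGroupoid.map f) ⟨?_⟩ ⟨?_⟩ ⟨?_⟩
    · rintro ⟨x⟩ ⟨x'⟩ a b hab
      obtain ⟨δ, rfl⟩ := Path.Homotopic.Quotient.mk_surjective a
      obtain ⟨δ', rfl⟩ := Path.Homotopic.Quotient.mk_surjective b
      exact Path.Homotopic.Quotient.eq.2 (h3 x x' δ δ' (Path.Homotopic.Quotient.exact hab))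
    · rintro ⟨x⟩ ⟨x'⟩ g
      obtain ⟨γ, rfl⟩ := Path.Homotopic.Quotient.mk_surjective g
      obtain ⟨δ, hδ⟩ := h2 x x' γ
      exact ⟨Path.Homotopic.Quotient.mk δ, Path.Homotopic.Quotient.eq.2 hδ⟩
    · rintro ⟨y⟩
      obtain ⟨x, ⟨p⟩⟩ := h1 y
      exact ⟨FundamentalGroupoid.mk x, ⟨Groupoid.isoEquivHom _ _ |>.symm
        (FundamentalGroupoid.fromPath (Path.Homotopic.Quotient.mk p))⟩⟩

theorem PE.fst [SimplyConnectedSpace Y] : PE (ContinuousMap.fst : C(X × Y, X)) := by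
  rw [pe_iff]
  obtain ⟨y0⟩ : Nonempty Y := inferInstance
  refine ⟨fun x => ⟨(x, y0), Joined.refl _⟩, ?_, ?_⟩
  · rintro ⟨x, y⟩ ⟨x', y'⟩ γ
    obtain ⟨η⟩ := PathConnectedSpace.joined y y'
    exact ⟨γ.prod η, Path.Homotopic.refl _⟩
  · rintro ⟨x, y⟩ ⟨x', y'⟩ δ δ' ⟨h⟩
    have h2 : (δ.map continuous_snd).Homotopic (δ'.map continuous_snd) :=
      SimplyConnectedSpace.paths_homotopic _ _
    obtain ⟨h2⟩ := h2
    exact ⟨Path.Homotopic.prodHomotopy h h2⟩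

end PESec
end


noncomputable section
open CategoryTheory

namespace PESec
open scoped unitInterval
variable {X Y Z : Type} [TopologicalSpace X] [TopologicalSpace Y] [TopologicalSpace Z]

/-- Straight segment path. -/
def segP {V : Type} [AddCommGroup V] [Module ℝ V] [TopologicalSpace V] [ContinuousAdd V]
    [ContinuousSMul ℝ V] (P Q : V) : Path P Q where
  toFun t := (1 - (t : ℝ)) • P + (t : ℝ) • Q
  continuous_toFun := by fun_prop
  source' := by simp
  target' := by simp

theorem segP_mem {V : Type} [AddCommGroup V] [Module ℝ V] [TopologicalSpace V] [ContinuousAdd V]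
    [ContinuousSMul ℝ V] {P Q : V} {K : Set V} (hK : Convex ℝ K) (hP : P ∈ K) (hQ : Q ∈ K) (t : I) :
    segP P Q t ∈ K :=
  hK hP hQ (by linarith [t.2.2]) t.2.1 (by ring)

/-- restrict a path to a subset -/
def pathIn {x y : X} (γ : Path x y) (s : Set X) (h : ∀ t, γ t ∈ s) :
    Path (⟨x, by simpa using h 0⟩ : s) ⟨y, by simpa using h 1⟩ where
  toFun t := ⟨γ t, h t⟩
  continuous_toFun := by fun_prop
  source' := by simp
  target' := by simp

abbrev Pm (f : C(X, Y)) := FundamentalGroupoid.map f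

abbrev pmk {x y : X} (γ : Path x y) : FundamentalGroupoid.mk x ⟶ FundamentalGroupoid.mk y :=
  Path.Homotopic.Quotient.mk γ

theorem pmk_eq {x y : X} {γ γ' : Path x y} : pmk γ = pmk γ' ↔ γ.Homotopic γ' :=
  Path.Homotopic.Quotient.eq

theorem pmk_trans {x y z : X} (γ : Path x y) (γ' : Path y z) :
    pmk (γ.trans γ') = pmk γ ≫ pmk γ' := rfl

theorem pmk_refl (x : X) : pmk (Path.refl x) = 𝟙 (FundamentalGroupoid.mk x) := rfl

theorem exists_pmk {x y : X} (g : FundamentalGroupoid.mk x ⟶ FundamentalGroupoid.mk y) :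
    ∃ γ : Path x y, g = pmk γ := by
  obtain ⟨γ, h⟩ := Path.Homotopic.Quotient.mk_surjective g
  exact ⟨γ, h.symm⟩

theorem lebesgue2 {ι : Type} (F : C(ℝ × ℝ, X)) (O : ι → Set X) (hO : ∀ i, IsOpen (O i))
    (hc : ∀ x, ∃ i, x ∈ O i) :
    ∃ N : ℕ, 0 < N ∧ ∀ k l : ℕ, k < N → l < N → ∃ i, ∀ p : ℝ × ℝ,
      p ∈ Set.Icc ((k : ℝ) / N) ((k + 1 : ℕ) / N) ×ˢ Set.Icc ((l : ℝ) / N) ((l + 1 : ℕ) / N) →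
      F p ∈ O i := by
  have hcpt : IsCompact (Set.Icc (0 : ℝ) 1 ×ˢ Set.Icc (0 : ℝ) 1) := isCompact_Icc.prod isCompact_Icc
  obtain ⟨δ, hδ, hb⟩ := lebesgue_number_lemma_of_metric (c := fun i => F ⁻¹' O i) hcpt
    (fun i => (hO i).preimage F.continuous) (fun p _ => by
      obtain ⟨i, hi⟩ := hc (F p)
      exact Set.mem_iUnion.2 ⟨i, hi⟩)
  obtain ⟨N, hN⟩ := exists_nat_one_div_lt hδ
  refine ⟨N + 1, Nat.succ_pos _, fun k l hk hl => ?_⟩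
  have hN0 : (0 : ℝ) < ((N + 1 : ℕ) : ℝ) := by positivity
  have hmem : ∀ k : ℕ, k < N + 1 → (k : ℝ) / (N + 1 : ℕ) ∈ Set.Icc (0 : ℝ) 1 := fun k hk =>
    ⟨by positivity, by
      rw [div_le_one hN0]; exact_mod_cast hk.le⟩
  obtain ⟨i, hi⟩ := hb ((k : ℝ) / (N + 1 : ℕ), (l : ℝ) / (N + 1 : ℕ)) ⟨hmem k hk, hmem l hl⟩
  refine ⟨i, fun p hp => hi ?_⟩
  obtain ⟨⟨h1, h2⟩, ⟨h3, h4⟩⟩ := hp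
  have e : ∀ k : ℕ, ((k + 1 : ℕ) : ℝ) / (N + 1 : ℕ) = (k : ℝ) / (N + 1 : ℕ) + 1 / ((N : ℝ) + 1) := by
    intro k; push_cast; ring
  rw [e] at h2 h4
  rw [Metric.mem_ball, Prod.dist_eq, max_lt_iff, Real.dist_eq, Real.dist_eq, abs_lt, abs_lt]
  dsimp only
  refine ⟨⟨?_, ?_⟩, ?_, ?_⟩ <;> linarith

theorem lebesgue1 {ι : Type} (f : C(ℝ, X)) (O : ι → Set X) (hO : ∀ i, IsOpen (O i))
    (hc : ∀ x, ∃ i, x ∈ O i) :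
    ∃ N : ℕ, 0 < N ∧ ∀ k : ℕ, k < N → ∃ i, ∀ p : ℝ,
      p ∈ Set.Icc ((k : ℝ) / N) ((k + 1 : ℕ) / N) → f p ∈ O i := by
  obtain ⟨N, hN, h⟩ := lebesgue2 (f.comp ContinuousMap.fst) O hO hc
  refine ⟨N, hN, fun k hk => ?_⟩
  obtain ⟨i, hi⟩ := h k 0 hk hN
  refine ⟨i, fun p hp => hi (p, 0) ⟨hp, ?_⟩⟩
  constructor
  · simp
  · positivity

theorem seg_comp (f : C(ℝ, X)) (s t u : ℝ) :
    pmk ((segP s t).map f.continuous) ≫ pmk ((segP t u).map f.continuous) =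
      pmk ((segP s u).map f.continuous) := by
  have h : ((segP s t).trans (segP t u)).Homotopic (segP s u) :=
    SimplyConnectedSpace.paths_homotopic _ _
  have := pmk_eq.2 (h.map f)
  rw [← this, ← pmk_trans, Path.map_trans]

/-- extension of a path to the real line -/
def extC {x y : X} (γ : Path x y) : C(ℝ, X) := ⟨γ.extend, γ.continuous_extend⟩

theorem extC_zero {x y : X} (γ : Path x y) : extC γ 0 = x := by simp [extC]
theorem extC_one {x y : X} (γ : Path x y) : extC γ 1 = y := by simp [extC]

theorem seg_extC {x y : X} (γ : Path x y) :
    (segP 0 1).map (extC γ).continuous = γ.cast (extC_zero γ) (extC_one γ) := by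
  ext t
  change γ.extend ((1 - (t : ℝ)) • (0 : ℝ) + (t : ℝ) • (1 : ℝ)) = γ t
  simp

theorem path_ind {ι : Type} (O : ι → Set X) (hO : ∀ i, IsOpen (O i))
    (hc : ∀ x, ∃ i, x ∈ O i)
    (P : ∀ x y : X, (FundamentalGroupoid.mk x ⟶ FundamentalGroupoid.mk y) → Prop)
    (hs : ∀ x y (γ : Path x y) i, (∀ t, γ t ∈ O i) → P x y (pmk γ))
    (hcomp : ∀ x y z f g, P x y f → P y z g → P x z (f ≫ g)) :
    ∀ x y f, P x y f := by
  intro x y f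
  obtain ⟨γ, rfl⟩ := exists_pmk f
  obtain ⟨N, hN, h⟩ := lebesgue1 (extC γ) O hO hc
  have key : ∀ m : ℕ, m ≤ N → P _ _ (pmk ((segP 0 ((m : ℝ) / N)).map (extC γ).continuous)) := by
    intro m
    induction m with
    | zero =>
      intro _
      obtain ⟨i, hi⟩ := h 0 hN
      apply hs _ _ _ i
      intro t
      apply hi
      simp only [segP]
      constructor
      · simp
      · simp
    | succ m ih =>
      intro hm
      rw [← seg_comp _ 0 ((m : ℝ) / N)]
      refine hcomp _ _ _ _ _ (ih (by omega)) ?_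
      obtain ⟨i, hi⟩ := h m (by omega)
      refine hs _ _ _ i fun t => hi _ ?_
      refine segP_mem (convex_Icc _ _) ?_ ?_ t
      · exact ⟨le_rfl, by gcongr; omega⟩
      · exact ⟨by gcongr; omega, le_rfl⟩
  have k1 := key N le_rfl
  rw [div_self (by positivity : (N : ℝ) ≠ 0), seg_extC] at k1
  revert k1
  generalize_proofs p1 p2
  revert p1 p2
  generalize (extC γ) 0 = x'
  generalize (extC γ) 1 = y'
  intro p1 p2
  subst p1 p2
  exact id

/-- grid lemma -/
theorem grid_lemma {C : Type*} [Category C] {c : C} (h v : ℕ → ℕ → (c ⟶ c)) (N : ℕ)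
    (hsq : ∀ k l, k < N → l < N → h k l ≫ v (k + 1) l = v k l ≫ h k (l + 1))
    (h0 : ∀ l, l < N → v 0 l = 𝟙 c) (h1 : ∀ l, l < N → v N l = 𝟙 c)
    (B : ℕ → ℕ → (c ⟶ c)) (B0 : ∀ l, B 0 l = 𝟙 c) (Bs : ∀ k l, B (k + 1) l = B k l ≫ h k l) :
    B N 0 = B N N := by
  have row : ∀ l, l < N → ∀ k, k ≤ N → B k l ≫ v k l = v 0 l ≫ B k (l + 1) := by
    intro l hl k
    induction k with
    | zero => intro _; simp [B0]
    | succ k ih =>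
      intro hk
      rw [Bs, Category.assoc, hsq k l (by omega) hl, ← Category.assoc, ih (by omega), Bs,
        Category.assoc]
  have : ∀ l, l ≤ N → B N 0 = B N l := by
    intro l
    induction l with
    | zero => intro _; rfl
    | succ l ih =>
      intro hl
      rw [ih (by omega)]
      have := row l (by omega) N le_rfl
      rw [h0 l (by omega), h1 l (by omega)] at this
      simpa using this
  exact this N le_rfl

end PESec
end


noncomputable section
open CategoryTheory

namespace PESec
open scoped unitInterval
variable {X A : Type} [TopologicalSpace X] [TopologicalSpace A] {ι : Type}

/-- Groupoid: conj. to an object -/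
theorem exists_conj {C : Type*} [Groupoid C] (c : C) :
    ∃ κ : ∀ y z : C, (y ⟶ z) → (c ⟶ c),
      (∀ y, κ y y (𝟙 y) = 𝟙 c) ∧
      (∀ x y z (f : x ⟶ y) (g : y ⟶ z), κ x z (f ≫ g) = κ x y f ≫ κ y z g) ∧
      (∀ y z (f g : y ⟶ z), Nonempty (c ⟶ y) → κ y z f = κ y z g → f = g) := by
  classical
  let k : ∀ y, Nonempty (c ⟶ y) → (c ⟶ y) := fun y h => h.some
  refine ⟨fun y z f => if h : Nonempty (c ⟶ y) then k y h ≫ f ≫ inv (k z ⟨h.some ≫ f⟩) else 𝟙 c,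
    ?_, ?_, ?_⟩
  · intro y
    dsimp only
    split_ifs with h
    · simp
    · rfl
  · intro x y z f g
    by_cases h : Nonempty (c ⟶ x)
    · have h' : Nonempty (c ⟶ y) := ⟨h.some ≫ f⟩
      simp [h, h']
    · have h' : ¬ Nonempty (c ⟶ y) := fun ⟨p⟩ => h ⟨p ≫ inv f⟩
      simp [h, h']
  · intro y z f g h e
    simp only [h, dite_true] at e
    exact (cancel_mono _).1 ((cancel_epi _).1 e)

abbrev PQ (x y : X) := Path.Homotopic.Quotient x y

/-- class of a path in a subset -/
def qIn (s : Set X) {x y : X} (γ : Path x y) (h : ∀ t, γ t ∈ s) :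
    PQ (⟨x, by simpa using h 0⟩ : s) ⟨y, by simpa using h 1⟩ :=
  Path.Homotopic.Quotient.mk (pathIn γ s h)

theorem mem_trans {s : Set X} {x y z : X} {γ : Path x y} {γ' : Path y z} (h : ∀ t, γ t ∈ s)
    (h' : ∀ t, γ' t ∈ s) : ∀ t, γ.trans γ' t ∈ s := by
  intro t
  rw [Path.trans_apply]
  split_ifs
  · exact h _
  · exact h' _

theorem mem_symm {s : Set X} {x y : X} {γ : Path x y} (h : ∀ t, γ t ∈ s) : ∀ t, γ.symm t ∈ s :=
  fun t => h _

theorem qIn_trans (s : Set X) {x y z : X} (γ : Path x y) (γ' : Path y z) (h : ∀ t, γ t ∈ s)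
    (h' : ∀ t, γ' t ∈ s) :
    qIn s (γ.trans γ') (mem_trans h h') = (qIn s γ h).trans (qIn s γ' h') := by
  unfold qIn
  rw [← Path.Homotopic.Quotient.mk_trans]
  congr 1
  ext t
  change γ.trans γ' t = ((pathIn γ s h).trans (pathIn γ' s h') t : s).1
  rw [Path.trans_apply, Path.trans_apply]
  split_ifs <;> rfl

theorem qIn_symm (s : Set X) {x y : X} (γ : Path x y) (h : ∀ t, γ t ∈ s) :
    qIn s γ.symm (mem_symm h) = (qIn s γ h).symm := rfl

theorem qIn_congr (s : Set X) {x y : X} {γ γ' : Path x y} (e : γ = γ') (h : ∀ t, γ' t ∈ s) :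
    qIn s γ (e ▸ h) = qIn s γ' h := by subst e; rfl

theorem qIn_refl (s : Set X) {x : X} (h : x ∈ s) :
    qIn s (Path.refl x) (fun _ => h) = Path.Homotopic.Quotient.refl (⟨x, h⟩ : s) := rfl

theorem qIn_mono {s t : Set X} (hst : s ⊆ t) {x y : X} {γ γ' : Path x y} {h : ∀ t, γ t ∈ s}
    {h' : ∀ t, γ' t ∈ s} (e : qIn s γ h = qIn s γ' h') :
    qIn t γ (fun u => hst (h u)) = qIn t γ' (fun u => hst (h' u)) := by
  have := congrArg (fun q => q.map ⟨Set.inclusion hst, continuous_inclusion hst⟩) e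
  exact this

theorem qIn_val {s : Set X} {x y : X} {γ γ' : Path x y} {h : ∀ t, γ t ∈ s}
    {h' : ∀ t, γ' t ∈ s} (e : qIn s γ h = qIn s γ' h') : γ.Homotopic γ' := by
  have := congrArg (fun q => q.map (⟨Subtype.val, continuous_subtype_val⟩ : C(s, X))) e
  exact Path.Homotopic.Quotient.exact this

theorem exists_qIn {s : Set X} {x y : X} {hx : x ∈ s} {hy : y ∈ s}
    (q : PQ (⟨x, hx⟩ : s) ⟨y, hy⟩) : ∃ (γ : Path x y) (h : ∀ t, γ t ∈ s), q = qIn s γ h := by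
  obtain ⟨γ, rfl⟩ := Path.Homotopic.Quotient.mk_surjective q
  exact ⟨γ.map continuous_subtype_val, fun t => (γ t).2, rfl⟩

variable (j : C(A, X))

def EssOn (U : Set X) : Prop := ∀ x ∈ U, ∃ (a : A) (γ : Path x (j a)), ∀ t, γ t ∈ U

def FullOn (U : Set X) : Prop := ∀ a a' (γ : Path (j a) (j a')) (hγ : ∀ t, γ t ∈ U),
  ∃ (δ : Path a a') (hδ : ∀ t, (δ.map j.continuous) t ∈ U), qIn U (δ.map j.continuous) hδ = qIn U γ hγ

def FaithOn (U : Set X) : Prop := ∀ a a' (δ δ' : Path a a')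
  (hδ : ∀ t, (δ.map j.continuous) t ∈ U) (hδ' : ∀ t, (δ'.map j.continuous) t ∈ U),
  qIn U (δ.map j.continuous) hδ = qIn U (δ'.map j.continuous) hδ' → δ.Homotopic δ'

def jI (U : Set X) : C(j ⁻¹' U, U) := ⟨fun a => ⟨j a.1, a.2⟩, by fun_prop⟩

variable {j}

theorem essOn_of_PE {U : Set X} (h : PE (jI j U)) : EssOn j U := by
  intro x hx
  obtain ⟨a, ⟨p⟩⟩ := (pe_iff.1 h).1 ⟨x, hx⟩
  exact ⟨a.1, p.symm.map continuous_subtype_val, fun t => (p.symm t).2⟩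

theorem fullOn_of_PE {U : Set X} (h : PE (jI j U)) : FullOn j U := by
  intro a a' γ hγ
  obtain ⟨δ, hδ⟩ := (pe_iff.1 h).2.1 ⟨a, by simpa using hγ 0⟩ ⟨a', by simpa using hγ 1⟩
    (pathIn γ U hγ)
  exact ⟨δ.map continuous_subtype_val, fun t => (δ t).2, Path.Homotopic.Quotient.eq.2 hδ⟩

theorem faithOn_of_PE {U : Set X} (h : PE (jI j U)) : FaithOn j U := by
  intro a a' δ δ' hδ hδ' e
  have := (pe_iff.1 h).2.2 ⟨a, by simpa using hδ 0⟩ ⟨a', by simpa using hδ 1⟩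
    (pathIn δ (j ⁻¹' U) hδ) (pathIn δ' (j ⁻¹' U) hδ') (Path.Homotopic.Quotient.exact e)
  exact this.map ⟨Subtype.val, continuous_subtype_val⟩

/-- relation between small paths and paths of A -/
def RR (a : X → A) (c : ∀ x, Path x (j (a x))) (U : Set X) {x x' : X} (γ : Path x x')
    (δ : Path (a x) (a x')) : Prop :=
  ∃ (h1 : ∀ t, c x t ∈ U) (h2 : ∀ t, (δ.map j.continuous) t ∈ U) (h3 : ∀ t, γ t ∈ U)
    (h4 : ∀ t, c x' t ∈ U),
    (qIn U (c x) h1).trans (qIn U (δ.map j.continuous) h2) = (qIn U γ h3).trans (qIn U (c x') h4)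

variable {a : X → A} {c : ∀ x, Path x (j (a x))} {U V : Set X}

theorem RR.exists (hf : FullOn j U) {x x' : X} {γ : Path x x'} (h : ∀ t, c x t ∈ U)
    (h' : ∀ t, c x' t ∈ U) (hγ : ∀ t, γ t ∈ U) : ∃ δ, RR a c U γ δ := by
  obtain ⟨δ, hδ, e⟩ := hf _ _ ((c x).symm.trans (γ.trans (c x')))
    (mem_trans (mem_symm h) (mem_trans hγ h'))
  refine ⟨δ, h, hδ, hγ, h', ?_⟩
  rw [e, qIn_trans U _ _ (mem_symm h) (mem_trans hγ h'), qIn_trans U _ _ hγ h', qIn_symm U _ h,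
    ← Path.Homotopic.Quotient.trans_assoc, Path.Homotopic.Quotient.trans_symm,
    Path.Homotopic.Quotient.refl_trans]

theorem RR.unique (hf : FaithOn j U) {x x' : X} {γ : Path x x'} {δ δ' : Path (a x) (a x')}
    (h : RR a c U γ δ) (h' : RR a c U γ δ') : δ.Homotopic δ' := by
  obtain ⟨h1, h2, h3, h4, e⟩ := h
  obtain ⟨h1', h2', h3', h4', e'⟩ := h'
  refine hf _ _ δ δ' h2 h2' ?_
  rw [← e'] at e
  have := congrArg (fun q => (qIn U (c x) h1).symm.trans q) e
  simpa only [← Path.Homotopic.Quotient.trans_assoc, Path.Homotopic.Quotient.symm_trans,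
    Path.Homotopic.Quotient.refl_trans] using this

theorem RR.mono (hUV : U ⊆ V) {x x' : X} {γ : Path x x'} {δ : Path (a x) (a x')}
    (h : RR a c U γ δ) : RR a c V γ δ := by
  obtain ⟨h1, h2, h3, h4, e⟩ := h
  refine ⟨fun t => hUV (h1 t), fun t => hUV (h2 t), fun t => hUV (h3 t), fun t => hUV (h4 t), ?_⟩
  rw [← qIn_trans, ← qIn_trans] at *
  exact qIn_mono hUV e

theorem RR.trans {x x' x'' : X} {γ : Path x x'} {δ : Path (a x) (a x')} {γ' : Path x' x''}
    {δ' : Path (a x') (a x'')} (h : RR a c U γ δ) (h' : RR a c U γ' δ') :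
    RR a c U (γ.trans γ') (δ.trans δ') := by
  obtain ⟨h1, h2, h3, h4, e⟩ := h
  obtain ⟨h1', h2', h3', h4', e'⟩ := h'
  have e0 : (δ.trans δ').map j.continuous = (δ.map j.continuous).trans (δ'.map j.continuous) :=
    Path.map_trans _ _ _
  refine ⟨h1, e0 ▸ mem_trans h2 h2', mem_trans h3 h3', h4', ?_⟩
  rw [qIn_congr U e0 (mem_trans h2 h2'), qIn_trans U _ _ h2 h2', qIn_trans U _ _ h3 h3', ← Path.Homotopic.Quotient.trans_assoc, e,
    Path.Homotopic.Quotient.trans_assoc, e', Path.Homotopic.Quotient.trans_assoc]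

theorem RR.congr {x x' : X} {γ γ' : Path x x'} {δ : Path (a x) (a x')} (h : RR a c U γ δ)
    (hγ : ∀ t, γ t ∈ U) (hγ' : ∀ t, γ' t ∈ U) (e : qIn U γ hγ = qIn U γ' hγ') :
    RR a c U γ' δ := by
  obtain ⟨h1, h2, h3, h4, e'⟩ := h
  exact ⟨h1, h2, hγ', h4, by rw [e', ← e]⟩

theorem RR.refl {x : X} (h : ∀ t, c x t ∈ U) :
    RR a c U (Path.refl x) (Path.refl (a x)) := by
  have h0 : x ∈ U := by simpa using h 0
  have h1 : j (a x) ∈ U := by simpa using h 1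
  refine ⟨h, fun _ => h1, fun _ => h0, h, ?_⟩
  rw [qIn_refl U h0]
  have : qIn U ((Path.refl (a x)).map j.continuous) (fun _ => h1) =
    Path.Homotopic.Quotient.refl (⟨_, h1⟩ : U) := rfl
  rw [this]
  simp

/-- If `ε : b → a (j b)` satisfies `j ε ≃ c (j b)` in `U` etc -/
theorem RR.map {b b' : A} (δ : Path b b') (hδ : ∀ t, (δ.map j.continuous) t ∈ U)
    (ε : Path b (a (j b))) (ε' : Path b' (a (j b')))
    (hc : ∀ t, c (j b) t ∈ U) (hc' : ∀ t, c (j b') t ∈ U)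
    (hε : ∀ t, (ε.map j.continuous) t ∈ U) (hε' : ∀ t, (ε'.map j.continuous) t ∈ U)
    (e : qIn U (ε.map j.continuous) hε = qIn U (c (j b)) hc)
    (e' : qIn U (ε'.map j.continuous) hε' = qIn U (c (j b')) hc') :
    RR a c U (δ.map j.continuous) (ε.symm.trans (δ.trans ε')) := by
  have e0 : (ε.symm.trans (δ.trans ε')).map j.continuous =
    (ε.map j.continuous).symm.trans ((δ.map j.continuous).trans (ε'.map j.continuous)) := by
    rw [Path.map_trans, Path.map_trans, Path.map_symm]
  refine ⟨hc, e0 ▸ mem_trans (mem_symm hε) (mem_trans hδ hε'), hδ, hc', ?_⟩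
  rw [qIn_congr U e0 (mem_trans (mem_symm hε) (mem_trans hδ hε')), qIn_trans U _ _ (mem_symm hε) (mem_trans hδ hε'), qIn_trans U _ _ hδ hε', qIn_symm U _ hε, e', e,
    ← Path.Homotopic.Quotient.trans_assoc, Path.Homotopic.Quotient.trans_symm,
    Path.Homotopic.Quotient.refl_trans]

end PESec
end


noncomputable section
open CategoryTheory

namespace PESec
open scoped unitInterval
variable {X A : Type} [TopologicalSpace X] [TopologicalSpace A] {ι : Type}

theorem pmk_symm_comp {x y : X} (γ : Path x y) : pmk γ.symm ≫ pmk γ = 𝟙 _ := by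
  rw [← pmk_trans, ← pmk_refl, pmk_eq]
  exact Path.Homotopic.symm_trans γ

theorem pmk_comp_symm {x y : X} (γ : Path x y) : pmk γ ≫ pmk γ.symm = 𝟙 _ := by
  rw [← pmk_trans, ← pmk_refl, pmk_eq]
  exact Path.Homotopic.trans_symm γ

theorem qIn_seg {V : Type} [AddCommGroup V] [Module ℝ V] [TopologicalSpace V] [ContinuousAdd V]
    [ContinuousSMul ℝ V] (F : C(V, X)) {K : Set V} (hK : Convex ℝ K) {U : Set X}
    (hU : ∀ p ∈ K, F p ∈ U) {P Q R : V} (hP : P ∈ K) (hQ : Q ∈ K) (hR : R ∈ K) :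
    qIn U (((segP P Q).map F.continuous).trans ((segP Q R).map F.continuous))
      (mem_trans (fun t => hU _ (segP_mem hK hP hQ t)) (fun t => hU _ (segP_mem hK hQ hR t))) =
    qIn U ((segP P R).map F.continuous) (fun t => hU _ (segP_mem hK hP hR t)) := by
  have : ContractibleSpace K := hK.contractibleSpace ⟨P, hP⟩
  have h := SimplyConnectedSpace.paths_homotopic
    ((pathIn (segP P Q) K (segP_mem hK hP hQ)).trans (pathIn (segP Q R) K (segP_mem hK hQ hR)))
    (pathIn (segP P R) K (segP_mem hK hP hR))
  let f : C(K, U) := ⟨fun p => ⟨F p.1, hU _ p.2⟩, by fun_prop⟩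
  have h2 := Path.Homotopic.Quotient.eq.2 (h.map f)
  rw [qIn_trans U _ _ (fun t => hU _ (segP_mem hK hP hQ t)) (fun t => hU _ (segP_mem hK hQ hR t))]
  refine Eq.trans ?_ h2
  rw [Path.map_trans]
  rfl

theorem glue_full {j : C(A, X)} (O : ι → Set X) (hO : ∀ i, IsOpen (O i)) (hc : ∀ x, ∃ i, x ∈ O i)
    (a : X → A) (c : ∀ x, Path x (j (a x))) (hcU : ∀ x i, x ∈ O i → ∀ t, c x t ∈ O i)
    (hfull : ∀ i, FullOn j (O i))
    (hε : ∀ b, ∃ ε : Path b (a (j b)), (ε.map j.continuous).Homotopic (c (j b)))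
    (b b' : A) (γ : Path (j b) (j b')) : ∃ δ : Path b b', (δ.map j.continuous).Homotopic γ := by
  have key := path_ind O hO hc (fun x y f => ∃ δ : Path (a x) (a y),
    pmk (c x) ≫ pmk (δ.map j.continuous) = f ≫ pmk (c y)) (by
      intro x y γ i hγ
      have h0 : x ∈ O i := by simpa using hγ 0
      have h1 : y ∈ O i := by simpa using hγ 1
      obtain ⟨δ, h1, h2, h3, h4, e⟩ := RR.exists (a := a) (c := c) (hfull i) (hcU x i h0)
        (hcU y i h1) hγ
      refine ⟨δ, ?_⟩
      rw [← qIn_trans, ← qIn_trans] at e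
      exact pmk_eq.2 (qIn_val e)) (by
      rintro x y z f g ⟨δ, h⟩ ⟨δ', h'⟩
      refine ⟨δ.trans δ', ?_⟩
      rw [Path.map_trans, pmk_trans, ← Category.assoc, h, Category.assoc, h', Category.assoc])
  obtain ⟨δ, hδ⟩ := key _ _ (pmk γ)
  obtain ⟨ε, h⟩ := hε b
  obtain ⟨ε', h'⟩ := hε b'
  refine ⟨ε.trans (δ.trans ε'.symm), ?_⟩
  rw [← pmk_eq, Path.map_trans, Path.map_trans, pmk_trans, pmk_trans, pmk_eq.2 h, ← Category.assoc,
    hδ, Category.assoc, ← pmk_eq.2 h', ← Path.map_symm, pmk_comp_symm, Category.comp_id]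

theorem glue_faith {j : C(A, X)} (O : ι → Set X) (hO : ∀ i, IsOpen (O i)) (hc : ∀ x, ∃ i, x ∈ O i)
    (a : X → A) (c : ∀ x, Path x (j (a x))) (hcU : ∀ x i, x ∈ O i → ∀ t, c x t ∈ O i)
    (hfull : ∀ i k, FullOn j (O i ∩ O k)) (hfaith : ∀ i, FaithOn j (O i))
    (ε : ∀ b, Path b (a (j b)))
    (hε : ∀ b i, j b ∈ O i → ∃ h h', qIn (O i) ((ε b).map j.continuous) h = qIn (O i) (c (j b)) h')
    (b b' : A) (δ δ' : Path b b') (hδ : (δ.map j.continuous).Homotopic (δ'.map j.continuous)) :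
    δ.Homotopic δ' := by
  classical
  obtain ⟨κ, κ1, κ2, κ3⟩ := exists_conj (FundamentalGroupoid.mk b)
  let Ψ : ∀ {x x' : X}, Path x x' → (FundamentalGroupoid.mk b ⟶ FundamentalGroupoid.mk b) :=
    fun {x x'} γ => if h : ∃ i δ, RR a c (O i) γ δ then κ _ _ (pmk h.choose_spec.choose) else 𝟙 _
  have Ψeq : ∀ {x x' : X} (γ : Path x x') i δ, RR a c (O i) γ δ → Ψ γ = κ _ _ (pmk δ) := by
    intro x x' γ i δ hr
    have h : ∃ i δ, RR a c (O i) γ δ := ⟨i, δ, hr⟩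
    simp only [Ψ, dif_pos h]
    have hr' := h.choose_spec.choose_spec
    set i' := h.choose
    set d := h.choose_spec.choose
    congr 1
    rw [pmk_eq]
    obtain ⟨p1, p2, p3, p4, -⟩ := id hr
    obtain ⟨q1, q2, q3, q4, -⟩ := id hr'
    obtain ⟨d2, hd2⟩ := RR.exists (a := a) (c := c) (hfull i i') (fun t => ⟨p1 t, q1 t⟩)
      (fun t => ⟨p4 t, q4 t⟩) (fun t => ⟨p3 t, q3 t⟩)
    exact (RR.unique (hfaith i') hr' (hd2.mono Set.inter_subset_right)).trans
      (RR.unique (hfaith i) (hd2.mono Set.inter_subset_left) hr)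
  have Ψcongr : ∀ {x x' y y' : X} (γ : Path x x') (γ' : Path y y'), (∀ t, γ t = γ' t) →
      Ψ γ = Ψ γ' := by
    intro x x' y y' γ γ' h
    have e0 : x = y := by simpa using h 0
    have e1 : x' = y' := by simpa using h 1
    subst e0 e1
    have : γ = γ' := by ext t; exact h t
    rw [this]
  have Ψrefl : ∀ x, Ψ (Path.refl x) = 𝟙 _ := by
    intro x
    obtain ⟨i, hi⟩ := hc x
    rw [Ψeq _ i _ (RR.refl (hcU x i hi)), pmk_refl, κ1]
  have hfull1 : ∀ i, FullOn j (O i) := fun i => by simpa using hfull i i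
  -- triangles
  have tri : ∀ (F : C(ℝ × ℝ, X)) (K : Set (ℝ × ℝ)) (hK : Convex ℝ K) (i : ι)
      (hU : ∀ p ∈ K, F p ∈ O i) (P Q R : ℝ × ℝ) (hP : P ∈ K) (hQ : Q ∈ K) (hR : R ∈ K),
      Ψ ((segP P Q).map F.continuous) ≫ Ψ ((segP Q R).map F.continuous) =
        Ψ ((segP P R).map F.continuous) := by
    intro F K hK i hU P Q R hP hQ hR
    obtain ⟨d1, hd1⟩ := RR.exists (a := a) (c := c) (hfull1 i) (hcU _ i (hU P hP))
      (hcU _ i (hU Q hQ)) (γ := (segP P Q).map F.continuous) (fun t => hU _ (segP_mem hK hP hQ t))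
    obtain ⟨d2, hd2⟩ := RR.exists (a := a) (c := c) (hfull1 i) (hcU _ i (hU Q hQ))
      (hcU _ i (hU R hR)) (γ := (segP Q R).map F.continuous) (fun t => hU _ (segP_mem hK hQ hR t))
    have h3 := (hd1.trans hd2).congr _ _ (qIn_seg F hK hU hP hQ hR)
    rw [Ψeq _ i _ hd1, Ψeq _ i _ hd2, Ψeq _ i _ h3, pmk_trans, κ2]
  -- naturality on A
  have Ψmap : ∀ {x x' : A} (d : Path x x') i, (∀ t, d t ∈ j ⁻¹' O i) →
      Ψ (d.map j.continuous) = κ _ _ (pmk (ε x).symm) ≫ κ _ _ (pmk d) ≫ κ _ _ (pmk (ε x')) := by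
    intro x x' d i hd
    obtain ⟨p1, p2, p3⟩ := hε x i (by simpa using hd 0)
    obtain ⟨q1, q2, q3⟩ := hε x' i (by simpa using hd 1)
    have := RR.map d (fun t => hd t) (ε x) (ε x') p2 q2 p1 q1 p3 q3
    rw [Ψeq _ i _ this, pmk_trans, pmk_trans, κ2, κ2]
  obtain ⟨H⟩ := hδ
  let F : C(ℝ × ℝ, X) := ⟨fun p => H (Set.projIcc 0 1 zero_le_one p.2, Set.projIcc 0 1 zero_le_one p.1),
    by fun_prop⟩
  obtain ⟨N, hN, hgrid⟩ := lebesgue2 F O hO hc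
  have hN0 : (0 : ℝ) < N := by exact_mod_cast hN
  let g : ℕ → ℕ → ℝ × ℝ := fun k l => ((k : ℝ) / N, (l : ℝ) / N)
  let hh : ℕ → ℕ → (FundamentalGroupoid.mk b ⟶ FundamentalGroupoid.mk b) := fun k l =>
    Ψ ((segP (g k l) (g (k + 1) l)).map F.continuous)
  let vv : ℕ → ℕ → (FundamentalGroupoid.mk b ⟶ FundamentalGroupoid.mk b) := fun k l =>
    Ψ ((segP (g k l) (g k (l + 1))).map F.continuous)
  let B : ℕ → ℕ → (FundamentalGroupoid.mk b ⟶ FundamentalGroupoid.mk b) := fun k l =>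
    Nat.rec (𝟙 _) (fun k q => q ≫ hh k l) k
  have vside : ∀ (s : ℝ) (k l : ℕ) (x : X), (k : ℝ) / N = s → (∀ t, F (s, t) = x) → vv k l = 𝟙 _ := by
    intro s k l x hs hx
    rw [← Ψrefl x]
    apply Ψcongr
    intro t
    change F (segP (g k l) (g k (l + 1)) t) = x
    rw [← hx (segP (g k l) (g k (l + 1)) t).2]
    congr 1
    ext
    · simp only [segP, g, Path.coe_mk_mk, Prod.smul_mk, Prod.mk_add_mk, smul_eq_mul, hs]
      ring
    · rfl
  have hB : B N 0 = B N N := by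
    apply grid_lemma hh vv N
    · intro k l hk hl
      obtain ⟨i, hi⟩ := hgrid k l hk hl
      have hKc : Convex ℝ (Set.Icc ((k : ℝ) / N) ((k + 1 : ℕ) / N) ×ˢ
        Set.Icc ((l : ℝ) / N) ((l + 1 : ℕ) / N)) := (convex_Icc _ _).prod (convex_Icc _ _)
      have hle : ∀ k : ℕ, (k : ℝ) / N ≤ ((k + 1 : ℕ) : ℝ) / N := fun k => by gcongr; omega
      have m00 : g k l ∈ Set.Icc ((k : ℝ) / N) ((k + 1 : ℕ) / N) ×ˢ
        Set.Icc ((l : ℝ) / N) ((l + 1 : ℕ) / N) := ⟨⟨le_rfl, hle k⟩, ⟨le_rfl, hle l⟩⟩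
      have m10 : g (k + 1) l ∈ Set.Icc ((k : ℝ) / N) ((k + 1 : ℕ) / N) ×ˢ
        Set.Icc ((l : ℝ) / N) ((l + 1 : ℕ) / N) := ⟨⟨hle k, le_rfl⟩, ⟨le_rfl, hle l⟩⟩
      have m01 : g k (l + 1) ∈ Set.Icc ((k : ℝ) / N) ((k + 1 : ℕ) / N) ×ˢ
        Set.Icc ((l : ℝ) / N) ((l + 1 : ℕ) / N) := ⟨⟨le_rfl, hle k⟩, ⟨hle l, le_rfl⟩⟩
      have m11 : g (k + 1) (l + 1) ∈ Set.Icc ((k : ℝ) / N) ((k + 1 : ℕ) / N) ×ˢ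
        Set.Icc ((l : ℝ) / N) ((l + 1 : ℕ) / N) := ⟨⟨hle k, le_rfl⟩, ⟨hle l, le_rfl⟩⟩
      exact (tri F _ hKc i hi _ _ _ m00 m10 m11).trans (tri F _ hKc i hi _ _ _ m00 m01 m11).symm
    · intro l _
      refine vside 0 0 l (j b) (by simp) fun t => ?_
      simp [F]
    · intro l _
      refine vside 1 N l (j b') (div_self hN0.ne') fun t => ?_
      simp [F]
    · intro l; rfl
    · intro k l; rfl
  -- telescoping
  have tel : ∀ (d : Path b b') (l : ℕ) (hl : ∀ s, F (s, (l : ℝ) / N) = j (extC d s))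
      (hs : ∀ k, k < N → ∃ i, ∀ s ∈ Set.Icc ((k : ℝ) / N) ((k + 1 : ℕ) / N), j (extC d s) ∈ O i)
      (m : ℕ), m ≤ N → B m l = κ _ _ (pmk (ε (extC d 0)).symm) ≫
        κ _ _ (pmk ((segP 0 ((m : ℝ) / N)).map (extC d).continuous)) ≫
        κ _ _ (pmk (ε (extC d ((m : ℝ) / N)))) := by
    intro d l hl hs m
    have hseg : ∀ k, k < N → hh k l = κ _ _ (pmk (ε (extC d ((k : ℝ) / N))).symm) ≫
        κ _ _ (pmk ((segP ((k : ℝ) / N) (((k + 1 : ℕ) : ℝ) / N)).map (extC d).continuous)) ≫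
        κ _ _ (pmk (ε (extC d (((k + 1 : ℕ) : ℝ) / N)))) := by
      intro k hk
      obtain ⟨i, hi⟩ := hs k hk
      rw [← Ψmap _ i]
      · apply Ψcongr
        intro t
        change F (segP (g k l) (g (k + 1) l) t) = j (extC d (segP ((k : ℝ) / N) _ t))
        rw [← hl]
        congr 1
        ext
        · rfl
        · simp only [segP, g, Path.coe_mk_mk, Prod.smul_mk, Prod.mk_add_mk, smul_eq_mul]
          ring
      · intro t
        apply hi
        apply segP_mem (convex_Icc _ _)
        · exact ⟨le_rfl, by gcongr; omega⟩
        · exact ⟨by gcongr; omega, le_rfl⟩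
    induction m with
    | zero =>
      intro _
      change 𝟙 _ = _
      have e0 : ((0 : ℕ) : ℝ) / N = 0 := by simp
      rw [e0]
      have : (segP (0 : ℝ) 0) = Path.refl 0 := by ext t; simp [segP]
      rw [this]
      have e1 : (Path.refl (0 : ℝ)).map (extC d).continuous = Path.refl (extC d 0) := rfl
      rw [e1, pmk_refl, κ1, Category.id_comp, ← κ2, pmk_symm_comp, κ1]
    | succ m ih =>
      intro hm
      change B m l ≫ hh m l = _
      rw [ih (by omega), hseg m (by omega), ← seg_comp (extC d) 0 ((m : ℝ) / N) (((m + 1 : ℕ) : ℝ) / N), κ2]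
      have : κ _ _ (pmk (ε (extC d ((m : ℝ) / N)))) ≫ κ _ _ (pmk (ε (extC d ((m : ℝ) / N))).symm) =
        𝟙 _ := by rw [← κ2, pmk_comp_symm, κ1]
      simp only [Category.assoc]
      rw [reassoc_of% this]
  have fin : ∀ (d : Path b b') (l : ℕ) (hl : ∀ s, F (s, (l : ℝ) / N) = j (extC d s))
      (hs : ∀ k, k < N → ∃ i, ∀ s ∈ Set.Icc ((k : ℝ) / N) ((k + 1 : ℕ) / N), j (extC d s) ∈ O i),
      B N l = κ _ _ (pmk (ε b).symm) ≫ κ _ _ (pmk d) ≫ κ _ _ (pmk (ε b')) := by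
    intro d l hl hs
    rw [tel d l hl hs N le_rfl, div_self hN0.ne', seg_extC]
    generalize_proofs p1 p2
    revert p1 p2
    generalize (extC d) 0 = x'
    generalize (extC d) 1 = y'
    intro p1 p2
    subst p1 p2
    rfl
  have f0 := fin δ 0 (fun s => by simp [F, extC, Path.extend, Set.IccExtend]) (by
    intro k hk
    obtain ⟨i, hi⟩ := hgrid k 0 hk hN
    refine ⟨i, fun s hs => ?_⟩
    have := hi (s, 0) ⟨hs, by constructor <;> simp⟩
    simpa [F, extC, Path.extend, Set.IccExtend] using this)
  have f1 := fin δ' N (fun s => by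
      simp [F, extC, Path.extend, Set.IccExtend, div_self hN0.ne']) (by
    intro k hk
    obtain ⟨i, hi⟩ := hgrid k (N - 1) hk (by omega)
    refine ⟨i, fun s hs => ?_⟩
    have := hi (s, 1) ⟨hs, by
      rw [Nat.sub_add_cancel hN, div_self hN0.ne']
      refine ⟨?_, le_rfl⟩
      rw [div_le_one hN0]
      exact_mod_cast Nat.sub_le _ _⟩
    simpa [F, extC, Path.extend, Set.IccExtend] using this)
  rw [hB, f1] at f0
  have c1 : κ _ _ (pmk (ε b)) ≫ κ _ _ (pmk (ε b).symm) = 𝟙 _ := by rw [← κ2, pmk_comp_symm, κ1]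
  have c2 : κ _ _ (pmk (ε b')) ≫ κ _ _ (pmk (ε b').symm) = 𝟙 _ := by rw [← κ2, pmk_comp_symm, κ1]
  have := congrArg (fun q => κ _ _ (pmk (ε b)) ≫ q ≫ κ _ _ (pmk (ε b').symm)) f0
  simp only [Category.assoc, c2, Category.comp_id, reassoc_of% c1] at this
  exact pmk_eq.1 (κ3 _ _ _ _ ⟨𝟙 _⟩ this.symm)

def OI (O : ι → Set X) (J : Set ι) : Set X := {x | ∀ i ∈ J, x ∈ O i}

theorem glue {j : C(A, X)} (O : ι → Set X) (hO : ∀ i, IsOpen (O i)) (hc : ∀ x, ∃ i, x ∈ O i)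
    (h : ∀ J : Set ι, J.Nonempty → PE (jI j (OI O J))) : PE j := by
  let idx : X → Set ι := fun x => {i | x ∈ O i}
  have hidx : ∀ x, PE (jI j (OI O (idx x))) := fun x => h _ (hc x)
  have hm : ∀ x, x ∈ OI O (idx x) := fun x i hi => hi
  choose a c hac using fun x => essOn_of_PE (hidx x) x (hm x)
  have hsub : ∀ x i, x ∈ O i → OI O (idx x) ⊆ O i := fun x i hx y hy => hy i hx
  choose ε hε hε' using fun b => fullOn_of_PE (hidx (j b)) b (a (j b)) (c (j b)) (hac (j b))
  have e1 : ∀ i, OI O {i} = O i := fun i => by ext x; simp [OI]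
  have e2 : ∀ i k, OI O {i, k} = O i ∩ O k := fun i k => by ext x; simp [OI]
  have hcU : ∀ x i, x ∈ O i → ∀ t, c x t ∈ O i := fun x i hx t => hsub x i hx (hac x t)
  refine pe_iff.2 ⟨fun y => ⟨a y, ⟨(c y).symm⟩⟩, ?_, ?_⟩
  · refine glue_full O hO hc a c hcU (fun i => ?_) (fun b => ⟨ε b, qIn_val (hε' b)⟩)
    rw [← e1]
    exact fullOn_of_PE (h _ (Set.singleton_nonempty i))
  · intro b b' δ δ' hδ
    refine glue_faith O hO hc a c hcU (fun i k => ?_) (fun i => ?_) ε (fun b i hb => ?_) b b' δ δ' hδ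
    · rw [← e2]
      exact fullOn_of_PE (h _ ⟨i, by simp⟩)
    · rw [← e1]
      exact faithOn_of_PE (h _ (Set.singleton_nonempty i))
    · exact ⟨_, _, qIn_mono (hsub _ i hb) (hε' b)⟩

end PESec
end


noncomputable section
open CategoryTheory

namespace PESec
open scoped unitInterval Topology

section HLP
variable {B M : Type} [TopologicalSpace B] [TopologicalSpace M]

/-- local transport for a subset of a product -/
def Trans (G : Set (B × M)) : Prop :=
  ∃ Φ : C(B × B × M, M), (∀ b z, Φ (b, b, z) = z) ∧
    ∀ b0, ∀ᶠ p in 𝓝 (b0, b0), ∀ z, ((p : B × B).1, z) ∈ G → (p.2, Φ (p.1, p.2, z)) ∈ G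

theorem Trans.comap {G : Set (B × M)} (h : Trans G) {B0 : Type} [TopologicalSpace B0]
    (j : C(B0, B)) : Trans {x : B0 × M | (j x.1, x.2) ∈ G} := by
  obtain ⟨Φ, h1, h2⟩ := h
  refine ⟨⟨fun x => Φ (j x.1, j x.2.1, x.2.2), by fun_prop⟩, fun b z => h1 _ _, fun b0 => ?_⟩
  have hc : Continuous (fun p : B0 × B0 => (j p.1, j p.2)) := by fun_prop
  exact (hc.tendsto (b0, b0)).eventually (h2 (j b0))

theorem hlp {G : Set (B × M)} (hT : Trans G) {D : Type} [PseudoMetricSpace D] [CompactSpace D]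
    (f : C(D × I, B)) (p0 : C(D, M)) (h0 : ∀ x, (f (x, 0), p0 x) ∈ G) :
    ∃ p : C(D × I, M), (∀ x, p (x, 0) = p0 x) ∧ (∀ x s, (f (x, s), p (x, s)) ∈ G) ∧
      (∀ x, (∀ s, f (x, s) = f (x, 0)) → ∀ s, p (x, s) = p0 x) ∧
      (∀ x x', (∀ s, f (x, s) = f (x', s)) → p0 x = p0 x' → ∀ s, p (x, s) = p (x', s)) := by
  obtain ⟨Φ, h1, h2⟩ := hT
  have key : ∃ ε > 0, ∀ (x : D) (s s' : I), dist s s' < ε →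
      ∀ z, (f (x, s), z) ∈ G → (f (x, s'), Φ (f (x, s), f (x, s'), z)) ∈ G := by
    have hU : ∀ y : D × I, ∃ U : Set (D × I), IsOpen U ∧ y ∈ U ∧ ∀ a ∈ U, ∀ b ∈ U,
        ∀ z, (f a, z) ∈ G → (f b, Φ (f a, f b, z)) ∈ G := by
      intro y
      have hc : Continuous (fun p : (D × I) × (D × I) => (f p.1, f p.2)) := by fun_prop
      have := (hc.tendsto (y, y)).eventually (h2 (f y))
      rw [nhds_prod_eq] at this
      obtain ⟨U, hU, hU'⟩ := Filter.mem_prod_same_iff.1 this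
      obtain ⟨V, hV, hVo, hyV⟩ := mem_nhds_iff.1 hU
      exact ⟨V, hVo, hyV, fun a ha b hb => hU' (Set.mk_mem_prod (hV ha) (hV hb))⟩
    choose U hUo hyU hU using hU
    obtain ⟨ε, hε, h⟩ := lebesgue_number_lemma_of_metric (isCompact_univ (X := D × I)) (c := U) hUo
      (fun y _ => Set.mem_iUnion.2 ⟨y, hyU y⟩)
    refine ⟨ε, hε, fun x s s' hs => ?_⟩
    obtain ⟨i, hi⟩ := h (x, s) trivial
    refine hU i _ (hi (Metric.mem_ball_self hε)) _ (hi ?_)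
    rw [Metric.mem_ball, Prod.dist_eq]
    simp only [dist_self]
    rw [max_lt_iff]
    exact ⟨hε, by rwa [dist_comm]⟩
  obtain ⟨ε, hε, key⟩ := key
  obtain ⟨N, hN⟩ := exists_nat_one_div_lt hε
  let τ : ℕ → I → I := fun k s => Set.projIcc 0 1 zero_le_one (min (s : ℝ) (k / (N + 1)))
  have hτ : ∀ k, Continuous (τ k) := fun k => by fun_prop
  have hτ0 : ∀ k, τ k 0 = 0 := by
    intro k
    simp only [τ]
    rw [min_eq_left (by simp only [Set.Icc.coe_zero]; positivity)]
    simp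
  have hτz : ∀ s, τ 0 s = 0 := by
    intro s
    simp only [τ]
    rw [min_eq_right (by simpa using s.2.1)]
    simp
  have hτ1 : ∀ s, τ (N + 1) s = s := by
    intro s
    simp only [τ]
    rw [min_eq_left (by
      push_cast
      rw [div_self (by positivity)]
      exact s.2.2)]
    simp
  have hτd : ∀ k s, dist (τ k s) (τ (k + 1) s) < ε := by
    intro k s
    refine lt_of_le_of_lt ?_ hN
    have hle : (k : ℝ) / (N + 1) ≤ ((k + 1 : ℕ) : ℝ) / (N + 1) := by gcongr; omega
    have e : ((k + 1 : ℕ) : ℝ) / (N + 1) - k / (N + 1) = 1 / (N + 1) := by push_cast; ring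
    have hl : LipschitzWith 1 (Set.projIcc (0 : ℝ) 1 zero_le_one) := LipschitzWith.projIcc zero_le_one
    refine (hl.dist_le_mul _ _).trans ?_
    rw [NNReal.coe_one, one_mul, Real.dist_eq, abs_le]
    have := min_le_min (le_refl (s : ℝ)) hle
    constructor
    · rcases le_total (s : ℝ) (k / (N + 1)) with h | h
      · rw [min_eq_left h, min_eq_left (h.trans hle)]
        simp only [sub_self, Left.neg_nonpos_iff]; positivity
      · rw [min_eq_right h]
        linarith [min_le_right (s : ℝ) (((k + 1 : ℕ) : ℝ) / (N + 1))]
    · have : (0 : ℝ) ≤ 1 / (N + 1) := by positivity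
      linarith
  have ind : ∀ k : ℕ, ∃ p : C(D × I, M), (∀ x, p (x, 0) = p0 x) ∧
      (∀ x s, (f (x, τ k s), p (x, s)) ∈ G) ∧
      (∀ x, (∀ s, f (x, s) = f (x, 0)) → ∀ s, p (x, s) = p0 x) ∧
      (∀ x x', (∀ s, f (x, s) = f (x', s)) → p0 x = p0 x' → ∀ s, p (x, s) = p (x', s)) := by
    intro k
    induction k with
    | zero =>
      refine ⟨⟨fun y => p0 y.1, by fun_prop⟩, fun x => rfl, fun x s => ?_, fun x _ s => rfl,
        fun x x' _ h s => h⟩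
      rw [hτz]; exact h0 x
    | succ k ih =>
      obtain ⟨p, i1, i2, i3, i4⟩ := ih
      have := hτ k
      have := hτ (k + 1)
      refine ⟨⟨fun y => Φ (f (y.1, τ k y.2), f (y.1, τ (k + 1) y.2), p y), by fun_prop⟩, ?_, ?_, ?_, ?_⟩
      · intro x
        simp only [ContinuousMap.coe_mk, hτ0, h1, i1]
      · intro x s
        exact key _ _ _ (hτd k s) _ (i2 x s)
      · intro x hx s
        simp only [ContinuousMap.coe_mk]
        rw [hx (τ k s), hx (τ (k + 1) s), h1, i3 x hx]
      · intro x x' hx hx' s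
        simp only [ContinuousMap.coe_mk]
        rw [hx, hx, i4 x x' hx hx']
  obtain ⟨p, i1, i2, i3, i4⟩ := ind (N + 1)
  exact ⟨p, i1, fun x s => by simpa [hτ1] using i2 x s, i3, i4⟩
end HLP

section Feat
variable {B M : Type} [TopologicalSpace B] [NormedAddCommGroup M] [NormedSpace ℝ M]
  [FiniteDimensional ℝ M]

def psi (a b : ℝ) : ℝ := max 0 (min 1 (2 - 4 * (a / (a + b))))

theorem psi_cont {Y : Type} [TopologicalSpace Y] {a b : Y → ℝ} (ha : Continuous a) (hb : Continuous b)
    (h : ∀ y, a y + b y ≠ 0) : Continuous fun y => psi (a y) (b y) := by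
  unfold psi
  have := ha.div (ha.add hb) h
  fun_prop

theorem psi_one {a b : ℝ} (ha : 0 ≤ a) (h : 3 * a < b) : psi a b = 1 := by
  have : a / (a + b) ≤ 1 / 4 := by
    rw [div_le_iff₀ (by linarith)]; linarith
  unfold psi
  rw [min_eq_left (by linarith)]
  simp

theorem psi_zero {a b : ℝ} (hb : 0 ≤ b) (h0 : 0 < a) (h : b ≤ a) : psi a b = 0 := by
  have : 1 / 2 ≤ a / (a + b) := by
    rw [le_div_iff₀ (by linarith)]; linarith
  unfold psi
  exact max_eq_left ((min_le_right _ _).trans (by linarith))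

theorem trans_of_feat {J : Type} [Fintype J] (Δ : J → B × M → ℝ) (hΔ : ∀ j, Continuous (Δ j))
    (hpos : ∀ j x, 0 ≤ Δ j x) (S : J → B × B × M → M) (hS : ∀ j, Continuous (S j))
    (hSd : ∀ j b z, S j (b, b, z) = z)
    (hSz : ∀ j b0, ∀ᶠ p in 𝓝 (b0, b0), ∀ z, Δ j ((p : B × B).2, S j (p.1, p.2, z)) = 0 →
      Δ j (p.1, z) = 0)
    (N : B → ℝ) (hN : Continuous N) (hNz : ∀ j b z, Δ j (b, z) = 0 → ‖z‖ < N b)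
    (hdis : ∀ j k x, j ≠ k → Δ j x = 0 → Δ k x ≠ 0) :
    Trans {x : B × M | ∀ j, Δ j x ≠ 0} := by
  classical
  let L : B × M → ℝ := fun x => max 0 (N x.1 - ‖x.2‖)
  have hL : Continuous L := by fun_prop
  have hL0 : ∀ x, 0 ≤ L x := fun x => le_max_left _ _
  have hΔL : ∀ j x, 0 < Δ j x + L x := by
    rintro j ⟨b, z⟩
    rcases (hpos j (b, z)).lt_or_eq with h | h
    · linarith [hL0 (b, z)]
    · have := hNz j b z h.symm
      rw [← h, zero_add]
      exact lt_max_of_lt_right (by simpa using this)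
  have hΔΔ : ∀ j k x, j ≠ k → 0 < Δ j x + Δ k x := by
    intro j k x hjk
    rcases (hpos j x).lt_or_eq with h | h
    · linarith [hpos k x]
    · have := (hpos k x).lt_of_ne' (hdis j k x hjk h.symm)
      linarith
  let χ : J → B × M → ℝ := fun j x =>
    psi (Δ j x) (L x) * ∏ k ∈ Finset.univ.erase j, psi (Δ j x) (Δ k x)
  have hχ : ∀ j, Continuous (χ j) := by
    intro j
    refine (psi_cont (hΔ j) hL fun x => (hΔL j x).ne').mul ?_
    refine continuous_finsetProd _ fun k hk => psi_cont (hΔ j) (hΔ k) fun x => ?_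
    exact (hΔΔ j k x (Finset.ne_of_mem_erase hk).symm).ne'
  let Φ : B × B × M → M := fun y => y.2.2 + ∑ j, χ j (y.1, y.2.2) • (S j y - y.2.2)
  have hΦ : Continuous Φ := by fun_prop
  have hΦd : ∀ b z, Φ (b, b, z) = z := by
    intro b z
    simp only [Φ, hSd, sub_self, smul_zero, Finset.sum_const_zero, add_zero]
  have hΦS : ∀ j b b' z, (∀ k, k ≠ j → 3 * Δ j (b, z) < Δ k (b, z)) → 3 * Δ j (b, z) < L (b, z) →
      Φ (b, b', z) = S j (b, b', z) := by
    intro j b b' z hk hl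
    simp only [Φ]
    rw [Finset.sum_eq_single j]
    · have : χ j (b, z) = 1 := by
        simp only [χ]
        rw [psi_one (hpos _ _) hl, one_mul]
        exact Finset.prod_eq_one fun k hk' => psi_one (hpos _ _) (hk k (Finset.ne_of_mem_erase hk'))
      rw [this, one_smul]; abel
    · intro k _ hkj
      have : χ k (b, z) = 0 := by
        simp only [χ]
        rw [Finset.prod_eq_zero (i := j), mul_zero]
        · simp [hkj.symm]
        · have := hk k hkj
          have h0 := hpos j (b, z)
          exact psi_zero h0 (by linarith) (by linarith)
      rw [this, zero_smul]
    · simp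
  have hΦL : ∀ b b' z, N b ≤ ‖z‖ → Φ (b, b', z) = z := by
    intro b b' z h
    have hl : L (b, z) = 0 := max_eq_left (by simpa using h)
    simp only [Φ]
    rw [Finset.sum_eq_zero, add_zero]
    intro j _
    have : χ j (b, z) = 0 := by
      simp only [χ]
      rw [psi_zero (hL0 _), zero_mul]
      · have := hΔL j (b, z); rw [hl] at this; linarith
      · rw [hl]; exact hpos _ _
    rw [this, zero_smul]
  refine ⟨⟨Φ, hΦ⟩, hΦd, fun b0 => ?_⟩
  have hfar : ∀ᶠ p in 𝓝 (b0, b0), N (p : B × B).1 < N b0 + 1 ∧ N p.2 < N b0 + 1 := by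
    have c1 : Continuous fun p : B × B => N p.1 := by fun_prop
    have c2 : Continuous fun p : B × B => N p.2 := by fun_prop
    exact (c1.continuousAt.eventually_lt continuousAt_const (by simp)).and
      (c2.continuousAt.eventually_lt continuousAt_const (by simp))
  have hnear : ∀ᶠ p in 𝓝 (b0, b0), ∀ z ∈ Metric.closedBall (0 : M) (N b0 + 1),
      (∃ j, (∀ k, k ≠ j → 3 * Δ j ((p : B × B).1, z) < Δ k (p.1, z) ∧ 0 < Δ k (p.2, Φ (p.1, p.2, z))) ∧
        3 * Δ j (p.1, z) < L (p.1, z)) ∨ (∀ k, 0 < Δ k (p.2, Φ (p.1, p.2, z))) := by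
    have hcpt : IsCompact (Metric.closedBall (0 : M) (N b0 + 1)) := isCompact_closedBall _ _
    refine hcpt.eventually_forall_of_forall_eventually fun z _ => ?_
    have hopen : IsOpen {y : (B × B) × M | (∃ j, (∀ k, k ≠ j → 3 * Δ j (y.1.1, y.2) < Δ k (y.1.1, y.2) ∧
        0 < Δ k (y.1.2, Φ (y.1.1, y.1.2, y.2))) ∧
        3 * Δ j (y.1.1, y.2) < L (y.1.1, y.2)) ∨ (∀ k, 0 < Δ k (y.1.2, Φ (y.1.1, y.1.2, y.2)))} := by
      simp only [Set.ofPred_or, Set.ofPred_exists, Set.ofPred_and, Set.ofPred_forall]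
      refine IsOpen.union (isOpen_iUnion fun j => IsOpen.inter (isOpen_iInter_of_finite fun k =>
        isOpen_iInter_of_finite fun _ => IsOpen.inter ?_ ?_) ?_) (isOpen_iInter_of_finite fun k => ?_)
      all_goals exact isOpen_lt (by fun_prop) (by fun_prop)
    refine hopen.mem_nhds ?_
    simp only [Set.mem_ofPred_eq, hΦd]
    by_cases h : ∃ j, Δ j (b0, z) = 0
    · obtain ⟨j, hj⟩ := h
      left
      refine ⟨j, fun k hk => ?_, ?_⟩
      · have := (hpos k (b0, z)).lt_of_ne' (hdis j k _ hk.symm hj)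
        rw [hj]
        exact ⟨by simpa using this, this⟩
      · have := hΔL j (b0, z)
        rw [hj] at this ⊢
        linarith
    · right
      exact fun k => (hpos k _).lt_of_ne' fun hk => h ⟨k, hk⟩
  have hSz' : ∀ᶠ p in 𝓝 (b0, b0), ∀ j z, Δ j ((p : B × B).2, S j (p.1, p.2, z)) = 0 →
      Δ j (p.1, z) = 0 := Filter.eventually_all.2 fun j => hSz j b0
  filter_upwards [hfar, hnear, hSz'] with p hp1 hp2 hp3 z hz k
  change Δ k (p.2, Φ (p.1, p.2, z)) ≠ 0
  by_cases hball : z ∈ Metric.closedBall (0 : M) (N b0 + 1)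
  · rcases hp2 z hball with ⟨j, h1, h2⟩ | h
    · by_cases hkj : k = j
      · subst hkj
        rw [hΦS k _ _ _ (fun l hl => (h1 l hl).1) h2]
        exact fun h => hz k (hp3 k z h)
      · exact (h1 k hkj).2.ne'
    · exact (h k).ne'
  · rw [mem_closedBall_zero_iff, not_le] at hball
    rw [hΦL _ _ _ (hp1.1.trans hball).le]
    exact fun h => absurd (hNz k _ _ h) (by linarith [hp1.2])
end Feat

end PESec
end


noncomputable section
open CategoryTheory

namespace PESec
open scoped unitInterval Topology

section Fib
set_option linter.unusedSectionVars false
variable {B0 B M : Type} [TopologicalSpace B0] [TopologicalSpace B] [NormedAddCommGroup M]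
  [NormedSpace ℝ M]

def jE (j : C(B0, B)) (G : Set (B × M)) : C({x : B0 × M // (j x.1, x.2) ∈ G}, {x : B × M // x ∈ G}) :=
  ⟨fun x => ⟨(j x.1.1, x.1.2), x.2⟩, by fun_prop⟩

/-- lift of a homotopy rel endpoints -/
theorem lift_htpy {G : Set (B × M)} (hT : Trans G) {e e' : {x : B × M // x ∈ G}} (w : Path e e')
    (δ : Path e.1.1 e'.1.1) (h : (w.map (continuous_fst.comp continuous_subtype_val)).Homotopic δ) :
    ∃ p : Path e.1.2 e'.1.2, ∃ hp : ∀ t, (δ t, p t) ∈ G,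
      w.Homotopic ⟨⟨fun t => ⟨(δ t, p t), hp t⟩, by fun_prop⟩, by ext <;> simp, by ext <;> simp⟩ := by
  obtain ⟨H⟩ := h
  obtain ⟨p, h1, h2, h3, -⟩ := hlp hT (D := I) ⟨fun x => H (x.2, x.1), by fun_prop⟩
    ⟨fun t => (w t).1.2, by fun_prop⟩ (by intro x; simp)
  simp only [ContinuousMap.coe_mk] at h1 h2 h3
  refine ⟨⟨⟨fun t => p (t, 1), by fun_prop⟩, ?_, ?_⟩, ?_, ?_⟩
  · simp only []
    rw [h3 0 (by intro s; simp) 1]; simp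
  · simp only []
    rw [h3 1 (by intro s; simp) 1]; simp
  · intro t
    have := h2 t 1
    simpa using this
  · refine ⟨⟨⟨⟨fun y => ⟨(H y, p (y.2, y.1)), h2 y.2 y.1⟩, by fun_prop⟩, ?_, ?_⟩, ?_⟩⟩
    · intro t
      ext
      · simp
      · simp [h1]
    · intro t
      ext
      · simp
      · simp
    · rintro s t (rfl | ht)
      · ext
        · simp
        · simpa using h3 0 (by intro s; simp) s
      · rw [Set.mem_singleton_iff] at ht
        subst ht
        ext
        · simp
        · simpa using h3 1 (by intro s; simp) s

theorem fib_full {j : C(B0, B)} (hj : PE j) {G : Set (B × M)} (hT : Trans G)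
    (x x' : {x : B0 × M // (j x.1, x.2) ∈ G}) (γ : Path (jE j G x) (jE j G x')) :
    ∃ δ : Path x x', (δ.map (jE j G).continuous).Homotopic γ := by
  obtain ⟨δ, hδ⟩ := (pe_iff.1 hj).2.1 x.1.1 x'.1.1
    (γ.map (continuous_fst.comp continuous_subtype_val))
  obtain ⟨p, hp, h⟩ := lift_htpy hT γ (δ.map j.continuous) hδ.symm
  exact ⟨⟨⟨fun t => ⟨(δ t, p t), hp t⟩, by fun_prop⟩, by ext; exacts [δ.source, p.source], by ext; exacts [δ.target, p.target]⟩, h.symm⟩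

theorem fib_loop {j : C(B0, B)} (hj : PE j) {G : Set (B × M)} (hT : Trans G) (sg : C(B, M))
    (hsg : ∀ b, (b, sg b) ∈ G) (b : B0)
    (w : Path (⟨(b, sg (j b)), hsg _⟩ : {x : B0 × M // (j x.1, x.2) ∈ G}) ⟨(b, sg (j b)), hsg _⟩)
    (hw : (w.map (jE j G).continuous).Homotopic (Path.refl _)) : w.Homotopic (Path.refl _) := by
  -- project and contract
  have h1 : (w.map (continuous_fst.comp continuous_subtype_val)).Homotopic (Path.refl b) := by
    apply (pe_iff.1 hj).2.2
    have := hw.map (⟨fun x => x.1.1, by fun_prop⟩ : C({x : B × M // x ∈ G}, B))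
    exact this
  obtain ⟨α, hα, hwα⟩ := lift_htpy (hT.comap j) w (Path.refl b) h1
  refine hwα.trans ?_
  have h2 := (hwα.symm.map (jE j G)).trans hw
  let bs := j b
  obtain ⟨Q, hQt, hQt', hQ0, hQ1⟩ : ∃ Q : C(I × I, {x : B × M // x ∈ G}),
      (∀ s, (Q (s, 0)).1 = (bs, sg bs)) ∧ (∀ s, (Q (s, 1)).1 = (bs, sg bs)) ∧
      (∀ t, (Q (0, t)).1 = (bs, α t)) ∧ (∀ t, (Q (1, t)).1 = (bs, sg bs)) := by
    obtain ⟨Q⟩ := h2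
    refine ⟨Q.toContinuousMap, fun s => ?_, fun s => ?_, fun t => ?_, fun t => ?_⟩
    · exact congrArg Subtype.val (Q.source s)
    · exact congrArg Subtype.val (Q.target s)
    · exact congrArg Subtype.val (Q.apply_zero t)
    · exact congrArg Subtype.val (Q.apply_one t)
  have : CompactSpace ({0, 1} : Set ℝ) :=
    isCompact_iff_compactSpace.1 (Set.toFinite _).isCompact
  let f : C((({0, 1} : Set ℝ) × I × I) × I, B) := ⟨fun y => (Q (⟨(1 - (y.2 : ℝ)) * (y.1.2.2 : ℝ), by
      have h1 := y.2.2; have h2 := y.1.2.2.2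
      exact ⟨mul_nonneg (by linarith [h1.2]) h2.1, mul_le_one₀ (by linarith [h1.1]) h2.1 h2.2⟩⟩,
      y.1.2.1)).1.1, by fun_prop⟩
  let p0 : C((({0, 1} : Set ℝ) × I × I), M) := ⟨fun y => (1 - (y.1 : ℝ)) • (Q (y.2.2, y.2.1)).1.2 +
    (y.1 : ℝ) • sg ((Q (y.2.2, y.2.1)).1.1), by fun_prop⟩
  have hf0 : ∀ x, f (x, 0) = (Q (x.2.2, x.2.1)).1.1 := by
    intro x
    simp [f]
  obtain ⟨p, k1, k2, k3, k4⟩ := hlp hT f p0 (by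
    rintro ⟨⟨ε, hε⟩, t, s⟩
    rw [hf0]
    rcases hε with rfl | hε
    · simp only [p0, ContinuousMap.coe_mk]
      convert (Q (s, t)).2 using 1
      ext <;> simp
    · rw [Set.mem_singleton_iff] at hε
      subst hε
      simp only [p0, ContinuousMap.coe_mk]
      convert hsg (Q (s, t)).1.1 using 1
      simp)
  have hf1 : ∀ x, f (x, 1) = bs := by
    intro x
    simp only [f, ContinuousMap.coe_mk]
    convert congrArg Prod.fst (hQ0 x.2.1) using 4
    simp
  let z0 : ({0, 1} : Set ℝ) := ⟨0, by simp⟩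
  let z1 : ({0, 1} : Set ℝ) := ⟨1, by simp⟩
  -- boundary
  have hb0 : ∀ (ε : ({0, 1} : Set ℝ)) s u, p ((ε, 0, s), u) = sg bs := by
    intro ε s u
    rw [k3]
    · simp only [p0, ContinuousMap.coe_mk, hQt]
      rw [← add_smul]; simp
    · intro s; simp [f, hQt]
  have hb1 : ∀ (ε : ({0, 1} : Set ℝ)) s u, p ((ε, 1, s), u) = sg bs := by
    intro ε s u
    rw [k3]
    · simp only [p0, ContinuousMap.coe_mk, hQt']
      rw [← add_smul]; simp
    · intro s; simp [f, hQt']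
  have hrow : ∀ ε t u, f ((ε, t, 0), u) = bs := by
    intro ε t u
    have e := congrArg Prod.fst (hQ0 t)
    simp only [f, ContinuousMap.coe_mk]
    convert e using 4
    simp
  have hα0 : ∀ t u, p ((z0, t, 0), u) = α t := by
    intro t u
    rw [k3]
    · simp [p0, z0, hQ0]
    · intro s; rw [hrow, hrow]
  have hsg0 : ∀ t u, p ((z1, t, 0), u) = sg bs := by
    intro t u
    rw [k3]
    · simp [p0, z1, hQ0]
    · intro s; rw [hrow, hrow]
  have hβ : ∀ t u, p ((z0, t, 1), u) = p ((z1, t, 1), u) := by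
    intro t u
    apply k4
    · intro s; simp [f]
    · simp [p0, z0, z1, hQ1]
  have hG : ∀ x, (bs, p (x, 1)) ∈ G := fun x => by
    have := k2 x 1
    rwa [hf1] at this
  -- the middle loop
  let β : Path (⟨(b, sg (j b)), hsg _⟩ : {x : B0 × M // (j x.1, x.2) ∈ G}) ⟨(b, sg (j b)), hsg _⟩ :=
    ⟨⟨fun t => ⟨(b, p ((z0, t, 1), 1)), hG _⟩, by fun_prop⟩,
      by ext <;> simp [hb0, bs], by ext <;> simp [hb1, bs]⟩
  refine Path.Homotopic.trans (p₁ := β) ?_ (Path.Homotopic.symm ?_)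
  · refine ⟨⟨⟨⟨fun y => ⟨(b, p ((z0, y.2, y.1), 1)), hG _⟩, by fun_prop⟩, ?_, ?_⟩, ?_⟩⟩
    · intro t; ext
      · simp
      · simp [hα0]
    · intro t; ext <;> simp [β]
    · rintro s t (rfl | ht)
      · ext
        · simp
        · simp [hb0, bs]
      · rw [Set.mem_singleton_iff] at ht
        subst ht
        ext
        · simp
        · simp [hb1, bs]
  · refine Path.Homotopic.symm ⟨⟨⟨⟨fun y => ⟨(b, p ((z1, y.2, unitInterval.symm y.1), 1)), hG _⟩, by fun_prop⟩, ?_, ?_⟩, ?_⟩⟩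
    · intro t; ext
      · simp [β]
      · simp [β, hβ]
    · intro t; ext
      · simp
      · simp [hsg0, bs]
    · rintro s t (rfl | ht)
      · ext
        · simp [β]
        · simp [hb0, bs]
      · rw [Set.mem_singleton_iff] at ht
        subst ht
        ext
        · simp [β]
        · simp [hb1, bs]

theorem fib {j : C(B0, B)} (hj : PE j) {G : Set (B × M)} (hT : Trans G) (sg : C(B, M))
    (hsg : ∀ b, (b, sg b) ∈ G)
    (hconn : ∀ b z, (j b, z) ∈ G → ∃ γ : Path (sg (j b)) z, ∀ t, (j b, γ t) ∈ G) : PE (jE j G) := by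
  refine pe_iff.2 ⟨?_, fib_full hj hT, ?_⟩
  · rintro ⟨⟨b, z⟩, hz⟩
    obtain ⟨b0, ⟨γ⟩⟩ := (pe_iff.1 hj).1 b
    obtain ⟨p, h1, h2, -⟩ := hlp hT (D := Unit) ⟨fun x => γ.symm x.2, by fun_prop⟩
      ⟨fun _ => z, by fun_prop⟩ (by intro x; simpa using hz)
    refine ⟨⟨(b0, p ((), 1)), by simpa using h2 () 1⟩, ⟨Path.symm ⟨⟨fun t => ⟨(γ.symm t, p ((), t)), h2 () t⟩, by fun_prop⟩, ?_, ?_⟩⟩⟩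
    · ext <;> simp [h1]
    · ext <;> simp [jE]
  · rintro ⟨⟨b, z⟩, hz⟩ x' δ δ' h
    obtain ⟨γ, hγ⟩ := hconn b z hz
    let κ : Path (⟨(b, sg (j b)), hsg _⟩ : {x : B0 × M // (j x.1, x.2) ∈ G}) ⟨(b, z), hz⟩ :=
      ⟨⟨fun t => ⟨(b, γ t), hγ t⟩, by fun_prop⟩, by ext <;> simp, by ext <;> simp⟩
    have key := fib_loop hj hT sg hsg b ((κ.trans δ).trans (κ.trans δ').symm) (by
      rw [Path.map_trans, Path.map_trans, ← Path.map_symm, Path.map_trans]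
      refine ((((Path.Homotopic.refl _).hcomp h).hcomp (Path.Homotopic.refl _)).trans ?_)
      exact Path.Homotopic.trans_symm _)
    rw [← pmk_eq, pmk_refl, pmk_trans, pmk_trans] at key
    rw [← pmk_eq]
    have k2 := pmk_symm_comp (κ.trans δ')
    rw [pmk_trans] at k2
    have k3 := congrArg (fun q => q ≫ pmk κ ≫ pmk δ') key
    simp only [Category.assoc] at k3
    rw [k2, Category.id_comp, Category.comp_id] at k3
    have k4 := congrArg (fun q => pmk κ.symm ≫ q) k3
    simp only [← Category.assoc, pmk_symm_comp, Category.id_comp] at k4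
    exact k4
end Fib

end PESec
end


noncomputable section
open CategoryTheory

namespace PESec
open scoped unitInterval Topology

section Geom
set_option linter.unusedSectionVars false
variable {M : Type} [NormedAddCommGroup M] [InnerProductSpace ℝ M]
variable {S : Type} [TopologicalSpace S]

abbrev Ob (M S : Type) := M × ℝ × S

def pw (o : Ob M S) (z : M) : ℝ := ‖z - o.1‖ ^ 2 - o.2.1
def ht (ν : C(S, M)) (o : Ob M S) (z : M) : ℝ := inner ℝ (z - o.1) (ν o.2.2)
def InK (ν : C(S, M)) (o : Ob M S) (z : M) : Prop := pw o z = 0 ∧ ht ν o z = 0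
def Dj (ν : C(S, M)) (o o' : Ob M S) : Prop :=
  ∀ z, ht ν o z = 0 → ht ν o' z = 0 → pw o z = pw o' z → 0 < pw o z
def Far (ν : C(S, M)) (o : Ob M S) (m : M) (R : ℝ) : Prop :=
  ∀ z, InK ν o z → 9 * R < ‖z - m‖ ^ 2

variable {ν : C(S, M)}

theorem Dj.symm {o o' : Ob M S} (h : Dj ν o o') : Dj ν o' o :=
  fun z h1 h2 h3 => h3 ▸ h z h2 h1 h3.symm

theorem chord (hdim : ∀ v : M, ∃ l : M, ‖l‖ = 1 ∧ inner ℝ l v = 0) (o : Ob M S) (z y : M)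
    (h1 : pw o z ≤ 0) (h2 : ht ν o z = 0) :
    ∃ z', InK ν o z' ∧ ‖z' - y‖ ^ 2 ≤ ‖z - y‖ ^ 2 - pw o z := by
  obtain ⟨l, hl, hlν, hly⟩ : ∃ l : M, ‖l‖ = 1 ∧ inner ℝ l (ν o.2.2) = 0 ∧ inner ℝ l (o.1 - y) ≤ 0 := by
    obtain ⟨l, hl, hlν⟩ := hdim (ν o.2.2)
    rcases le_total (inner ℝ l (o.1 - y)) 0 with h | h
    · exact ⟨l, hl, hlν, h⟩
    · exact ⟨-l, by simpa, by simpa using hlν, by rw [inner_neg_left]; linarith⟩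
  set b := inner ℝ l (z - o.1) with hb
  set τ := - pw o z with hτ
  have hτ0 : 0 ≤ τ := by linarith
  set t := - b + Real.sqrt (b ^ 2 + τ) with ht'
  have hsq : Real.sqrt (b ^ 2 + τ) ^ 2 = b ^ 2 + τ := Real.sq_sqrt (by positivity)
  have hq : t ^ 2 + 2 * b * t = τ := by rw [ht']; linear_combination hsq
  have ht0 : 0 ≤ t := by
    have : b ≤ Real.sqrt (b ^ 2 + τ) := by
      apply Real.le_sqrt_of_sq_le; linarith
    linarith
  have hexp : ∀ c : M, ‖z + t • l - c‖ ^ 2 = ‖z - c‖ ^ 2 + 2 * t * inner ℝ l (z - c) + t ^ 2 := by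
    intro c
    have : z + t • l - c = (z - c) + t • l := by abel
    rw [this, norm_add_sq_real, inner_smul_right, norm_smul, hl, real_inner_comm, Real.norm_eq_abs,
      mul_one, sq_abs]
    ring
  refine ⟨z + t • l, ⟨?_, ?_⟩, ?_⟩
  · simp only [pw] at *
    rw [hexp]
    linarith
  · simp only [ht] at *
    have : z + t • l - o.1 = (z - o.1) + t • l := by abel
    rw [this, inner_add_left, inner_smul_left, h2, hlν]
    simp
  · rw [hexp]
    have e : inner ℝ l (z - y) = b + inner ℝ l (o.1 - y) := by
      rw [hb, ← inner_add_right]; congr 1; abel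
    rw [e]
    have := mul_nonneg ht0 (neg_nonneg.2 hly)
    linarith

theorem exists_inK (hdim : ∀ v : M, ∃ l : M, ‖l‖ = 1 ∧ inner ℝ l v = 0) (o : Ob M S) (y : M)
    (hR : 0 ≤ o.2.1) : ∃ z', InK ν o z' ∧ ‖z' - y‖ ^ 2 ≤ ‖o.1 - y‖ ^ 2 + o.2.1 := by
  obtain ⟨z, h1, h2⟩ := chord (ν := ν) hdim o o.1 y (by simp [pw, hR]) (by simp [ht])
  refine ⟨z, h1, h2.trans ?_⟩
  simp [pw]

theorem Far.dj (hdim : ∀ v : M, ∃ l : M, ‖l‖ = 1 ∧ inner ℝ l v = 0) {o o' : Ob M S}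
    (hR : 0 < o'.2.1) (h : Far ν o o'.1 o'.2.1) : Dj ν o' o := by
  intro z h1 h2 h3
  by_contra hcon
  push Not at hcon
  obtain ⟨z', hz', h4⟩ := chord hdim o z o'.1 (h3 ▸ hcon) h2
  have := h z' hz'
  rw [← h3] at h4
  simp only [pw] at h4
  linarith

theorem Far.mono {o : Ob M S} {m : M} {R R' : ℝ} (h : Far ν o m R) (hR : R' ≤ R) : Far ν o m R' :=
  fun z hz => lt_of_le_of_lt (by linarith) (h z hz)

/-- decrease `R` by `τ` -/
def fl (τ : ℝ) (o : Ob M S) : Ob M S := (o.1, o.2.1 - τ, o.2.2)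

theorem pw_fl (τ : ℝ) (o : Ob M S) (z : M) : pw (fl τ o) z = pw o z + τ := by
  simp only [pw, fl]; ring

theorem ht_fl (τ : ℝ) (o : Ob M S) (z : M) : ht ν (fl τ o) z = ht ν o z := rfl

theorem Dj.fl {o o' : Ob M S} (h : Dj ν o o') {τ : ℝ} (hτ : 0 ≤ τ) : Dj ν (fl τ o) (fl τ o') := by
  intro z h1 h2 h3
  rw [pw_fl, pw_fl] at *
  have := h z h1 h2 (by linarith)
  linarith

theorem Far.fl (hdim : ∀ v : M, ∃ l : M, ‖l‖ = 1 ∧ inner ℝ l v = 0) {o : Ob M S} {m : M} {R : ℝ}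
    (h : Far ν o m R) {τ : ℝ} (hτ : 0 ≤ τ) : Far ν (fl τ o) m (R - τ) := by
  rintro z ⟨h1, h2⟩
  rw [pw_fl] at h1
  obtain ⟨z', hz', h4⟩ := chord hdim o z m (by linarith) h2
  have := h z' hz'
  linarith

theorem Far.dist (hdim : ∀ v : M, ∃ l : M, ‖l‖ = 1 ∧ inner ℝ l v = 0) {o o' : Ob M S}
    (h : Far ν o o'.1 o'.2.1) (h' : Far ν o' o.1 o.2.1) (hR : 0 ≤ o.2.1) (hR' : 0 ≤ o'.2.1) :
    4 * (o.2.1 + o'.2.1) < ‖o.1 - o'.1‖ ^ 2 := by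
  obtain ⟨z, hz, h1⟩ := exists_inK (ν := ν) hdim o o'.1 hR
  obtain ⟨z', hz', h1'⟩ := exists_inK (ν := ν) hdim o' o.1 hR'
  have := h z hz
  have := h' z' hz'
  rw [norm_sub_rev o'.1] at h1'
  linarith

def scl (μ : ℝ) (o : Ob M S) : Ob M S := (o.1, μ * o.2.1, o.2.2)

theorem Far.scl {o : Ob M S} {m : M} {R μ : ℝ} (h : Far ν o m R) (h0 : 0 < μ) (h1 : μ ≤ 1)
    (hR : 0 ≤ o.2.1) (hd : o.2.1 ≤ ‖o.1 - m‖ ^ 2) : Far ν (scl μ o) m (μ * R) := by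
  rintro z ⟨hz1, hz2⟩
  simp only [pw, ht, PESec.scl] at hz1 hz2
  set l := Real.sqrt μ with hl
  have hl2 : l ^ 2 = μ := Real.sq_sqrt h0.le
  have hl0 : 0 < l := Real.sqrt_pos.2 h0
  have hl1 : l ≤ 1 := (Real.sqrt_le_sqrt h1).trans (by simp)
  set y := l⁻¹ • (z - o.1) with hy
  set D := o.1 - m with hD
  have hzy : z - m = D + l • y := by
    rw [hy, smul_smul, mul_inv_cancel₀ hl0.ne', one_smul, hD]; abel
  have hyn : ‖y‖ ^ 2 = o.2.1 := by
    rw [hy, norm_smul, mul_pow, norm_inv, Real.norm_of_nonneg hl0.le, inv_pow, hl2]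
    have : ‖z - o.1‖ ^ 2 = μ * o.2.1 := by linarith
    rw [this, inv_mul_cancel_left₀ h0.ne']
  have hK : InK ν o (o.1 + y) := by
    constructor
    · simp only [pw, add_sub_cancel_left, hyn, sub_self]
    · simp only [ht, add_sub_cancel_left]
      rw [hy, inner_smul_left, hz2, mul_zero]
  have h3 := h _ hK
  have e : o.1 + y - m = D + y := by rw [hD]; abel
  rw [e, norm_add_sq_real] at h3
  rw [hzy, norm_add_sq_real, inner_smul_right, norm_smul, mul_pow, Real.norm_of_nonneg hl0.le, hyn]
  have hin : -(‖D‖ ^ 2) ≤ inner ℝ D y := by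
    have h4 := abs_real_inner_le_norm D y
    have h5 : ‖y‖ ≤ ‖D‖ := by
      apply le_of_sq_le_sq _ (norm_nonneg _)
      rw [hyn]; exact hd
    have h6 : ‖D‖ * ‖y‖ ≤ ‖D‖ * ‖D‖ := by gcongr
    have := neg_abs_le (inner ℝ D y)
    nlinarith
  rw [hyn] at h3
  have h7 : μ * (9 * R) < μ * (‖D‖ ^ 2 + 2 * inner ℝ D y + o.2.1) := by gcongr
  have h8 : 0 ≤ (1 - l) * ((1 + l) * ‖D‖ ^ 2 + 2 * l * inner ℝ D y) := by
    apply mul_nonneg (by linarith)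
    have : l * -(‖D‖ ^ 2) ≤ l * inner ℝ D y := by gcongr
    have := mul_nonneg (sub_nonneg.2 hl1) (sq_nonneg ‖D‖)
    nlinarith
  rw [← hl2] at h7 ⊢
  nlinarith

theorem far_small {o : Ob M S} {m : M} {ρ R : ℝ} (h : 25 * ρ < ‖o.1 - m‖ ^ 2)
    (h0 : o.2.1 ≤ ρ) (hR : R ≤ ρ) (hR0 : 0 < R) : Far ν o m R := by
  rintro z ⟨hz, -⟩
  simp only [pw] at hz
  have hρ : 0 < ρ := by linarith
  set e := Real.sqrt ρ
  have he : e ^ 2 = ρ := Real.sq_sqrt hρ.le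
  have he0 : 0 < e := Real.sqrt_pos.2 hρ
  have h1 : ‖z - o.1‖ ≤ e := by
    apply le_of_sq_le_sq _ he0.le
    linarith
  have h2 : 5 * e < ‖o.1 - m‖ := by
    apply lt_of_pow_lt_pow_left₀ 2 (norm_nonneg _)
    rw [mul_pow, he]; linarith
  have h3 : ‖o.1 - m‖ ≤ ‖z - m‖ + ‖z - o.1‖ := by
    have := norm_sub_le (z - m) (z - o.1)
    simpa using this
  have h4 : 4 * e < ‖z - m‖ := by linarith
  have h5 : (4 * e) ^ 2 < ‖z - m‖ ^ 2 := by gcongr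
  rw [mul_pow, he] at h5
  linarith

end Geom
end PESec
end


noncomputable section
open CategoryTheory

namespace PESec
open scoped unitInterval Topology

section Conf
set_option linter.unusedSectionVars false
variable {M : Type} [NormedAddCommGroup M] [InnerProductSpace ℝ M] [FiniteDimensional ℝ M]
variable {S S' : Type} [MetricSpace S] [MetricSpace S'] {β α : Type}

def IsY (ν : C(S, M)) (f : β → Ob M S) : Prop :=
  (∀ i, 0 < (f i).2.1) ∧ ∀ i j, i ≠ j → Dj ν (f i) (f j)

abbrev YC (ν : C(S, M)) (β : Type) := {f : β → Ob M S // IsY ν f}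

def IsX (ν : C(S, M)) (f : (β → Ob M S) × (α → M)) : Prop :=
  IsY ν f.1 ∧ Function.Injective f.2 ∧ ∀ i a, ¬ InK ν (f.1 i) (f.2 a)

abbrev XC (ν : C(S, M)) (β α : Type) := {f : (β → Ob M S) × (α → M) // IsX ν f}

def mapOb (φ : C(S', S)) (o : Ob M S') : Ob M S := (o.1, o.2.1, φ o.2.2)

theorem mapOb_cont (φ : C(S', S)) : Continuous (mapOb (M := M) φ) := by
  unfold mapOb; fun_prop

theorem YC.ev (ν : C(S, M)) (i : β) : Continuous fun f : YC ν β => f.1 i :=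
  (continuous_apply i).comp continuous_subtype_val

theorem XC.ev1 (ν : C(S, M)) (i : β) : Continuous fun f : XC ν β α => f.1.1 i :=
  (continuous_apply i).comp (continuous_fst.comp continuous_subtype_val)

theorem XC.ev2 (ν : C(S, M)) (i : α) : Continuous fun f : XC ν β α => f.1.2 i :=
  (continuous_apply i).comp (continuous_snd.comp continuous_subtype_val)

def jY (ν : C(S, M)) (φ : C(S', S)) (β : Type) : C(YC (ν.comp φ) β, YC ν β) :=
  ⟨fun f => ⟨fun i => mapOb φ (f.1 i), f.2⟩,
    Continuous.subtype_mk (continuous_pi fun i => (mapOb_cont φ).comp (YC.ev _ i)) _⟩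

def jX (ν : C(S, M)) (φ : C(S', S)) (β α : Type) : C(XC (ν.comp φ) β α, XC ν β α) :=
  ⟨fun f => ⟨(fun i => mapOb φ (f.1.1 i), f.1.2), f.2⟩,
    Continuous.subtype_mk ((continuous_pi fun i => (mapOb_cont φ).comp (XC.ev1 _ i)).prodMk
      (continuous_snd.comp continuous_subtype_val)) _⟩

variable {ν : C(S, M)}

theorem InK.norm_le {o : Ob M S} {z : M} (h : InK ν o z) : ‖z‖ < ‖o.1‖ + (o.2.1 + 1) := by
  have h1 : ‖z - o.1‖ ^ 2 = o.2.1 := by have := h.1; simp only [pw] at this; linarith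
  have h2 : ‖z‖ ≤ ‖o.1‖ + ‖z - o.1‖ := by
    have := norm_add_le o.1 (z - o.1)
    simpa using this
  nlinarith [sq_nonneg (‖z - o.1‖ - 1), norm_nonneg (z - o.1)]

theorem isOpen_far {Y : Type} [TopologicalSpace Y] {o : Y → Ob M S} (ho : Continuous o) {m : Y → M}
    (hm : Continuous m) {R : Y → ℝ} (hR : Continuous R) :
    IsOpen {y | Far ν (o y) (m y) (R y)} := by
  rw [isOpen_iff_eventually]
  intro y0 hy0
  let C : Y → ℝ := fun y => ‖(o y).1‖ + ((o y).2.1 + 1)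
  have hC : Continuous C := by fun_prop
  have h1 : ∀ᶠ y in 𝓝 y0, C y < C y0 + 1 :=
    hC.continuousAt.eventually_lt continuousAt_const (by simp)
  have h2 : ∀ᶠ y in 𝓝 y0, ∀ z ∈ Metric.closedBall (0 : M) (C y0 + 1),
      pw (o y) z ≠ 0 ∨ ht ν (o y) z ≠ 0 ∨ 9 * R y < ‖z - m y‖ ^ 2 := by
    refine (isCompact_closedBall _ _).eventually_forall_of_forall_eventually fun z _ => ?_
    have hopen : IsOpen {x : Y × M | pw (o x.1) x.2 ≠ 0 ∨ ht ν (o x.1) x.2 ≠ 0 ∨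
        9 * R x.1 < ‖x.2 - m x.1‖ ^ 2} := by
      refine IsOpen.union ?_ (IsOpen.union ?_ ?_)
      · exact isOpen_ne_fun (by unfold pw; fun_prop) continuous_const
      · exact isOpen_ne_fun (by unfold ht; fun_prop) continuous_const
      · exact isOpen_lt (f := fun x : Y × M => 9 * R x.1) (g := fun x => ‖x.2 - m x.1‖ ^ 2)
          (by fun_prop) (by fun_prop)
    refine hopen.mem_nhds ?_
    by_cases h : InK ν (o y0) z
    · exact Or.inr (Or.inr (hy0 z h))
    · simp only [InK, not_and_or] at h
      rcases h with h | h
      · exact Or.inl h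
      · exact Or.inr (Or.inl h)
  filter_upwards [h1, h2] with y h1 h2 z hz
  have := hz.norm_le
  rcases h2 z (mem_closedBall_zero_iff.2 (this.le.trans h1.le)) with h | h | h
  · exact absurd hz.1 h
  · exact absurd hz.2 h
  · exact h

theorem isY_of_far (hdim : ∀ v : M, ∃ l : M, ‖l‖ = 1 ∧ inner ℝ l v = 0) (J : Set β) {f : β → Ob M S}
    (h0 : ∀ i, 0 < (f i).2.1) (h1 : ∀ i ∈ J, ∀ j, j ≠ i → Far ν (f j) (f i).1 (f i).2.1)
    (h2 : ∀ i ∉ J, ∀ j ∉ J, i ≠ j → Dj ν (f i) (f j)) : IsY ν f := by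
  refine ⟨h0, fun i j hij => ?_⟩
  by_cases hi : i ∈ J
  · exact Far.dj hdim (h0 i) (h1 i hi j hij.symm)
  · by_cases hj : j ∈ J
    · exact (Far.dj hdim (h0 j) (h1 j hj i hij)).symm
    · exact h2 i hi j hj hij

def TI (ν : C(S, M)) (J : Set β) : Set (YC ν β) :=
  {f | ∀ i ∈ J, ∀ j, j ≠ i → Far ν (f.1 j) (f.1 i).1 (f.1 i).2.1}

def Oset (ν : C(S, M)) (i : β) : Set (YC ν β) :=
  {f | ∃ τ : ℝ, 0 ≤ τ ∧ (∀ k, τ < (f.1 k).2.1) ∧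
    ∀ j, j ≠ i → Far ν (fl τ (f.1 j)) (f.1 i).1 ((f.1 i).2.1 - τ)}

theorem fl_cont : Continuous fun x : ℝ × Ob M S => fl x.1 x.2 := by unfold fl; fun_prop

variable [Finite β]

theorem isOpen_Oaux (τ : ℝ) (i : β) : IsOpen {f : YC ν β | (∀ k, τ < (f.1 k).2.1) ∧
    ∀ j, j ≠ i → Far ν (fl τ (f.1 j)) (f.1 i).1 ((f.1 i).2.1 - τ)} := by
  rw [Set.ofPred_and]
  simp only [Set.ofPred_forall]
  refine IsOpen.inter (isOpen_iInter_of_finite fun k => ?_) (isOpen_iInter_of_finite fun j =>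
    isOpen_iInter_of_finite fun _ => ?_)
  · exact isOpen_lt continuous_const (YC.ev ν k).snd.fst
  · exact isOpen_far (fl_cont.comp (continuous_const.prodMk (YC.ev ν j))) (YC.ev ν i).fst
      ((YC.ev ν i).snd.fst.sub continuous_const)

theorem isOpen_Oset (i : β) : IsOpen (Oset (M := M) ν i) := by
  have : Oset (M := M) ν i = ⋃ τ : Set.Ici (0 : ℝ), {f : YC ν β | (∀ k, τ.1 < (f.1 k).2.1) ∧
    ∀ j, j ≠ i → Far ν (fl τ.1 (f.1 j)) (f.1 i).1 ((f.1 i).2.1 - τ)} := by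
    ext f
    simp only [Oset, Set.mem_iUnion, Subtype.exists, Set.mem_ofPred_eq, Set.mem_Ici, exists_prop]
  rw [this]
  exact isOpen_iUnion fun τ => isOpen_Oaux _ _

theorem Oset_cover [Nonempty β] (f : YC ν β) : ∃ i, f ∈ Oset ν i := by
  obtain ⟨i, hi⟩ := Finite.exists_min fun i => (f.1 i).2.1
  refine ⟨i, ?_⟩
  have h1 : ∀ᶠ x : M × ℝ in 𝓝 ((f.1 i).1, (f.1 i).2.1), ∀ j, j ≠ i →
      (pw (f.1 j) x.1 + x.2 ≠ 0 ∨ ht ν (f.1 j) x.1 ≠ 0) := by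
    refine Filter.eventually_all.2 fun j => ?_
    by_cases hj : j = i
    · simp [hj]
    have hopen : IsOpen {x : M × ℝ | pw (f.1 j) x.1 + x.2 ≠ 0 ∨ ht ν (f.1 j) x.1 ≠ 0} := by
      refine IsOpen.union ?_ ?_
      · exact isOpen_ne_fun (by unfold pw; fun_prop) continuous_const
      · exact isOpen_ne_fun (by unfold ht; fun_prop) continuous_const
    have := hopen.mem_nhds (x := ((f.1 i).1, (f.1 i).2.1)) (by
      by_contra hcon
      simp only [Set.mem_ofPred_eq, not_or, not_not] at hcon
      have := f.2.2 i j (Ne.symm hj) (f.1 i).1 (by simp [ht]) hcon.2 (by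
        have := hcon.1
        simp [pw] at this ⊢
        linarith)
      have h3 := f.2.1 i
      simp [pw] at this
      linarith)
    filter_upwards [this] with x hx _ using hx
  obtain ⟨r, hr, h⟩ := Metric.eventually_nhds_iff.1 h1
  set Ri := (f.1 i).2.1 with hRi
  have hRi0 : 0 < Ri := f.2.1 i
  obtain ⟨d, hd0, hd⟩ : ∃ d, 0 < d ∧ d < Ri ∧ d < r ∧ 9 * d < r ^ 2 := by
    have hr2 : 0 < r ^ 2 := by positivity
    refine ⟨min (Ri / 2) (min (r / 2) (r ^ 2 / 10)), by positivity, ?_, ?_, ?_⟩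
    · exact (min_le_left _ _).trans_lt (by linarith)
    · exact ((min_le_right _ _).trans (min_le_left _ _)).trans_lt (by linarith)
    · have := ((min_le_right (Ri / 2) _).trans (min_le_right (r / 2) (r ^ 2 / 10)))
      linarith
  refine ⟨Ri - d, by linarith, fun k => by have : Ri ≤ (f.1 k).2.1 := hi k; linarith, fun j hj z hz => ?_⟩
  have : r ≤ dist z (f.1 i).1 := by
    by_contra hcon
    push Not at hcon
    have h5 := h (y := (z, Ri - d)) (by
      rw [Prod.dist_eq, max_lt_iff]
      refine ⟨hcon, ?_⟩
      simp only [Real.dist_eq]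
      rw [abs_lt]; constructor <;> linarith) j hj
    rcases h5 with h5 | h5
    · have := hz.1
      rw [pw_fl] at this
      exact h5 this
    · exact h5 hz.2
  rw [dist_eq_norm] at this
  have : r ^ 2 ≤ ‖z - (f.1 i).1‖ ^ 2 := by gcongr
  linarith [hd.2.2]

theorem OI_iff {J : Set β} (hJ : J.Nonempty) (hdim : ∀ v : M, ∃ l : M, ‖l‖ = 1 ∧ inner ℝ l v = 0)
    (f : YC ν β) : f ∈ OI (Oset ν) J ↔ ∃ τ : ℝ, 0 ≤ τ ∧ (∀ k, τ < (f.1 k).2.1) ∧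
      ∀ i ∈ J, ∀ j, j ≠ i → Far ν (fl τ (f.1 j)) (f.1 i).1 ((f.1 i).2.1 - τ) := by
  constructor
  · intro h
    have : ∀ i : β, ∃ τ : ℝ, 0 ≤ τ ∧ (∀ k, τ < (f.1 k).2.1) ∧
      (i ∈ J → ∀ j, j ≠ i → Far ν (fl τ (f.1 j)) (f.1 i).1 ((f.1 i).2.1 - τ)) := by
      intro i
      by_cases hi : i ∈ J
      · obtain ⟨τ, h1, h2, h3⟩ := h i hi
        exact ⟨τ, h1, h2, fun _ => h3⟩
      · exact ⟨0, le_rfl, f.2.1, fun h => absurd h hi⟩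
    choose τ h1 h2 h3 using this
    have : Nonempty β := hJ.to_type
    obtain ⟨i0, hi0⟩ := Finite.exists_max τ
    refine ⟨τ i0, h1 _, h2 _, fun i hi j hj => ?_⟩
    have := (h3 i hi j hj).fl hdim (sub_nonneg.2 (hi0 i))
    convert this using 1
    · simp [fl]
    · ring
  · rintro ⟨τ, h1, h2, h3⟩ i hi
    exact ⟨τ, h1, h2, h3 i hi⟩

def flY (f : YC ν β) (τ : ℝ) (h0 : 0 ≤ τ) (h : ∀ k, τ < (f.1 k).2.1) : YC ν β :=
  ⟨fun i => fl τ (f.1 i), fun i => by have := h i; simp only [fl]; linarith,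
    fun i j hij => (f.2.2 i j hij).fl h0⟩

theorem TI_sub_OI (J : Set β) : TI ν J ⊆ OI (Oset (M := M) ν) J := by
  intro f hf i hi
  refine ⟨0, le_rfl, f.2.1, fun j hj => ?_⟩
  simpa [fl] using hf i hi j hj

def inclTO (ν : C(S, M)) (J : Set β) : C(TI ν J, OI (Oset ν) J) :=
  ⟨Set.inclusion (TI_sub_OI J), continuous_inclusion _⟩

theorem PE_inclTO (hdim : ∀ v : M, ∃ l : M, ‖l‖ = 1 ∧ inner ℝ l v = 0) {J : Set β} (hJ : J.Nonempty) :
    PE (inclTO ν J) := by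
  have := Fintype.ofFinite β
  have hflc : ∀ τ τ' : ℝ, ∀ o : Ob M S, fl τ (fl τ' o) = fl (τ + τ') o := by
    intro τ τ' o; simp only [fl]; congr 2; ring
  obtain ⟨τ, hτ⟩ := exists_continuous_forall_mem_convex_of_local_const (X := OI (Oset ν) J) (E := ℝ)
    (t := fun f => {τ | 0 ≤ τ ∧ (∀ k, τ < (f.1.1 k).2.1) ∧
      ∀ i ∈ J, ∀ j, j ≠ i → Far ν (fl τ (f.1.1 j)) (f.1.1 i).1 ((f.1.1 i).2.1 - τ)}) (by
      intro f
      apply Set.OrdConnected.convex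
      rw [Set.ordConnected_def]
      rintro a ⟨a1, a2, a3⟩ b ⟨b1, b2, b3⟩ c ⟨hc1, hc2⟩
      refine ⟨a1.trans hc1, fun k => hc2.trans_lt (b2 k), fun i hi j hj => ?_⟩
      have := (a3 i hi j hj).fl hdim (sub_nonneg.2 hc1)
      convert this using 1
      · simp [fl]
      · ring) (by
      intro f
      obtain ⟨c, h1, h2, h3⟩ := (OI_iff hJ hdim f.1).1 f.2
      refine ⟨c, ?_⟩
      have : ∀ᶠ g : OI (Oset ν) J in 𝓝 f, ∀ i, i ∈ J → ((∀ k, c < (g.1.1 k).2.1) ∧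
        ∀ j, j ≠ i → Far ν (fl c (g.1.1 j)) (g.1.1 i).1 ((g.1.1 i).2.1 - c)) := by
        refine Filter.eventually_all.2 fun i => ?_
        by_cases hi : i ∈ J
        · have := ((isOpen_Oaux (ν := ν) c i).preimage
            (continuous_subtype_val : Continuous fun g : OI (Oset ν) J => g.1)).mem_nhds
              (x := f) ⟨h2, h3 i hi⟩
          filter_upwards [this] with g hg _ using hg
        · simp [hi]
      obtain ⟨i0, hi0⟩ := hJ
      filter_upwards [this] with g hg
      exact ⟨h1, (hg i0 hi0).1, fun i hi => (hg i hi).2⟩)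
  have hτ0 : ∀ f, 0 ≤ τ f := fun f => (hτ f).1
  have hu : ∀ (u : I) f, 0 ≤ (u : ℝ) * τ f ∧ (u : ℝ) * τ f ≤ τ f := fun u f =>
    ⟨mul_nonneg u.2.1 (hτ0 f), mul_le_of_le_one_left (hτ0 f) u.2.2⟩
  have hcf : ∀ (Y : Type) [TopologicalSpace Y] (t : Y → ℝ) (f : Y → Ob M S), Continuous t → Continuous f →
    Continuous fun y => fl (t y) (f y) := fun Y _ t f h1 h2 => fl_cont.comp (h1.prodMk h2)
  refine PE.of_inverse _ ⟨fun f => ⟨flY f.1 (τ f) (hτ0 f) (hτ f).2.1, (hτ f).2.2⟩, ?_⟩ ?_ ?_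
  · refine Continuous.subtype_mk (Continuous.subtype_mk (continuous_pi fun i => ?_) _) _
    exact hcf _ _ _ (by fun_prop) ((YC.ev ν i).comp continuous_subtype_val)
  · -- on T
    refine ContinuousMap.Homotopic.symm ⟨⟨⟨fun x => ⟨flY x.2.1 ((x.1 : ℝ) * τ (inclTO ν J x.2)) (hu _ _).1
      (fun k => (hu _ _).2.trans_lt ((hτ _).2.1 k)), ?_⟩, ?_⟩, ?_, ?_⟩⟩
    · intro i hi j hj
      exact (x.2.2 i hi j hj).fl hdim (hu _ _).1
    · refine Continuous.subtype_mk (Continuous.subtype_mk (continuous_pi fun i => ?_) _) _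
      exact hcf _ _ _ (by fun_prop) ((YC.ev ν i).comp (continuous_subtype_val.comp continuous_snd))
    · intro f
      apply Subtype.ext; apply Subtype.ext
      funext i
      simp [flY, fl]
    · intro f
      apply Subtype.ext; apply Subtype.ext
      funext i
      simp [flY]
      rfl
  · refine ContinuousMap.Homotopic.symm ⟨⟨⟨fun x => ⟨flY x.2.1 ((x.1 : ℝ) * τ x.2) (hu _ _).1
      (fun k => (hu _ _).2.trans_lt ((hτ _).2.1 k)), ?_⟩, ?_⟩, ?_, ?_⟩⟩
    · rw [OI_iff hJ hdim]
      refine ⟨(1 - (x.1 : ℝ)) * τ x.2, mul_nonneg (by linarith [x.1.2.2]) (hτ0 _), fun k => ?_,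
        fun i hi j hj => ?_⟩
      · have := (hτ x.2).2.1 k
        simp only [flY, fl]
        linarith
      · have := (hτ x.2).2.2 i hi j hj
        simp only [flY]
        rw [hflc]
        have e1 : (1 - (x.1 : ℝ)) * τ x.2 + (x.1 : ℝ) * τ x.2 = τ x.2 := by ring
        have e2 : (fl ((x.1 : ℝ) * τ x.2) (x.2.1.1 i)).2.1 - (1 - (x.1 : ℝ)) * τ x.2 =
          (x.2.1.1 i).2.1 - τ x.2 := by simp only [fl]; ring
        rw [e1, e2]
        exact this
    · refine Continuous.subtype_mk (Continuous.subtype_mk (continuous_pi fun i => ?_) _) _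
      exact hcf _ _ _ (by fun_prop) ((YC.ev ν i).comp (continuous_subtype_val.comp continuous_snd))
    · intro f
      apply Subtype.ext; apply Subtype.ext
      funext i
      simp [flY, fl]
    · intro f
      apply Subtype.ext; apply Subtype.ext
      funext i
      simp [flY, inclTO]

end Conf
end PESec
end


noncomputable section
open CategoryTheory

namespace PESec
open scoped unitInterval Topology

theorem simplyConnected_pi {ι : Type} {S : Type} [TopologicalSpace S] [SimplyConnectedSpace S] :
    SimplyConnectedSpace (ι → S) := by
  rw [simply_connected_iff_paths_homotopic']
  refine ⟨inferInstance, ?_⟩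
  intro x y p₁ p₂
  have h : ∀ i, (p₁.map (continuous_apply i)).Homotopic (p₂.map (continuous_apply i)) := fun i =>
    SimplyConnectedSpace.paths_homotopic _ _
  exact ⟨Path.Homotopic.piHomotopy _ _ (fun i => (h i).some)⟩

abbrev Rp (ι : Type) := {r : ι → ℝ // ∀ i, 0 < r i}

theorem simplyConnected_Rp {ι : Type} : SimplyConnectedSpace (Rp ι) := by
  have hconv : Convex ℝ {r : ι → ℝ | ∀ i, 0 < r i} := by
    intro x hx y hy a b ha hb hab i
    have h1 := hx i
    have h2 := hy i
    simp only [Pi.add_apply, Pi.smul_apply, smul_eq_mul]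
    rcases ha.eq_or_lt with h | h
    · subst h
      have : b = 1 := by linarith
      subst this; simpa
    · have := mul_pos h h1
      have := mul_nonneg hb h2.le
      linarith
  have := hconv.contractibleSpace ⟨fun _ => 1, fun _ => one_pos⟩
  exact (inferInstance : SimplyConnectedSpace {r : ι → ℝ | ∀ i, 0 < r i})

section TE
set_option linter.unusedSectionVars false
variable {M : Type} [NormedAddCommGroup M] [InnerProductSpace ℝ M] [FiniteDimensional ℝ M]
variable {S S' : Type} [MetricSpace S] [MetricSpace S'] {β : Type} [Finite β]

abbrev EJ (ν : C(S, M)) (J : Set β) := XC ν {j // j ∉ J} J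
abbrev FJ (ν : C(S, M)) (J : Set β) := (EJ ν J × (J → S)) × Rp J

variable {ν : C(S, M)}

theorem TI_isX (hdim : ∀ v : M, ∃ l : M, ‖l‖ = 1 ∧ inner ℝ l v = 0) (J : Set β) (f : TI ν J) :
    IsX ν ((fun j => f.1.1 j.1, fun i => (f.1.1 i.1).1) : ({j // j ∉ J} → Ob M S) × (J → M)) := by
  refine ⟨⟨fun i => f.1.2.1 i.1, fun i j hij => f.1.2.2 _ _ fun h => hij (Subtype.ext h)⟩, ?_, ?_⟩
  · intro i k hik
    by_contra hne
    have hne' : i.1 ≠ k.1 := fun h => hne (Subtype.ext h)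
    have := Far.dist hdim (f.2 k.1 k.2 i.1 hne') (f.2 i.1 i.2 k.1 hne'.symm) (f.1.2.1 _).le (f.1.2.1 _).le
    simp only at hik
    rw [hik] at this
    have h1 := f.1.2.1 i.1
    have h2 := f.1.2.1 k.1
    simp at this
    linarith
  · intro i a hK
    have := f.2 a.1 a.2 i.1 (fun h => i.2 (h ▸ a.2)) _ hK
    have h2 := f.1.2.1 a.1
    simp at this
    linarith

def piTE (ν : C(S, M)) (hdim : ∀ v : M, ∃ l : M, ‖l‖ = 1 ∧ inner ℝ l v = 0) (J : Set β) :
    C(TI ν J, EJ ν J) :=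
  ⟨fun f => ⟨(fun j => f.1.1 j.1, fun i => (f.1.1 i.1).1), TI_isX hdim J f⟩,
    Continuous.subtype_mk ((continuous_pi fun j : {j // j ∉ J} => (YC.ev ν j.1).comp continuous_subtype_val).prodMk
      (continuous_pi fun j : J => ((YC.ev ν j.1).comp continuous_subtype_val).fst)) _⟩

def PsiTE (ν : C(S, M)) (hdim : ∀ v : M, ∃ l : M, ‖l‖ = 1 ∧ inner ℝ l v = 0) (J : Set β) :
    C(TI ν J, FJ ν J) :=
  ⟨fun f => ((piTE ν hdim J f, fun i => (f.1.1 i.1).2.2), ⟨fun i => (f.1.1 i.1).2.1, fun i => f.1.2.1 _⟩),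
    (((piTE ν hdim J).continuous.prodMk
      (continuous_pi fun j : J => ((YC.ev ν j.1).comp continuous_subtype_val).snd.snd)).prodMk
      (Continuous.subtype_mk (continuous_pi fun j : J => ((YC.ev ν j.1).comp continuous_subtype_val).snd.fst) _))⟩

theorem exists_rho (ν : C(S, M)) (J : Set β) : ∃ ρ : C(EJ ν J, ℝ), ∀ e, 0 < ρ e ∧
    (∀ i i', i ≠ i' → 25 * ρ e < ‖e.1.2 i - e.1.2 i'‖ ^ 2) ∧ ∀ j i, Far ν (e.1.1 j) (e.1.2 i) (ρ e) := by
  have := Fintype.ofFinite β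
  classical
  obtain ⟨ρ, hρ⟩ := exists_continuous_forall_mem_convex_of_local_const (X := EJ ν J) (E := ℝ)
    (t := fun e => {r | 0 < r ∧
      (∀ i i', i ≠ i' → 25 * r < ‖e.1.2 i - e.1.2 i'‖ ^ 2) ∧ ∀ j i, Far ν (e.1.1 j) (e.1.2 i) r}) (by
    intro e
    apply Set.OrdConnected.convex
    rw [Set.ordConnected_def]
    rintro a ⟨a1, a2, a3⟩ b ⟨b1, b2, b3⟩ c ⟨hc1, hc2⟩
    exact ⟨a1.trans_le hc1, fun i i' h => lt_of_le_of_lt (by linarith) (b2 i i' h),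
      fun j i => (b3 j i).mono hc2⟩) (by
    intro e
    have h1 : ∀ᶠ r : ℝ in 𝓝[>] 0, ∀ i i', i ≠ i' → 25 * r < ‖e.1.2 i - e.1.2 i'‖ ^ 2 := by
      refine Filter.eventually_all.2 fun i => Filter.eventually_all.2 fun i' => ?_
      by_cases h : i = i'
      · simp [h]
      · have hp : 0 < ‖e.1.2 i - e.1.2 i'‖ ^ 2 := by
          have : e.1.2 i - e.1.2 i' ≠ 0 := sub_ne_zero.2 fun hh => h (e.2.2.1 hh)
          positivity
        have : ∀ᶠ r : ℝ in 𝓝 0, 25 * r < ‖e.1.2 i - e.1.2 i'‖ ^ 2 :=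
          ContinuousAt.eventually_lt (by fun_prop) continuousAt_const (by simpa using hp)
        filter_upwards [nhdsWithin_le_nhds this] with r hr _ using hr
    have h2 : ∀ᶠ r : ℝ in 𝓝[>] 0, ∀ j i, Far ν (e.1.1 j) (e.1.2 i) r := by
      refine Filter.eventually_all.2 fun j => Filter.eventually_all.2 fun i => ?_
      have := (isOpen_far (ν := ν) (Y := ℝ) (o := fun _ => e.1.1 j) (m := fun _ => e.1.2 i) (R := fun r => r)
        continuous_const continuous_const continuous_id).mem_nhds (x := (0 : ℝ)) (by
          intro z hz
          have hne : z - e.1.2 i ≠ 0 := sub_ne_zero.2 fun h => e.2.2.2 j i (h ▸ hz)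
          have : 0 < ‖z - e.1.2 i‖ ^ 2 := by positivity
          simpa using this)
      exact nhdsWithin_le_nhds this
    obtain ⟨r, hr1, hr2, hr0⟩ := (h1.and (h2.and self_mem_nhdsWithin)).exists
    refine ⟨r, ?_⟩
    have h3 : ∀ᶠ e' in 𝓝 e, ∀ i i', i ≠ i' → 25 * r < ‖e'.1.2 i - e'.1.2 i'‖ ^ 2 := by
      refine Filter.eventually_all.2 fun i => Filter.eventually_all.2 fun i' => ?_
      by_cases h : i = i'
      · simp [h]
      · have : ∀ᶠ e' in 𝓝 e, 25 * r < ‖e'.1.2 i - e'.1.2 i'‖ ^ 2 :=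
          ContinuousAt.eventually_lt continuousAt_const
            ((((XC.ev2 ν i).sub (XC.ev2 ν i')).norm.pow 2).continuousAt) (hr1 i i' h)
        filter_upwards [this] with r hr _ using hr
    have h4 : ∀ᶠ e' in 𝓝 e, ∀ j i, Far ν (e'.1.1 j) (e'.1.2 i) r := by
      refine Filter.eventually_all.2 fun j => Filter.eventually_all.2 fun i => ?_
      exact (isOpen_far (ν := ν) (XC.ev1 ν j) (XC.ev2 ν i) continuous_const).mem_nhds (hr2 j i)
    filter_upwards [h3, h4] with e' h3 h4 using ⟨hr0, h3, h4⟩)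
  exact ⟨ρ, hρ⟩

open Classical in
theorem PE_PsiTE (hdim : ∀ v : M, ∃ l : M, ‖l‖ = 1 ∧ inner ℝ l v = 0) (J : Set β) :
    PE (PsiTE ν hdim J) := by
  have := Fintype.ofFinite β
  obtain ⟨ρ, hρ⟩ := exists_rho ν J
  let μ : FJ ν J → ℝ := fun x => ρ x.1.1 / (ρ x.1.1 + ∑ i, x.2.1 i)
  have hsum : ∀ x : FJ ν J, ∀ i, x.2.1 i ≤ ∑ i, x.2.1 i := fun x i =>
    Finset.single_le_sum (f := x.2.1) (fun i _ => (x.2.2 i).le) (Finset.mem_univ i)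
  have hsum0 : ∀ x : FJ ν J, 0 ≤ ∑ i, x.2.1 i := fun x => Finset.sum_nonneg fun i _ => (x.2.2 i).le
  have hden : ∀ x : FJ ν J, 0 < ρ x.1.1 + ∑ i, x.2.1 i := fun x => by
    have := (hρ x.1.1).1
    have := hsum0 x
    linarith
  have hμc : Continuous μ := by
    have h1 : Continuous fun x : FJ ν J => ρ x.1.1 := by fun_prop
    have h2 : Continuous fun x : FJ ν J => ∑ i, x.2.1 i :=
      continuous_finsetSum _ fun i _ => (continuous_apply i).comp (continuous_subtype_val.comp continuous_snd)
    exact h1.div (h1.add h2) fun x => (hden x).ne'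
  have hμ0 : ∀ x, 0 < μ x := fun x => div_pos (hρ _).1 (hden x)
  have hμ1 : ∀ x, μ x ≤ 1 := fun x => (div_le_one (hden x)).2 (by have := hsum0 x; linarith)
  have hμr : ∀ x i, μ x * x.2.1 i ≤ ρ x.1.1 := by
    intro x i
    simp only [μ]
    rw [div_mul_eq_mul_div, div_le_iff₀ (hden x)]
    have := (hρ x.1.1).1
    gcongr
    have := hsum x i
    linarith
  have hl : ∀ (u : I) x, 0 < (1 - (u : ℝ)) + u * μ x ∧ (1 - (u : ℝ)) + u * μ x ≤ 1 := by
    intro u x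
    have h0 := u.2.1
    have h1 := u.2.2
    have := hμ0 x
    have := hμ1 x
    constructor
    · rcases h0.eq_or_lt with h | h
      · rw [← h]; simp
      · have := mul_pos h (hμ0 x); linarith
    · nlinarith
  let θ : FJ ν J → β → Ob M S := fun x k =>
    if h : k ∈ J then (x.1.1.1.2 ⟨k, h⟩, μ x * x.2.1 ⟨k, h⟩, x.1.2 ⟨k, h⟩) else x.1.1.1.1 ⟨k, h⟩
  have hθp : ∀ x k (h : k ∈ J), θ x k = (x.1.1.1.2 ⟨k, h⟩, μ x * x.2.1 ⟨k, h⟩, x.1.2 ⟨k, h⟩) :=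
    fun x k h => dif_pos h
  have hθn : ∀ x k (h : k ∉ J), θ x k = x.1.1.1.1 ⟨k, h⟩ := fun x k h => dif_neg h
  have hθ0 : ∀ x k, 0 < (θ x k).2.1 := by
    intro x k
    by_cases h : k ∈ J
    · rw [hθp x k h]; exact mul_pos (hμ0 x) (x.2.2 _)
    · rw [hθn x k h]; exact x.1.1.2.1.1 _
  have hθfar : ∀ x, ∀ i ∈ J, ∀ j, j ≠ i → Far ν (θ x j) (θ x i).1 (θ x i).2.1 := by
    intro x i hi j hj
    by_cases h : j ∈ J
    · have hne : (⟨j, h⟩ : J) ≠ ⟨i, hi⟩ := fun hh => hj (congrArg Subtype.val hh)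
      rw [hθp x i hi, hθp x j h]
      exact far_small (ρ := ρ x.1.1) ((hρ x.1.1).2.1 _ _ hne) (hμr _ _) (hμr _ _)
        (mul_pos (hμ0 x) (x.2.2 _))
    · rw [hθp x i hi, hθn x j h]
      exact ((hρ x.1.1).2.2 _ _).mono (hμr _ _)
  have hθY : ∀ x, IsY ν (θ x) := by
    intro x
    refine isY_of_far hdim J (hθ0 x) (hθfar x) fun i hi j hj hij => ?_
    rw [hθn x i hi, hθn x j hj]
    exact x.1.1.2.1.2 _ _ fun h => hij (congrArg Subtype.val h)
  have hθc : Continuous θ := by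
    refine continuous_pi fun k => ?_
    by_cases h : k ∈ J
    · simp only [hθp _ k h]
      exact ((XC.ev2 ν _).comp (continuous_fst.comp continuous_fst)).prodMk
        ((hμc.mul ((continuous_apply _).comp (continuous_subtype_val.comp continuous_snd))).prodMk
          ((continuous_apply _).comp (continuous_snd.comp continuous_fst)))
    · simp only [hθn _ k h]
      exact (XC.ev1 ν _).comp (continuous_fst.comp continuous_fst)
  let Θ : C(FJ ν J, TI ν J) := ⟨fun x => ⟨⟨θ x, hθY x⟩, hθfar x⟩,
    Continuous.subtype_mk (Continuous.subtype_mk hθc _) _⟩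
  -- scaling on T
  let sc : I × TI ν J → β → Ob M S := fun x k => if k ∈ J then
    scl ((1 - (x.1 : ℝ)) + x.1 * μ (PsiTE ν hdim J x.2)) (x.2.1.1 k) else x.2.1.1 k
  have hsp : ∀ x k, k ∈ J → sc x k =
    scl ((1 - (x.1 : ℝ)) + x.1 * μ (PsiTE ν hdim J x.2)) (x.2.1.1 k) := fun x k h => if_pos h
  have hsn : ∀ x k, k ∉ J → sc x k = x.2.1.1 k := fun x k h => if_neg h
  have hs0 : ∀ x k, 0 < (sc x k).2.1 := by
    intro x k
    by_cases h : k ∈ J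
    · rw [hsp x k h]; exact mul_pos (hl _ _).1 (x.2.1.2.1 _)
    · rw [hsn x k h]; exact x.2.1.2.1 _
  have hsfar : ∀ x, ∀ i ∈ J, ∀ j, j ≠ i → Far ν (sc x j) (sc x i).1 (sc x i).2.1 := by
    intro x i hi j hj
    have hF := x.2.2 i hi j hj
    by_cases h : j ∈ J
    · have hF' := x.2.2 j h i hj.symm
      have := Far.dist hdim hF hF' (x.2.1.2.1 _).le (x.2.1.2.1 _).le
      have h1 := x.2.1.2.1 i
      have h2 := x.2.1.2.1 j
      rw [hsp x i hi, hsp x j h]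
      exact hF.scl (hl _ _).1 (hl _ _).2 h2.le (by linarith)
    · rw [hsp x i hi, hsn x j h]
      exact hF.mono (mul_le_of_le_one_left (x.2.1.2.1 _).le (hl _ _).2)
  have hsY : ∀ x, IsY ν (sc x) := by
    intro x
    refine isY_of_far hdim J (hs0 x) (hsfar x) fun i hi j hj hij => ?_
    rw [hsn x i hi, hsn x j hj]
    exact x.2.1.2.2 _ _ hij
  have hsc : Continuous sc := by
    refine continuous_pi fun k => ?_
    have hk : Continuous fun x : I × TI ν J => x.2.1.1 k :=
      (YC.ev ν k).comp (continuous_subtype_val.comp continuous_snd)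
    by_cases h : k ∈ J
    · simp only [hsp _ k h, scl]
      refine hk.fst.prodMk (Continuous.prodMk (Continuous.mul ?_ hk.snd.fst) hk.snd.snd)
      have : Continuous fun x : I × TI ν J => μ (PsiTE ν hdim J x.2) := by fun_prop
      fun_prop
    · simpa only [hsn _ k h] using hk
  refine PE.of_inverse _ Θ ?_ ?_
  · refine ContinuousMap.Homotopic.symm ⟨⟨⟨fun x => ⟨⟨sc x, hsY x⟩, hsfar x⟩,
      Continuous.subtype_mk (Continuous.subtype_mk hsc _) _⟩, ?_, ?_⟩⟩
    · intro f
      apply Subtype.ext; apply Subtype.ext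
      funext k
      by_cases h : k ∈ J
      · simp [hsp _ k h, scl]
      · simp [hsn _ k h]
    · intro f
      apply Subtype.ext; apply Subtype.ext
      funext k
      by_cases h : k ∈ J
      · simp only [hsp _ k h, scl, ContinuousMap.comp_apply]
        change _ = θ _ k
        rw [hθp _ k h]
        simp [PsiTE, piTE]
      · simp only [hsn _ k h, ContinuousMap.comp_apply]
        change _ = θ _ k
        rw [hθn _ k h]
        simp [PsiTE, piTE]
  · refine ContinuousMap.Homotopic.symm ⟨⟨⟨fun x => (x.2.1, ⟨fun i =>
      ((1 - (x.1 : ℝ)) + x.1 * μ x.2) * x.2.2.1 i, fun i => mul_pos (hl _ _).1 (x.2.2.2 _)⟩), ?_⟩, ?_, ?_⟩⟩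
    · refine Continuous.prodMk (by fun_prop) (Continuous.subtype_mk (continuous_pi fun i => ?_) _)
      refine Continuous.mul (by fun_prop) ?_
      exact (continuous_apply _).comp (continuous_subtype_val.comp (continuous_snd.comp continuous_snd))
    · intro x
      refine Prod.ext rfl (Subtype.ext ?_)
      funext i
      simp
    · rintro x
      refine Prod.ext (Prod.ext (Subtype.ext (Prod.ext ?_ ?_)) ?_) (Subtype.ext ?_)
      · funext j
        exact (hθn x j.1 j.2).symm
      · funext i
        exact (congrArg Prod.fst (hθp x i.1 i.2)).symm
      · funext i
        exact (congrArg (fun o => o.2.2) (hθp x i.1 i.2)).symm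
      · funext i
        refine Eq.trans ?_ (congrArg (fun o => o.2.1) (hθp x i.1 i.2)).symm
        simp

theorem PE_piTE [SimplyConnectedSpace S] (hdim : ∀ v : M, ∃ l : M, ‖l‖ = 1 ∧ inner ℝ l v = 0)
    (J : Set β) : PE (piTE ν hdim J) := by
  have := simplyConnected_pi (ι := J) (S := S)
  have := simplyConnected_Rp (ι := J)
  exact (PE.fst (X := EJ ν J) (Y := J → S)).comp ((PE.fst (X := EJ ν J × (J → S)) (Y := Rp J)).comp
    (PE_PsiTE hdim J))

end TE
end PESec
end


noncomputable section
open CategoryTheory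

namespace PESec
open scoped unitInterval Topology

section
set_option linter.unusedSectionVars false
variable {M : Type} [NormedAddCommGroup M] [InnerProductSpace ℝ M] [FiniteDimensional ℝ M]
variable {S S' : Type} [MetricSpace S] [MetricSpace S'] {β : Type} [Finite β]

def jT (ν : C(S, M)) (φ : C(S', S)) (J : Set β) : C(TI (ν.comp φ) J, TI ν J) :=
  ⟨fun f => ⟨jY ν φ β f.1, f.2⟩,
    Continuous.subtype_mk ((jY ν φ β).continuous.comp continuous_subtype_val) _⟩

theorem PE_jY_of [SimplyConnectedSpace S] [SimplyConnectedSpace S'] (ν : C(S, M)) (φ : C(S', S))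
    (hdim : ∀ v : M, ∃ l : M, ‖l‖ = 1 ∧ inner ℝ l v = 0) [Nonempty β]
    (h : ∀ J : Set β, J.Nonempty → PE (jX ν φ {j // j ∉ J} J)) : PE (jY ν φ β) := by
  refine glue (Oset ν) isOpen_Oset Oset_cover fun J hJ => ?_
  have h1 : PE (jT ν φ J) := by
    refine PE.of_comp_right (PE_piTE (ν := ν) hdim J) ?_
    exact (h J hJ).comp (PE_piTE (ν := ν.comp φ) hdim J)
  refine PE.of_comp_left (PE_inclTO (ν := ν.comp φ) hdim hJ) ?_
  exact (PE_inclTO (ν := ν) hdim hJ).comp h1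

end
end PESec
end


noncomputable section
open CategoryTheory

namespace PESec
open scoped unitInterval Topology

section Rot
variable {M : Type} [NormedAddCommGroup M] [InnerProductSpace ℝ M]

def Rot (n n' x : M) : M :=
  x - (inner ℝ x (n + n') / max (1 + inner ℝ n n') (1 / 2)) • (n + n') + (2 * inner ℝ x n) • n'

theorem Rot_self {n : M} (hn : ‖n‖ = 1) (x : M) : Rot n n x = x := by
  have h : inner ℝ n n = (1 : ℝ) := by rw [real_inner_self_eq_norm_sq, hn]; norm_num
  have h2 : max (1 + 1 : ℝ) (1 / 2) = 2 := by norm_num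
  rw [Rot, h, h2, inner_add_right, ← two_smul ℝ n, smul_smul]
  have : (inner ℝ x n + inner ℝ x n) / 2 * 2 = 2 * inner ℝ x n := by ring
  rw [this]; abel

theorem Rot_inner {n n' : M} (hn' : ‖n'‖ = 1) (hc : 1 / 2 ≤ 1 + inner ℝ n n') (x : M) :
    inner ℝ (Rot n n' x) n' = inner ℝ x n := by
  have h' : inner ℝ n' n' = (1 : ℝ) := by rw [real_inner_self_eq_norm_sq, hn']; norm_num
  have hc0 : 1 + inner ℝ n n' ≠ 0 := by intro h; rw [h] at hc; norm_num at hc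
  rw [Rot, max_eq_left hc, inner_add_left, inner_sub_left, inner_smul_left, inner_smul_left,
    inner_add_left, h', inner_add_right]
  simp only [conj_trivial]
  field_simp
  ring

theorem Rot_norm {n n' : M} (hn : ‖n‖ = 1) (hn' : ‖n'‖ = 1) (hc : 1 / 2 ≤ 1 + inner ℝ n n') (x : M) :
    ‖Rot n n' x‖ ^ 2 = ‖x‖ ^ 2 := by
  have h : inner ℝ n n = (1 : ℝ) := by rw [real_inner_self_eq_norm_sq, hn]; norm_num
  have h' : inner ℝ n' n' = (1 : ℝ) := by rw [real_inner_self_eq_norm_sq, hn']; norm_num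
  have hc0 : 1 + inner ℝ n n' ≠ 0 := by intro h; rw [h] at hc; norm_num at hc
  rw [← real_inner_self_eq_norm_sq, ← real_inner_self_eq_norm_sq, Rot, max_eq_left hc]
  simp only [inner_add_left, inner_sub_left, inner_smul_left, inner_add_right, inner_sub_right,
    inner_smul_right, conj_trivial, h, h', real_inner_comm n n', real_inner_comm n x, real_inner_comm n' x]
  have hc1 : 1 + inner ℝ n' n ≠ 0 := by rwa [real_inner_comm]
  field_simp
  ring

theorem Rot_cont : Continuous fun x : M × M × M => Rot x.1 x.2.1 x.2.2 := by
  unfold Rot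
  have : Continuous fun x : M × M × M => inner ℝ x.2.2 (x.1 + x.2.1) / max (1 + inner ℝ x.1 x.2.1) (1 / 2 : ℝ) := by
    refine Continuous.div (by fun_prop) (by fun_prop) fun x => ?_
    have := le_max_right (1 + inner ℝ x.1 x.2.1) (1 / 2 : ℝ)
    intro h; rw [h] at this; norm_num at this
  fun_prop

end Rot

section Fib
set_option linter.unusedSectionVars false
variable {M : Type} [NormedAddCommGroup M] [InnerProductSpace ℝ M] [FiniteDimensional ℝ M]
variable {S S' : Type} [MetricSpace S] [MetricSpace S'] {β α : Type}

def GX (ν : C(S, M)) (β α : Type) : Set (XC ν β α × M) :=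
  {x | (∀ i, ¬ InK ν (x.1.1.1 i) x.2) ∧ ∀ a, x.2 ≠ x.1.1.2 a}

def DX (ν : C(S, M)) : β ⊕ α → XC ν β α × M → ℝ
  | .inl i, x => |pw (x.1.1.1 i) x.2| + |ht ν (x.1.1.1 i) x.2|
  | .inr a, x => ‖x.2 - x.1.1.2 a‖

theorem DX_inl {ν : C(S, M)} (i : β) (x : XC ν β α × M) : DX ν (.inl i) x = 0 ↔ InK ν (x.1.1.1 i) x.2 := by
  simp only [DX, InK]
  constructor
  · intro h
    have h1 := abs_nonneg (pw (x.1.1.1 i) x.2)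
    have h2 := abs_nonneg (ht ν (x.1.1.1 i) x.2)
    exact ⟨abs_eq_zero.1 (by linarith), abs_eq_zero.1 (by linarith)⟩
  · rintro ⟨h1, h2⟩; simp [h1, h2]

theorem DX_inr {ν : C(S, M)} (a : α) (x : XC ν β α × M) : DX ν (.inr a) x = 0 ↔ x.2 = x.1.1.2 a := by
  simp only [DX, norm_eq_zero, sub_eq_zero]

theorem GX_eq (ν : C(S, M)) : GX ν β α = {x | ∀ j, DX ν j x ≠ 0} := by
  ext x
  simp only [GX, Set.mem_ofPred_eq, Sum.forall, ne_eq, DX_inl, DX_inr]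

def SX (ν : C(S, M)) : β ⊕ α → XC ν β α × XC ν β α × M → M
  | .inl i, x => (x.2.1.1.1 i).1 + Real.sqrt ((x.2.1.1.1 i).2.1 / (x.1.1.1 i).2.1) •
      Rot (ν (x.1.1.1 i).2.2) (ν (x.2.1.1.1 i).2.2) (x.2.2 - (x.1.1.1 i).1)
  | .inr a, x => x.2.2 + (x.2.1.1.2 a - x.1.1.2 a)

theorem pw_cont : Continuous fun x : Ob M S × M => pw x.1 x.2 := by unfold pw; fun_prop
theorem ht_cont (ν : C(S, M)) : Continuous fun x : Ob M S × M => ht ν x.1 x.2 := by unfold ht; fun_prop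

theorem trans_GX [Finite β] [Finite α] (ν : C(S, M)) (hν : ∀ s, ‖ν s‖ = 1) : Trans (GX ν β α) ∧
    ∃ N : XC ν β α → ℝ, Continuous N ∧ (∀ b, 0 ≤ N b) ∧ ∀ j b z, DX ν j (b, z) = 0 → ‖z‖ < N b := by
  have := Fintype.ofFinite β
  have := Fintype.ofFinite α
  let N : XC ν β α → ℝ := fun b => 1 + ∑ i, (‖(b.1.1 i).1‖ + ((b.1.1 i).2.1 + 1)) + ∑ a, ‖b.1.2 a‖
  have hNc : Continuous N := by
    refine (continuous_const.add (continuous_finsetSum _ fun i _ => ?_)).add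
      (continuous_finsetSum _ fun a _ => (XC.ev2 ν a).norm)
    exact (XC.ev1 ν i).fst.norm.add ((XC.ev1 ν i).snd.fst.add continuous_const)
  have hterm : ∀ (b : XC ν β α) i, 0 ≤ ‖(b.1.1 i).1‖ + ((b.1.1 i).2.1 + 1) := fun b i => by
    have := b.2.1.1 i
    positivity
  have hs1 : ∀ b : XC ν β α, 0 ≤ ∑ i, (‖(b.1.1 i).1‖ + ((b.1.1 i).2.1 + 1)) := fun b =>
    Finset.sum_nonneg fun i _ => hterm b i
  have hs2 : ∀ b : XC ν β α, 0 ≤ ∑ a, ‖b.1.2 a‖ := fun b => Finset.sum_nonneg fun i _ => norm_nonneg _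
  have hN0 : ∀ b, 0 ≤ N b := fun b => by
    have := hs1 b
    have := hs2 b
    simp only [N]; linarith
  have hNz : ∀ j b z, DX ν j (b, z) = 0 → ‖z‖ < N b := by
    rintro (i | a) b z h
    · rw [DX_inl] at h
      have h1 := h.norm_le
      have h2 := Finset.single_le_sum (f := fun i => ‖(b.1.1 i).1‖ + ((b.1.1 i).2.1 + 1))
        (fun i _ => hterm b i) (Finset.mem_univ i)
      have := hs2 b
      simp only [N]; simp only at h1 h2; linarith
    · rw [DX_inr] at h
      have h2 := Finset.single_le_sum (f := fun a => ‖b.1.2 a‖) (fun i _ => norm_nonneg _) (Finset.mem_univ a)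
      have := hs1 b
      simp only at h h2
      rw [h]
      simp only [N]; linarith
  refine ⟨?_, N, hNc, hN0, hNz⟩
  rw [GX_eq]
  refine trans_of_feat (DX ν) ?_ ?_ (SX ν) ?_ ?_ ?_ N hNc hNz ?_
  · rintro (i | a)
    · have h1 : Continuous fun x : XC ν β α × M => (x.1.1.1 i, x.2) :=
        ((XC.ev1 ν i).comp continuous_fst).prodMk continuous_snd
      exact (pw_cont.comp h1).abs.add ((ht_cont ν).comp h1).abs
    · exact (continuous_snd.sub ((XC.ev2 ν a).comp continuous_fst)).norm
  · rintro (i | a) x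
    · simp only [DX]; positivity
    · simp only [DX]; positivity
  · rintro (i | a)
    · have h1 : Continuous fun x : XC ν β α × XC ν β α × M => x.1.1.1 i := (XC.ev1 ν i).comp continuous_fst
      have h2 : Continuous fun x : XC ν β α × XC ν β α × M => x.2.1.1.1 i :=
        (XC.ev1 ν i).comp (continuous_fst.comp continuous_snd)
      refine h2.fst.add (Continuous.smul ?_ ?_)
      · exact (h2.snd.fst.div h1.snd.fst fun x => (x.1.2.1.1 i).ne').sqrt
      · exact Rot_cont.comp ((ν.continuous.comp h1.snd.snd).prodMk ((ν.continuous.comp h2.snd.snd).prodMk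
          ((continuous_snd.comp continuous_snd).sub h1.fst)))
    · have h1 : Continuous fun x : XC ν β α × XC ν β α × M => x.1.1.2 a := (XC.ev2 ν a).comp continuous_fst
      have h2 : Continuous fun x : XC ν β α × XC ν β α × M => x.2.1.1.2 a :=
        (XC.ev2 ν a).comp (continuous_fst.comp continuous_snd)
      exact (continuous_snd.comp continuous_snd).add (h2.sub h1)
  · rintro (i | a) b z
    · simp only [SX]
      rw [Rot_self (hν _), div_self (b.2.1.1 i).ne']
      simp
    · simp [SX]
  · rintro (i | a) b0
    · have h1 : Continuous fun p : XC ν β α × XC ν β α => inner ℝ (ν (p.1.1.1 i).2.2) (ν (p.2.1.1 i).2.2) := by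
        have h1 : Continuous fun x : XC ν β α × XC ν β α => x.1.1.1 i := (XC.ev1 ν i).comp continuous_fst
        have h2 : Continuous fun x : XC ν β α × XC ν β α => x.2.1.1 i := (XC.ev1 ν i).comp continuous_snd
        exact (ν.continuous.comp h1.snd.snd).inner (ν.continuous.comp h2.snd.snd)
      have h2 : ∀ᶠ p in 𝓝 (b0, b0), 0 < inner ℝ (ν (p.1.1.1 i).2.2) (ν (p.2.1.1 i).2.2) :=
        ContinuousAt.eventually_lt continuousAt_const h1.continuousAt (by
          simp only; rw [real_inner_self_eq_norm_sq, hν]; norm_num)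
      filter_upwards [h2] with p hp z
      rw [DX_inl, DX_inl]
      have hc : 1 / 2 ≤ 1 + inner ℝ (ν (p.1.1.1 i).2.2) (ν (p.2.1.1 i).2.2) := by linarith
      have hR := p.1.2.1.1 i
      have hR' := p.2.2.1.1 i
      have hq : 0 < (p.2.1.1 i).2.1 / (p.1.1.1 i).2.1 := div_pos hR' hR
      simp only [InK, SX, pw, ht, add_sub_cancel_left]
      rw [norm_smul, mul_pow, Rot_norm (hν _) (hν _) hc, Real.norm_eq_abs, sq_abs, Real.sq_sqrt hq.le,
        inner_smul_left, Rot_inner (hν _) hc]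
      rintro ⟨e1, e2⟩
      constructor
      · field_simp at e1
        have : (p.2.1.1 i).2.1 * (‖z - (p.1.1.1 i).1‖ ^ 2 - (p.1.1.1 i).2.1) = 0 := by linarith
        rcases mul_eq_zero.1 this with h | h
        · exact absurd h hR'.ne'
        · exact h
      · rcases mul_eq_zero.1 e2 with h | h
        · exact absurd h (by simpa using (Real.sqrt_pos.2 hq).ne')
        · exact h
    · refine Filter.Eventually.of_forall fun p z => ?_
      rw [DX_inr, DX_inr]
      simp only [SX]
      intro h
      have : z - p.1.1.2 a = 0 := by
        have := sub_eq_zero.2 h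
        rw [← this]; abel
      exact sub_eq_zero.1 this
  · rintro (i | a) (k | c) ⟨b, z⟩ hne h1 h2
    · rw [DX_inl] at h1 h2
      have := b.2.1.2 i k (fun h => hne (by rw [h])) z h1.2 h2.2 (h1.1.trans h2.1.symm)
      exact this.ne' h1.1
    · rw [DX_inl] at h1
      rw [DX_inr] at h2
      simp only at h1 h2
      exact b.2.2.2 i c (h2 ▸ h1)
    · rw [DX_inr] at h1
      rw [DX_inl] at h2
      simp only at h1 h2
      exact b.2.2.2 k a (h1 ▸ h2)
    · rw [DX_inr] at h1 h2
      exact hne (by rw [b.2.2.1 (h1.symm.trans h2)])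

theorem conn_GX [Finite β] [Finite α] (ν : C(S, M)) (v0 e : M) (he : ‖e‖ = 1)
    (hev : inner ℝ e v0 = 0) (hv0 : ‖v0‖ = 1) (b : XC ν β α) (hb : ∀ i, ν (b.1.1 i).2.2 = v0) (N : ℝ)
    (hN : ∀ j z, DX ν j (b, z) = 0 → ‖z‖ < N) (z : M) (hz : (b, z) ∈ GX ν β α) :
    JoinedIn {z | (b, z) ∈ GX ν β α} (N • e) z := by
  have hvv : inner ℝ v0 v0 = (1 : ℝ) := by rw [real_inner_self_eq_norm_sq, hv0]; norm_num
  have hee : inner ℝ e e = (1 : ℝ) := by rw [real_inner_self_eq_norm_sq, he]; norm_num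
  let F : Set ℝ := (Set.range fun i => inner ℝ (b.1.1 i).1 v0) ∪ Set.range fun a => inner ℝ (b.1.2 a) v0
  have hF : F.Finite := (Set.finite_range _).union (Set.finite_range _)
  have hG1 : ∀ y, inner ℝ y v0 ∉ F → (b, y) ∈ GX ν β α := by
    intro y hy
    refine ⟨fun i hK => hy (Or.inl ⟨i, ?_⟩), fun a ha => hy (Or.inr ⟨a, ?_⟩)⟩
    · have := hK.2
      simp only [ht] at this
      rw [hb, inner_sub_left] at this
      simp only; linarith
    · simp only at ha ⊢; rw [ha]
  have hG2 : ∀ y, N ≤ inner ℝ y e → (b, y) ∈ GX ν β α := by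
    intro y hy
    rw [GX_eq]
    intro j hj
    have h1 := hN j y hj
    have h2 := real_inner_le_norm y e
    rw [he] at h2
    linarith
  obtain ⟨ε, hε, hε2⟩ : ∃ ε > 0, ∀ t, 0 < t → t ≤ ε → inner ℝ z v0 + t ∉ F := by
    have hcl : IsOpen (F \ {inner ℝ z v0})ᶜ := (hF.sdiff).isClosed.isOpen_compl
    obtain ⟨ε, hε, h⟩ := Metric.isOpen_iff.1 hcl (inner ℝ z v0) (by simp)
    refine ⟨ε / 2, by positivity, fun t ht0 ht h' => ?_⟩
    have := h (a := inner ℝ z v0 + t) (by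
      rw [Metric.mem_ball, Real.dist_eq, add_sub_cancel_left, abs_of_pos ht0]; linarith)
    exact this ⟨h', by simp; linarith⟩
  set z1 := z + ε • v0 with hz1
  set L := |N - inner ℝ z e| with hL
  set z2 := z1 + L • e with hz2
  have hve : inner ℝ v0 e = (0 : ℝ) := by rw [real_inner_comm]; exact hev
  have s1 : JoinedIn {z | (b, z) ∈ GX ν β α} z z1 := by
    refine JoinedIn.of_segment_subset ?_
    rw [segment_eq_image']
    rintro _ ⟨t, ⟨ht0, ht1⟩, rfl⟩
    rcases ht0.eq_or_lt with h | h
    · subst h; simpa using hz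
    · apply hG1
      have : inner ℝ (z + t • (z1 - z)) v0 = inner ℝ z v0 + t * ε := by
        simp [hz1, inner_smul_left, inner_add_left, hv0]
      rw [this]
      exact hε2 _ (by positivity) (by nlinarith)
  have s2 : JoinedIn {z | (b, z) ∈ GX ν β α} z1 z2 := by
    refine JoinedIn.of_segment_subset ?_
    rw [segment_eq_image']
    rintro _ ⟨t, ⟨ht0, ht1⟩, rfl⟩
    apply hG1
    have : inner ℝ (z1 + t • (z2 - z1)) v0 = inner ℝ z v0 + ε := by
      simp [hz1, hz2, inner_smul_left, inner_add_left, hv0, hev]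
    rw [this]
    exact hε2 _ hε le_rfl
  have s3 : JoinedIn {z | (b, z) ∈ GX ν β α} z2 (N • e) := by
    refine JoinedIn.of_segment_subset fun y hy => hG2 y ?_
    have hc : Convex ℝ {y | N ≤ inner ℝ y e} := by
      have := convex_halfSpace_ge (𝕜 := ℝ) (E := M) (f := fun y => inner ℝ y e)
        ⟨fun x y => inner_add_left _ _ _, fun c x => by simp [inner_smul_left]⟩ N
      exact this
    refine hc.segment_subset ?_ ?_ hy
    · simp only [Set.mem_ofPred_eq, hz2, hz1, inner_add_left, inner_smul_left, hve, hee, hL, conj_trivial]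
      have := le_abs_self (N - inner ℝ z e)
      linarith
    · simp [inner_smul_left, he]
  exact ((s1.trans s2).trans s3).symm

theorem PE_of_homeo {X Y : Type} [TopologicalSpace X] [TopologicalSpace Y] (e : X ≃ₜ Y) :
    PE (e : C(X, Y)) :=
  PE.of_inverse _ (e.symm : C(Y, X)) (by simpa using ContinuousMap.Homotopic.refl _)
    (by simpa using ContinuousMap.Homotopic.refl _)

end Fib
end PESec
end


noncomputable section
open CategoryTheory

namespace PESec
open scoped unitInterval Topology

section Ind
set_option linter.unusedSectionVars false
variable {M : Type} [NormedAddCommGroup M] [InnerProductSpace ℝ M] [FiniteDimensional ℝ M]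
variable {S S' : Type} [MetricSpace S] [MetricSpace S'] {β α α' : Type}

theorem option_isX (ν : C(S, M)) (x : {x : XC ν β α × M // x ∈ GX ν β α}) :
    IsX ν ((x.1.1.1.1, fun o => o.elim x.1.2 x.1.1.1.2) : (β → Ob M S) × (Option α → M)) := by
  refine ⟨x.1.1.2.1, ?_, ?_⟩
  · rintro (_ | a) (_ | c) h
    · rfl
    · exact absurd h (x.2.2 c)
    · exact absurd h.symm (x.2.2 a)
    · exact congrArg some (x.1.1.2.2.1 h)
  · rintro i (_ | a)
    · exact x.2.1 i
    · exact x.1.1.2.2.2 i a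

def homeoOpt (ν : C(S, M)) (β α : Type) : {x : XC ν β α × M // x ∈ GX ν β α} ≃ₜ XC ν β (Option α) where
  toFun x := ⟨(x.1.1.1.1, fun o => o.elim x.1.2 x.1.1.1.2), option_isX ν x⟩
  invFun f := ⟨(⟨(f.1.1, fun a => f.1.2 (some a)), f.2.1,
      fun a c h => Option.some_injective _ (f.2.2.1 h), fun i a => f.2.2.2 i (some a)⟩, f.1.2 none),
    ⟨fun i => f.2.2.2 i none, fun a h => by cases f.2.2.1 h⟩⟩
  left_inv x := rfl
  right_inv f := by
    apply Subtype.ext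
    refine Prod.ext rfl ?_
    funext o
    cases o <;> rfl
  continuous_toFun := by
    refine Continuous.subtype_mk (Continuous.prodMk ?_ (continuous_pi fun o => ?_)) _
    · exact continuous_fst.comp (continuous_subtype_val.comp (continuous_fst.comp continuous_subtype_val))
    · cases o with
      | none => exact continuous_snd.comp continuous_subtype_val
      | some a => exact (XC.ev2 ν a).comp (continuous_fst.comp continuous_subtype_val)
  continuous_invFun := by
    refine Continuous.subtype_mk (Continuous.prodMk (Continuous.subtype_mk (Continuous.prodMk ?_
      (continuous_pi fun a => ?_)) _) ?_) _
    · exact continuous_fst.comp continuous_subtype_val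
    · exact XC.ev2 ν (some a)
    · exact XC.ev2 ν none

def homeoEq (ν : C(S, M)) (β : Type) (e : α ≃ α') : XC ν β α ≃ₜ XC ν β α' where
  toFun f := ⟨(f.1.1, fun a => f.1.2 (e.symm a)), f.2.1, f.2.2.1.comp e.symm.injective,
    fun i a => f.2.2.2 i _⟩
  invFun f := ⟨(f.1.1, fun a => f.1.2 (e a)), f.2.1, f.2.2.1.comp e.injective,
    fun i a => f.2.2.2 i _⟩
  left_inv f := by apply Subtype.ext; simp
  right_inv f := by apply Subtype.ext; simp
  continuous_toFun := by
    refine Continuous.subtype_mk (Continuous.prodMk ?_ (continuous_pi fun a => ?_)) _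
    · exact continuous_fst.comp continuous_subtype_val
    · exact XC.ev2 ν _
  continuous_invFun := by
    refine Continuous.subtype_mk (Continuous.prodMk ?_ (continuous_pi fun a => ?_)) _
    · exact continuous_fst.comp continuous_subtype_val
    · exact XC.ev2 ν _

def homeoEmp (ν : C(S, M)) (β : Type) : YC ν β ≃ₜ XC ν β PEmpty where
  toFun f := ⟨(f.1, PEmpty.elim), f.2, fun a => a.elim, fun _ a => a.elim⟩
  invFun f := ⟨f.1.1, f.2.1⟩
  left_inv f := rfl
  right_inv f := by apply Subtype.ext; refine Prod.ext rfl (Subsingleton.elim _ _)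
  continuous_toFun := Continuous.subtype_mk (continuous_subtype_val.prodMk continuous_const) _
  continuous_invFun := Continuous.subtype_mk (continuous_fst.comp continuous_subtype_val) _

theorem PE_jX_option [Finite β] [Finite α] (ν : C(S, M)) (φ : C(S', S)) (hν : ∀ s, ‖ν s‖ = 1)
    (hdim : ∀ v : M, ∃ l : M, ‖l‖ = 1 ∧ inner ℝ l v = 0) (v0 : M) (hv0 : ‖v0‖ = 1)
    (hφ : ∀ s, ν (φ s) = v0) (h : PE (jX ν φ β α)) : PE (jX ν φ β (Option α)) := by
  obtain ⟨hT, N, hNc, hN0, hNz⟩ := trans_GX (β := β) (α := α) ν hν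
  obtain ⟨e, he, hev⟩ := hdim v0
  have key : PE (jE (jX ν φ β α) (GX ν β α)) := by
    refine fib h hT ⟨fun b => N b • e, by fun_prop⟩ ?_ ?_
    · intro b
      rw [GX_eq]
      intro j hj
      have := hNz j b _ hj
      simp only [ContinuousMap.coe_mk] at this
      rw [norm_smul, he, Real.norm_eq_abs, abs_of_nonneg (hN0 b)] at this
      linarith
    · intro b z hz
      exact conn_GX ν v0 e he hev hv0 (jX ν φ β α b) (fun i => hφ _) (N (jX ν φ β α b))
        (fun j z => hNz j _ z) z hz
  refine PE.of_comp_left (PE_of_homeo (homeoOpt (ν.comp φ) β α)) ?_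
  have h2 := (PE_of_homeo (homeoOpt ν β α)).comp key
  exact h2

theorem PE_jX_of [Finite β] [Finite α] (ν : C(S, M)) (φ : C(S', S)) (hν : ∀ s, ‖ν s‖ = 1)
    (hdim : ∀ v : M, ∃ l : M, ‖l‖ = 1 ∧ inner ℝ l v = 0) (v0 : M) (hv0 : ‖v0‖ = 1)
    (hφ : ∀ s, ν (φ s) = v0) (h : PE (jY ν φ β)) : PE (jX ν φ β α) := by
  refine Finite.induction_empty_option (P := fun α : Type => PE (jX ν φ β α)) ?_ ?_ ?_ α
  · intro α α' e h
    refine PE.of_comp_left (PE_of_homeo (homeoEq (ν.comp φ) β e)) ?_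
    exact (PE_of_homeo (homeoEq ν β e)).comp h
  · refine PE.of_comp_left (PE_of_homeo (homeoEmp (ν.comp φ) β)) ?_
    have h2 := (PE_of_homeo (homeoEmp ν β)).comp h
    exact h2
  · intro α _ h
    exact PE_jX_option ν φ hν hdim v0 hv0 hφ h

theorem PE_jY_all [SimplyConnectedSpace S] [SimplyConnectedSpace S'] (ν : C(S, M)) (φ : C(S', S))
    (hν : ∀ s, ‖ν s‖ = 1)
    (hdim : ∀ v : M, ∃ l : M, ‖l‖ = 1 ∧ inner ℝ l v = 0) (v0 : M) (hv0 : ‖v0‖ = 1)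
    (hφ : ∀ s, ν (φ s) = v0) (k : ℕ) : ∀ (β : Type) [Finite β], Nat.card β = k → PE (jY ν φ β) := by
  induction k using Nat.strong_induction_on with
  | _ k ih =>
  intro β _ hk
  rcases isEmpty_or_nonempty β with he | hne
  · refine PE.of_inverse _ ⟨fun _ => ⟨isEmptyElim, fun i => he.elim i, fun i => he.elim i⟩, continuous_const⟩ ?_ ?_
    · have : Subsingleton (YC (ν.comp φ) β) := inferInstance
      rw [Subsingleton.elim (ContinuousMap.comp _ _) (ContinuousMap.id (YC (ν.comp φ) β))]
    · rw [Subsingleton.elim (ContinuousMap.comp _ _) (ContinuousMap.id (YC ν β))]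
  · refine PE_jY_of ν φ hdim fun J hJ => PE_jX_of ν φ hν hdim v0 hv0 hφ ?_
    refine ih (Nat.card {j // j ∉ J}) ?_ _ rfl
    rw [← hk]
    obtain ⟨i, hi⟩ := hJ
    exact Finite.card_subtype_lt (x := i) (by simpa using hi)

end Ind
end PESec
end


noncomputable section
open CategoryTheory

namespace PESec
open scoped unitInterval Topology

abbrev EE3 : Type := EuclideanSpace ℝ (Fin 3)
abbrev S3 : Type := {w : EE3 // w ≠ 0}

/-- slit space -/
def slit (sg : ℝ) : Set S3 := {w | w.1 1 ≠ 0 ∨ w.1 2 ≠ 0 ∨ 0 < sg * w.1 0}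

theorem slit_open (sg : ℝ) : IsOpen (slit sg) := by
  have h : ∀ i, Continuous fun w : S3 => w.1 i := fun i => by fun_prop
  exact (isOpen_ne_fun (h 1) continuous_const).union ((isOpen_ne_fun (h 2) continuous_const).union
    (isOpen_lt continuous_const (continuous_const.mul (h 0))))

theorem slit_ne (sg : ℝ) (w : EE3) (h : w 1 ≠ 0 ∨ w 2 ≠ 0 ∨ 0 < sg * w 0) : w ≠ 0 := by
  rintro rfl
  simp at h

theorem slit_contr (sg : ℝ) (hs : sg * sg = 1) : ContractibleSpace (slit sg) := by
  let x : EE3 := !₂[sg, 0, 0]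
  have key : ∀ (t : I) (w : slit sg), ((t : ℝ) • x + (1 - (t : ℝ)) • w.1.1) 1 ≠ 0 ∨
      ((t : ℝ) • x + (1 - (t : ℝ)) • w.1.1) 2 ≠ 0 ∨ 0 < sg * ((t : ℝ) • x + (1 - (t : ℝ)) • w.1.1) 0 := by
    intro t w
    have ht0 := t.2.1
    have ht1 := t.2.2
    simp only [PiLp.add_apply, PiLp.smul_apply, smul_eq_mul, x]
    simp only [Matrix.cons_val, mul_zero, zero_add]
    rcases ht1.eq_or_lt with h | h
    · right; right
      rw [h]; simp; rintro rfl; simp at hs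
    · have h' : 0 < 1 - (t : ℝ) := by linarith
      rcases w.2 with hw | hw | hw
      · left; exact mul_ne_zero h'.ne' hw
      · right; left; exact mul_ne_zero h'.ne' hw
      · right; right
        have := mul_pos h' hw
        have e : sg * (t * sg + (1 - (t : ℝ)) * w.1.1 0) = t * (sg * sg) + (1 - (t : ℝ)) * (sg * w.1.1 0) := by ring
        rw [e, hs]; linarith
  have hx : x 1 ≠ 0 ∨ x 2 ≠ 0 ∨ 0 < sg * x 0 := by right; right; simp [x, hs]
  rw [contractible_iff_id_nullhomotopic]
  refine ⟨⟨⟨x, slit_ne sg x hx⟩, hx⟩, ⟨⟨⟨fun p => ⟨⟨(p.1 : ℝ) • x + (1 - (p.1 : ℝ)) • p.2.1.1,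
    slit_ne sg _ (key p.1 p.2)⟩, key p.1 p.2⟩, ?_⟩, ?_, ?_⟩⟩⟩
  · refine Continuous.subtype_mk (Continuous.subtype_mk ?_ _) _
    fun_prop
  · intro w; apply Subtype.ext; apply Subtype.ext; simp
  · intro w; apply Subtype.ext; apply Subtype.ext; simp

def wb : S3 := ⟨!₂[0, 1, 0], slit_ne 1 _ (by left; simp)⟩

theorem wb_mem (sg : ℝ) : wb ∈ slit sg := by left; simp [wb]

theorem joined_mid (w : S3) (hw : w.1 1 ≠ 0 ∨ w.1 2 ≠ 0) :
    ∃ γ : Path w wb, ∀ t, (γ t).1 1 ≠ 0 ∨ (γ t).1 2 ≠ 0 := by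
  have hpc : IsPathConnected ({0}ᶜ : Set (EuclideanSpace ℝ (Fin 2))) := by
    apply isPathConnected_compl_singleton_of_one_lt_rank
    rw [← Module.finrank_eq_rank]; simp
  have hne : (!₂[w.1 1, w.1 2] : EuclideanSpace ℝ (Fin 2)) ≠ 0 := by
    intro h
    have h0 := congrArg (fun v : EuclideanSpace ℝ (Fin 2) => v 0) h
    have h1 := congrArg (fun v : EuclideanSpace ℝ (Fin 2) => v 1) h
    simp at h0 h1
    tauto
  have hne' : (!₂[1, 0] : EuclideanSpace ℝ (Fin 2)) ≠ 0 := by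
    intro h
    have h0 := congrArg (fun v : EuclideanSpace ℝ (Fin 2) => v 0) h
    simp at h0
  obtain ⟨p, hp⟩ := hpc.joinedIn _ hne _ hne'
  have key : ∀ t, p t 0 ≠ 0 ∨ p t 1 ≠ 0 := by
    intro t
    by_contra h
    push Not at h
    apply hp t
    ext i; fin_cases i <;> simp [h.1, h.2]
  let g : I → EE3 := fun t => !₂[(1 - (t : ℝ)) * w.1 0, p t 0, p t 1]
  have hg : ∀ t, g t 1 ≠ 0 ∨ g t 2 ≠ 0 := fun t => by simpa [g] using key t
  have hg0 : ∀ t, g t ≠ 0 := fun t => slit_ne 1 _ (by have := hg t; tauto)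
  refine ⟨⟨⟨fun t => ⟨g t, hg0 t⟩, ?_⟩, ?_, ?_⟩, hg⟩
  · refine Continuous.subtype_mk ?_ _
    refine (PiLp.continuous_toLp 2 _).comp (continuous_pi fun i => ?_)
    have hp0 : Continuous fun t => p t 0 := by fun_prop
    have hp1 : Continuous fun t => p t 1 := by fun_prop
    fin_cases i
    · exact (by fun_prop : Continuous fun t : I => (1 - (t : ℝ)) * w.1 0)
    · exact hp0
    · exact hp1
  · apply Subtype.ext
    ext i; fin_cases i <;> simp [g]
  · apply Subtype.ext
    ext i; fin_cases i <;> simp [g, wb]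

theorem simplyConnected_S3 : SimplyConnectedSpace S3 := by
  let O : Bool → Set S3 := fun b => if b then slit 1 else slit (-1)
  have hO : ∀ b, ∃ sg : ℝ, sg * sg = 1 ∧ O b = slit sg := by
    intro b; cases b
    · exact ⟨-1, by norm_num, rfl⟩
    · exact ⟨1, by norm_num, rfl⟩
  have hct : ∀ b, ContractibleSpace (O b) := fun b => by
    obtain ⟨sg, h1, h2⟩ := hO b; rw [h2]; exact slit_contr sg h1
  have hwb : ∀ b, wb ∈ O b := fun b => by obtain ⟨sg, h1, h2⟩ := hO b; rw [h2]; exact wb_mem sg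
  have hop : ∀ b, IsOpen (O b) := fun b => by obtain ⟨sg, h1, h2⟩ := hO b; rw [h2]; exact slit_open sg
  have hcase : ∀ x : S3, (∃ b, x ∈ O b ∧ ∀ b', x ∈ O b' → b' = b) ∨ (x.1 1 ≠ 0 ∨ x.1 2 ≠ 0) := by
    intro x
    by_cases h1 : x.1 1 ≠ 0
    · exact Or.inr (Or.inl h1)
    by_cases h2 : x.1 2 ≠ 0
    · exact Or.inr (Or.inr h2)
    left
    have h0 : x.1 0 ≠ 0 := by
      intro h0
      apply x.2
      push Not at h1 h2
      ext i; fin_cases i <;> simp [h0, h1, h2]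
    rcases lt_or_gt_of_ne h0 with h | h
    · refine ⟨false, Or.inr (Or.inr (by linarith)), ?_⟩
      intro b' hb'
      cases b'
      · rfl
      · rcases hb' with h' | h' | h'
        · exact absurd h' h1
        · exact absurd h' h2
        · linarith
    · refine ⟨true, Or.inr (Or.inr (by linarith)), ?_⟩
      intro b' hb'
      cases b'
      · rcases hb' with h' | h' | h'
        · exact absurd h' h1
        · exact absurd h' h2
        · linarith
      · rfl
  have hmid : ∀ x : S3, (x.1 1 ≠ 0 ∨ x.1 2 ≠ 0) → ∀ b, x ∈ O b := by
    intro x hx b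
    obtain ⟨sg, h1, h2⟩ := hO b; rw [h2]
    rcases hx with h | h
    · exact Or.inl h
    · exact Or.inr (Or.inl h)
  have hpath : ∀ x : S3, ∃ γ : Path x wb, ∀ b, x ∈ O b → ∀ t, γ t ∈ O b := by
    intro x
    rcases hcase x with ⟨b, hb, hb'⟩ | h
    · have := hct b
      let p : Path (⟨x, hb⟩ : O b) ⟨wb, hwb b⟩ := PathConnectedSpace.somePath _ _
      refine ⟨p.map continuous_subtype_val, fun b' h t => ?_⟩
      rw [hb' b' h]
      exact (p t).2
    · obtain ⟨γ, hγ⟩ := joined_mid x h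
      exact ⟨γ, fun b _ t => hmid _ (hγ t) b⟩
  choose c hc using hpath
  have hnull : ∀ (b : Bool) (p q : Path wb wb) (hp : ∀ t, p t ∈ O b) (hq : ∀ t, q t ∈ O b),
      (pathIn p (O b) hp).Homotopic (pathIn q (O b) hq) := by
    intro b p q hp hq
    have := hct b
    exact SimplyConnectedSpace.paths_homotopic _ _
  rw [simply_connected_iff_loops_nullhomotopic]
  have hloop : ∀ γ : Path wb wb, γ.Homotopic (Path.refl wb) := by
    intro γ
    let j : C(Unit, S3) := ⟨fun _ => wb, continuous_const⟩
    obtain ⟨δ, hδ⟩ := glue_full (j := j) O hop (fun x => by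
      rcases hcase x with ⟨b, hb, _⟩ | h
      · exact ⟨b, hb⟩
      · exact ⟨true, hmid x h true⟩) (fun _ => ()) c hc (by
        intro b a a' γ hγ
        refine ⟨Path.refl (), fun t => hwb b, ?_⟩
        exact Path.Homotopic.Quotient.eq.2 (hnull b _ _ _ _)) (by
        intro b
        refine ⟨Path.refl (), ?_⟩
        have := (hnull true (Path.refl wb) (c wb) (fun t => hwb _) (hc wb true (hwb _))).map
          ⟨Subtype.val, continuous_subtype_val⟩
        exact this) () () γ
    refine hδ.symm.trans ?_
    have : δ = Path.refl () := by ext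
    rw [this]
    exact Path.Homotopic.refl _
  have hpc : PathConnectedSpace S3 := ⟨⟨wb⟩, fun x y => ⟨(c x).trans (c y).symm⟩⟩
  refine ⟨hpc, fun x γ => ?_⟩
  have h1 := hloop (((c x).symm.trans γ).trans (c x))
  rw [← pmk_eq] at h1 ⊢
  rw [pmk_trans, pmk_trans] at h1
  have h2 : pmk γ = pmk (c x) ≫ ((pmk (c x).symm ≫ pmk γ) ≫ pmk (c x)) ≫ pmk (c x).symm := by
    simp only [Category.assoc, pmk_comp_symm, Category.comp_id]
    rw [← Category.assoc, pmk_comp_symm, Category.id_comp]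
  rw [h2, h1, pmk_refl, Category.id_comp, pmk_comp_symm]
  rfl

end PESec
end


noncomputable section
open CategoryTheory

namespace PESec
open scoped unitInterval Topology

theorem pi1Map_inj {X Y : Type} [TopologicalSpace X] [TopologicalSpace Y] (f : C(X, Y)) (x : X)
    (h : ∀ γ γ' : Path x x, (γ.map f.continuous).Homotopic (γ'.map f.continuous) → γ.Homotopic γ') :
    Function.Injective (pi1Map f x) := by
  intro a b hab
  apply CategoryTheory.Iso.ext
  have hh := congrArg CategoryTheory.Iso.hom hab
  obtain ⟨δ, hδ⟩ := Path.Homotopic.Quotient.mk_surjective a.hom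
  obtain ⟨δ', hδ'⟩ := Path.Homotopic.Quotient.mk_surjective b.hom
  rw [← hδ, ← hδ']
  refine Path.Homotopic.Quotient.eq.2 (h δ δ' ?_)
  apply Path.Homotopic.Quotient.exact
  have e1 : (pi1Map f x a).hom = Path.Homotopic.Quotient.mk (δ.map f.continuous) := by
    change (FundamentalGroupoid.map f).map a.hom = _
    rw [← hδ]; rfl
  have e2 : (pi1Map f x b).hom = Path.Homotopic.Quotient.mk (δ'.map f.continuous) := by
    change (FundamentalGroupoid.map f).map b.hom = _
    rw [← hδ']; rfl
  rw [← e1, ← e2]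
  exact hh

theorem covering_inj {T C : Type} [TopologicalSpace T] [TopologicalSpace C] {q : T → C}
    (cov : IsCoveringMap q) (U : Set C) (Tu : Set T) (hmap : ∀ f ∈ Tu, q f ∈ U)
    (hlift : ∀ x ∈ U, ∃ f ∈ Tu, q f = x)
    (hstay : ∀ Γ : C(I, T), Γ 0 ∈ Tu → (∀ t, q (Γ t) ∈ U) → ∀ t, Γ t ∈ Tu)
    (hfaith : ∀ (a b : Tu) (δ δ' : Path a b),
      (δ.map continuous_subtype_val).Homotopic (δ'.map continuous_subtype_val) → δ.Homotopic δ')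
    (x : U) (γ γ' : Path x x)
    (h : (γ.map continuous_subtype_val).Homotopic (γ'.map continuous_subtype_val)) :
    γ.Homotopic γ' := by
  obtain ⟨f, hf, hfx⟩ := hlift x.1 x.2
  let g : C(I, C) := (γ.map continuous_subtype_val).toContinuousMap
  let g' : C(I, C) := (γ'.map continuous_subtype_val).toContinuousMap
  have hg0 : g 0 = q f := by rw [hfx]; exact congrArg Subtype.val γ.source
  have hg0' : g' 0 = q f := by rw [hfx]; exact congrArg Subtype.val γ'.source
  let Γ := cov.liftPath g f hg0
  let Γ' := cov.liftPath g' f hg0'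
  have hl : ∀ t, q (Γ t) = (γ t).1 := fun t => congrFun (cov.liftPath_lifts g f hg0) t
  have hl' : ∀ t, q (Γ' t) = (γ' t).1 := fun t => congrFun (cov.liftPath_lifts g' f hg0') t
  have h0 : Γ 0 = f := cov.liftPath_zero g f hg0
  have h0' : Γ' 0 = f := cov.liftPath_zero g' f hg0'
  have h1 : Γ 1 = Γ' 1 := cov.liftPath_apply_one_eq_of_homotopicRel h f hg0 hg0'
  have hr : Γ.HomotopicRel Γ' {0, 1} := cov.homotopicRel_liftPath h f hg0 hg0'
  have hT : ∀ t, Γ t ∈ Tu := hstay Γ (h0 ▸ hf) (fun t => by rw [hl]; exact (γ t).2)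
  have hT' : ∀ t, Γ' t ∈ Tu := hstay Γ' (h0' ▸ hf) (fun t => by rw [hl']; exact (γ' t).2)
  let δ : Path (⟨f, hf⟩ : Tu) ⟨Γ 1, hT 1⟩ :=
    ⟨⟨fun t => ⟨Γ t, hT t⟩, by fun_prop⟩, Subtype.ext h0, rfl⟩
  let δ' : Path (⟨f, hf⟩ : Tu) ⟨Γ 1, hT 1⟩ :=
    ⟨⟨fun t => ⟨Γ' t, hT' t⟩, by fun_prop⟩, Subtype.ext h0', Subtype.ext h1.symm⟩
  have hd : δ.Homotopic δ' := hfaith _ _ _ _ hr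
  let Q : C(Tu, U) := ⟨fun f => ⟨q f.1, hmap f.1 f.2⟩,
    Continuous.subtype_mk (cov.continuous.comp continuous_subtype_val) _⟩
  have hs : x = Q ⟨f, hf⟩ := Subtype.ext hfx.symm
  have ht : x = Q ⟨Γ 1, hT 1⟩ := Subtype.ext (by
    change x.1 = q (Γ 1); rw [hl 1, γ.target])
  have := hd.map Q
  have h2 : γ = (δ.map Q.continuous).cast hs ht := by
    ext t; exact (hl t).symm
  have h2' : γ' = (δ'.map Q.continuous).cast hs ht := by
    ext t; exact (hl' t).symm
  rw [h2, h2']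
  exact this

section Cov
variable {P : Type} {n : ℕ}

def signAct (n : ℕ) : Equiv.Perm (Fin n) →* MulAut (Fin n → ℤˣ) where
  toFun π := { toFun := fun e i => e (π⁻¹ i), invFun := fun e i => e (π i)
               left_inv := fun e => by ext; simp
               right_inv := fun e => by ext; simp
               map_mul' := fun e e' => rfl }
  map_one' := rfl
  map_mul' := fun _ _ => rfl

abbrev HO (n : ℕ) := (Fin n → ℤˣ) ⋊[signAct n] Equiv.Perm (Fin n)

instance : Finite (HO n) := Finite.of_injective (fun g : HO n => (g.left, g.right)) (by
  intro g h e
  exact SemidirectProduct.ext (congrArg Prod.fst e) (congrArg Prod.snd e))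

def hoAct (ρ : ℤˣ →* Equiv.Perm P) (g : HO n) (f : Fin n → P) : Fin n → P :=
  fun i => ρ (g.left i) (f (g.right⁻¹ i))

theorem hoAct_one (ρ : ℤˣ →* Equiv.Perm P) (f : Fin n → P) : hoAct ρ 1 f = f := by
  funext i; simp [hoAct]

theorem hoAct_mul (ρ : ℤˣ →* Equiv.Perm P) (g h : HO n) (f : Fin n → P) :
    hoAct ρ (g * h) f = hoAct ρ g (hoAct ρ h f) := by
  funext i; simp [hoAct, signAct]

theorem cov_tuple [TopologicalSpace P] [T2Space P] {Z : Type} (ρ : ℤˣ →* Equiv.Perm P)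
    (hρ : ∀ a, Continuous (ρ a)) (K : P → Z) (Is : (Fin n → P) → Prop)
    (hK : ∀ a p, K (ρ a p) = K p)
    (hIs : ∀ g f, Is f → Is (hoAct ρ g f))
    (hinj : ∀ f, Is f → Function.Injective fun i => K (f i))
    (hfree : ∀ f, Is f → ∀ i a, ρ a (f i) = f i → a = 1)
    (htr : ∀ f f', Is f → Is f' → ∀ i j, K (f i) = K (f' j) → ∃ a, f i = ρ a (f' j))
    {C : Type} [TopologicalSpace C] (q : {f : Fin n → P // Is f} → C) (hq : Topology.IsQuotientMap q)
    (hqK : ∀ f f', q f = q f' ↔ (Set.range fun i => K (f.1 i)) = Set.range fun i => K (f'.1 i)) :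
    IsCoveringMap q := by
  let act : MulAction (HO n) {f : Fin n → P // Is f} :=
    { smul := fun g f => ⟨hoAct ρ g f.1, hIs g f.1 f.2⟩
      one_smul := fun f => Subtype.ext (hoAct_one ρ f.1)
      mul_smul := fun g h f => Subtype.ext (hoAct_mul ρ g h f.1) }
  have hcont : ∀ g : HO n, Continuous fun f : {f : Fin n → P // Is f} => g • f := by
    intro g
    refine Continuous.subtype_mk (continuous_pi fun i => ?_) _
    exact (hρ _).comp ((continuous_apply (g.right⁻¹ i)).comp continuous_subtype_val)
  have hfr : ∀ (g : HO n) (f : {f : Fin n → P // Is f}), g • f = f → g = 1 := by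
    intro g f h
    have h' : ∀ i, ρ (g.left i) (f.1 (g.right⁻¹ i)) = f.1 i := fun i =>
      congrFun (congrArg Subtype.val h) i
    have hr : ∀ i, g.right⁻¹ i = i := by
      intro i
      apply hinj f.1 f.2
      change K _ = K _
      rw [← h' i, hK]
    have hl : ∀ i, g.left i = 1 := by
      intro i
      have := h' i
      rw [hr i] at this
      exact hfree f.1 f.2 i _ this
    ext i
    · rw [hl i]; rfl
    · rw [show g.right = 1 from inv_eq_one.1 (Equiv.ext hr)]; rfl
  have hcs : ContinuousConstSMul (HO n) {f : Fin n → P // Is f} := ⟨hcont⟩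
  have : IsQuotientCoveringMap q (HO n) :=
    { toIsQuotientMap := hq
      toContinuousConstSMul := hcs
      apply_eq_iff_mem_orbit := by
        intro f f'
        rw [hqK]
        constructor
        · intro h
          have h1 : ∀ i, ∃ j, K (f'.1 j) = K (f.1 i) := fun i => by
            have : K (f.1 i) ∈ Set.range fun i => K (f'.1 i) := by rw [← h]; exact ⟨i, rfl⟩
            exact this
          choose π hπ using h1
          have hπi : Function.Injective π := by
            intro i j hij
            apply hinj f.1 f.2
            change K _ = K _
            rw [← hπ i, ← hπ j, hij]
          let π' : Equiv.Perm (Fin n) := Equiv.ofBijective π (Finite.injective_iff_bijective.1 hπi)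
          choose a ha using fun i => htr f.1 f'.1 f.2 f'.2 i (π i) (hπ i).symm
          refine ⟨⟨a, π'⁻¹⟩, Subtype.ext (funext fun i => ?_)⟩
          change ρ (a i) (f'.1 ((π'⁻¹)⁻¹ i)) = f.1 i
          rw [inv_inv, ha i]; rfl
        · rintro ⟨g, rfl⟩
          ext z
          constructor
          · rintro ⟨i, rfl⟩
            exact ⟨g.right⁻¹ i, (hK _ _).symm⟩
          · rintro ⟨i, rfl⟩
            refine ⟨g.right i, ?_⟩
            change K (ρ _ (f'.1 (g.right⁻¹ (g.right i)))) = _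
            rw [hK]; simp
      disjoint := by
        intro e
        have : ∀ g : HO n, ∃ U ∈ 𝓝 e, ((g • ·) '' U ∩ U).Nonempty → g = 1 := by
          intro g
          by_cases hg : g • e = e
          · exact ⟨Set.univ, Filter.univ_mem, fun _ => hfr g e hg⟩
          · obtain ⟨V, W, hV, hW, heV, heW, hd⟩ := t2_separation hg
            refine ⟨W ∩ (g • ·) ⁻¹' V, Filter.inter_mem (hW.mem_nhds heW)
              ((hV.preimage (hcont g)).mem_nhds heV), ?_⟩
            rintro ⟨_, ⟨u, hu, rfl⟩, hu'⟩
            exact absurd hu'.1 (Set.disjoint_left.1 hd hu.2)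
        choose U hU hU' using this
        refine ⟨⋂ g, U g, Filter.iInter_mem.2 hU, fun g hg => hU' g (hg.mono ?_)⟩
        exact Set.inter_subset_inter (Set.image_mono (Set.iInter_subset _ _)) (Set.iInter_subset _ _) }
  exact this.isCoveringMap

end Cov

end PESec
end


noncomputable section
open CategoryTheory

namespace PESec
open scoped unitInterval Topology

theorem exists_perp2 (u v : E3) : ∃ l : E3, ‖l‖ = 1 ∧ inner ℝ l u = (0 : ℝ) ∧ inner ℝ l v = (0 : ℝ) := by
  let W : Submodule ℝ E3 := Submodule.span ℝ (({u, v} : Finset E3) : Set E3)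
  have h1 : Module.finrank ℝ W ≤ 2 := (finrank_span_finset_le_card _).trans Finset.card_le_two
  have h2 := Submodule.finrank_add_finrank_orthogonal W
  have h3 : Module.finrank ℝ E3 = 3 := by simp
  have h4 : 0 < Module.finrank ℝ Wᗮ := by omega
  have : Nontrivial Wᗮ := Module.finrank_pos_iff.1 h4
  obtain ⟨⟨l, hl⟩, hne⟩ := exists_ne (0 : Wᗮ)
  have hne' : l ≠ 0 := fun h => hne (Subtype.ext h)
  have hu : inner ℝ l u = (0 : ℝ) := by
    rw [real_inner_comm]
    exact hl u (Submodule.subset_span (by simp))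
  have hv : inner ℝ l v = (0 : ℝ) := by
    rw [real_inner_comm]
    exact hl v (Submodule.subset_span (by simp))
  refine ⟨‖l‖⁻¹ • l, ?_, ?_, ?_⟩
  · rw [norm_smul, norm_inv, norm_norm, inv_mul_cancel₀ (norm_ne_zero_iff.2 hne')]
  · rw [inner_smul_left, hu]; simp
  · rw [inner_smul_left, hv]; simp

theorem perp_unique {w w' l u : E3} (hli : ∀ k : ℝ, w' ≠ k • w) (hw : w ≠ 0) (hl : ‖l‖ = 1)
    (h1 : inner ℝ l w = (0 : ℝ)) (h2 : inner ℝ l w' = (0 : ℝ)) (h3 : inner ℝ u w = (0 : ℝ))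
    (h4 : inner ℝ u w' = (0 : ℝ)) : ∃ t : ℝ, u = t • l := by
  let W : Submodule ℝ E3 := Submodule.span ℝ (Set.range ![w, w'])
  have hind : LinearIndependent ℝ ![w, w'] := by
    rw [LinearIndependent.pair_iff' hw]
    intro k hk; exact hli k hk.symm
  have h5 : Module.finrank ℝ W = 2 := by
    rw [finrank_span_eq_card hind]; simp
  have h6 := Submodule.finrank_add_finrank_orthogonal W
  have h7 : Module.finrank ℝ E3 = 3 := by simp
  have h8 : Module.finrank ℝ Wᗮ = 1 := by omega
  have hmem : ∀ x : E3, inner ℝ x w = (0 : ℝ) → inner ℝ x w' = (0 : ℝ) → x ∈ Wᗮ := by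
    intro x hx hx'
    rw [Submodule.mem_orthogonal']
    intro y hy
    induction hy using Submodule.span_induction with
    | mem y hy =>
      obtain ⟨i, rfl⟩ := hy
      fin_cases i
      · exact hx
      · exact hx'
    | zero => simp
    | add a b _ _ ha hb => rw [inner_add_right, ha, hb, add_zero]
    | smul c a _ ha => rw [inner_smul_right, ha, mul_zero]
  have hlne : (⟨l, hmem l h1 h2⟩ : Wᗮ) ≠ 0 := by
    intro h
    have : l = 0 := congrArg Subtype.val h
    rw [this] at hl; simp at hl
  obtain ⟨t, ht⟩ := (finrank_eq_one_iff_of_nonzero' _ hlne).1 h8 ⟨u, hmem u h3 h4⟩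
  exact ⟨t, (congrArg Subtype.val ht).symm⟩

theorem par_of_perp {w u : E3} (h : ∀ l : E3, inner ℝ l w = (0 : ℝ) → inner ℝ l u = (0 : ℝ)) (hw : w ≠ 0) :
    ∃ k : ℝ, u = k • w := by
  have hww : inner ℝ w w ≠ (0 : ℝ) := by rwa [ne_eq, inner_self_eq_zero]
  refine ⟨inner ℝ u w / inner ℝ w w, ?_⟩
  set k : ℝ := inner ℝ u w / inner ℝ w w
  have h1 : inner ℝ (u - k • w) w = (0 : ℝ) := by
    rw [inner_sub_left, inner_smul_left]
    simp only [conj_trivial, k]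
    field_simp; ring
  have h2 := h _ h1
  have h3 : inner ℝ (u - k • w) (u - k • w) = (0 : ℝ) := by
    rw [inner_sub_right, h2, inner_smul_right, h1]; simp
  exact sub_eq_zero.1 (inner_self_eq_zero.1 h3)

theorem mem_pCircle_of_perp {c w l : E3} (h1 : inner ℝ l w = (0 : ℝ)) (h2 : ‖l‖ = ‖w‖) :
    c + l ∈ pCircle (c, w) := by
  refine ⟨?_, ?_⟩
  · simpa using h2
  · simpa using h1

theorem pCircle_inj {p q : E3 × E3} (hp : p.2 ≠ 0) (hq : q.2 ≠ 0) (h : pCircle p = pCircle q) :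
    p.1 = q.1 ∧ (p.2 = q.2 ∨ p.2 = - q.2) := by
  obtain ⟨c, w⟩ := p
  obtain ⟨c', w'⟩ := q
  simp only at hp hq ⊢
  have key : ∀ l : E3, inner ℝ l w = (0 : ℝ) → ‖l‖ = ‖w‖ →
      ‖(c - c') + l‖ = ‖w'‖ ∧ inner ℝ ((c - c') + l) w' = (0 : ℝ) := by
    intro l h1 h2
    have := mem_pCircle_of_perp (c := c) h1 h2
    rw [h] at this
    obtain ⟨h3, h4⟩ := this
    simp only at h3 h4
    have e : c + l - c' = (c - c') + l := by abel
    rw [e] at h3 h4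
    exact ⟨h3, h4⟩
  have key2 : ∀ l : E3, inner ℝ l w = (0 : ℝ) → ‖l‖ = ‖w‖ →
      inner ℝ l (c - c') = (0 : ℝ) ∧ inner ℝ l w' = (0 : ℝ) ∧ inner ℝ (c - c') w' = (0 : ℝ) := by
    intro l h1 h2
    obtain ⟨a1, a2⟩ := key l h1 h2
    obtain ⟨b1, b2⟩ := key (-l) (by simpa using h1) (by simpa using h2)
    have a3 := norm_add_sq_real (c - c') l
    have b3 := norm_add_sq_real (c - c') (-l)
    rw [a1] at a3
    rw [b1, inner_neg_right, norm_neg] at b3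
    rw [inner_add_left] at a2 b2
    rw [inner_neg_left] at b2
    rw [real_inner_comm]
    refine ⟨by linarith, by linarith, by linarith⟩
  have key3 : ∀ l : E3, inner ℝ l w = (0 : ℝ) → 
      inner ℝ l (c - c') = (0 : ℝ) ∧ inner ℝ l w' = (0 : ℝ) := by
    intro l h1
    by_cases hl : l = 0
    · simp [hl]
    have hl' : ‖l‖ ≠ 0 := norm_ne_zero_iff.2 hl
    have hw' : ‖w‖ ≠ 0 := norm_ne_zero_iff.2 hp
    have := key2 ((‖w‖ / ‖l‖) • l) (by rw [inner_smul_left, h1]; simp)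
      (by rw [norm_smul, norm_div, norm_norm, norm_norm]; field_simp)
    rw [inner_smul_left, inner_smul_left] at this
    simp only [conj_trivial, mul_eq_zero, div_eq_zero_iff, hl', hw', or_self, false_or] at this
    exact ⟨this.1, this.2.1⟩
  obtain ⟨k, hk⟩ := par_of_perp (fun l hl => (key3 l hl).2) hp
  obtain ⟨j, hj⟩ := par_of_perp (fun l hl => (key3 l hl).1) hp
  obtain ⟨l, hl, hlw, -⟩ := exists_perp2 w w
  have hlw' : inner ℝ (‖w‖ • l) w = (0 : ℝ) := by rw [inner_smul_left, hlw]; simp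
  have hln : ‖‖w‖ • l‖ = ‖w‖ := by rw [norm_smul, hl]; simp
  have hk0 : k ≠ 0 := by rintro rfl; apply hq; simpa using hk
  have hj0 : j = 0 := by
    have := (key2 _ hlw' hln).2.2
    rw [hj, hk, inner_smul_left, inner_smul_right] at this
    have hww : inner ℝ w w ≠ (0 : ℝ) := by rwa [ne_eq, inner_self_eq_zero]
    simp only [conj_trivial, mul_eq_zero, hk0, hww, or_false] at this
    exact this
  have hcc : c - c' = 0 := by rw [hj, hj0, zero_smul]
  refine ⟨sub_eq_zero.1 hcc, ?_⟩
  have hn := (key _ hlw' hln).1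
  rw [hcc, zero_add, hln, hk, norm_smul] at hn
  have hk1 : |k| = 1 := by
    have hw' : ‖w‖ ≠ 0 := norm_ne_zero_iff.2 hp
    have : ‖k‖ * ‖w‖ = 1 * ‖w‖ := by rw [one_mul]; exact hn.symm
    exact mul_right_cancel₀ hw' this
  rcases (abs_eq one_pos.le).1 hk1 with h | h
  · left; rw [hk, h, one_smul]
  · right; rw [hk, h]; simp

theorem pCircle_neg (c w : E3) : pCircle (c, -w) = pCircle (c, w) := by
  ext x; simp [pCircle, circleSet]

theorem pDisk_neg (c w : E3) : pDisk (c, -w) = pDisk (c, w) := by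
  ext x; simp [pDisk, diskSet]

theorem line_norm (z l c : E3) (hl : ‖l‖ = 1) (t : ℝ) :
    ‖z + t • l - c‖ ^ 2 = ‖z - c‖ ^ 2 + 2 * t * inner ℝ l (z - c) + t ^ 2 := by
  have : z + t • l - c = (z - c) + t • l := by abel
  rw [this, norm_add_sq_real, inner_smul_right, norm_smul, hl, real_inner_comm, Real.norm_eq_abs,
    mul_one, sq_abs]
  ring

theorem line_inner (z l c w : E3) (h : inner ℝ l w = (0 : ℝ)) (h' : inner ℝ (z - c) w = (0 : ℝ)) (t : ℝ) :
    inner ℝ (z + t • l - c) w = (0 : ℝ) := by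
  have : z + t • l - c = (z - c) + t • l := by abel
  rw [this, inner_add_left, inner_smul_left, h, h']; simp

theorem mem_pCircle_iff (c w x : E3) : x ∈ pCircle (c, w) ↔ ‖x - c‖ ^ 2 = ‖w‖ ^ 2 ∧ inner ℝ (x - c) w = (0 : ℝ) := by
  refine and_congr_left fun _ => ?_
  exact (sq_eq_sq₀ (norm_nonneg _) (norm_nonneg _)).symm

theorem mem_pDisk_iff (c w x : E3) : x ∈ pDisk (c, w) ↔ ‖x - c‖ ^ 2 ≤ ‖w‖ ^ 2 ∧ inner ℝ (x - c) w = (0 : ℝ) := by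
  refine and_congr_left fun _ => ?_
  exact (sq_le_sq₀ (norm_nonneg _) (norm_nonneg _)).symm

/-- Disjoint, unlinked circles are separated at every common point. -/
theorem dj_of_ring {c w c' w' : E3} (hw : w ≠ 0)
    (hd : Disjoint (pCircle (c, w)) (pCircle (c', w'))) (hu : ¬ LinksOnce (c, w) (c', w'))
    (z : E3) (h1 : inner ℝ (z - c) w = (0 : ℝ)) (h2 : inner ℝ (z - c') w' = (0 : ℝ))
    (h3 : ‖z - c‖ ^ 2 - ‖w‖ ^ 2 = ‖z - c'‖ ^ 2 - ‖w'‖ ^ 2) : 0 < ‖z - c‖ ^ 2 - ‖w‖ ^ 2 := by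
  by_contra hneg
  rw [not_lt] at hneg
  set τ := -(‖z - c‖ ^ 2 - ‖w‖ ^ 2) with hτ
  have hτ0 : 0 ≤ τ := by linarith
  have hdis : ∀ x, x ∈ pCircle (c, w) → x ∈ pCircle (c', w') → False :=
    fun x hx hx' => Set.disjoint_left.1 hd hx hx'
  have common : ∀ l : E3, ‖l‖ = 1 → inner ℝ l w = (0 : ℝ) → inner ℝ l w' = (0 : ℝ) →
      inner ℝ l (z - c) = (inner ℝ l (z - c') : ℝ) → False := by
    intro l hl hlw hlw' hb
    set b : ℝ := inner ℝ l (z - c) with hbd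
    have hsq : Real.sqrt (b ^ 2 + τ) ^ 2 = b ^ 2 + τ := Real.sq_sqrt (by positivity)
    set t := - b + Real.sqrt (b ^ 2 + τ)
    have hq : t ^ 2 + 2 * b * t = τ := by simp only [t]; linear_combination hsq
    refine hdis (z + t • l) ((mem_pCircle_iff _ _ _).2 ⟨?_, line_inner _ _ _ _ hlw h1 t⟩)
      ((mem_pCircle_iff _ _ _).2 ⟨?_, line_inner _ _ _ _ hlw' h2 t⟩)
    · rw [line_norm z l c hl t, ← hbd]; linarith
    · rw [line_norm z l c' hl t, ← hb]; linarith
  by_cases hpar : ∃ k : ℝ, w' = k • w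
  · obtain ⟨k, hk⟩ := hpar
    obtain ⟨l, hl, hlw, hlc⟩ := exists_perp2 w (c - c')
    refine common l hl hlw (by rw [hk, inner_smul_right, hlw, mul_zero]) ?_
    have : z - c' = (z - c) + (c - c') := by abel
    rw [this, inner_add_right, hlc, add_zero]
  · push Not at hpar
    obtain ⟨l, hl, hlw, hlw'⟩ := exists_perp2 w w'
    rcases hτ0.eq_or_lt with h0 | hpos
    · exact hdis z ((mem_pCircle_iff _ _ _).2 ⟨by linarith, h1⟩)
        ((mem_pCircle_iff _ _ _).2 ⟨by linarith, h2⟩)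
    -- orient the line
    obtain ⟨l, hl, hlw, hlw', hlt⟩ : ∃ l : E3, ‖l‖ = 1 ∧ inner ℝ l w = (0 : ℝ) ∧ inner ℝ l w' = (0 : ℝ) ∧
        (inner ℝ l (z - c') : ℝ) < inner ℝ l (z - c) := by
      rcases lt_trichotomy (inner ℝ l (z - c') : ℝ) (inner ℝ l (z - c)) with h | h | h
      · exact ⟨l, hl, hlw, hlw', h⟩
      · exact (common l hl hlw hlw' h.symm).elim
      · exact ⟨-l, by simpa, by simpa using hlw, by simpa using hlw', by
          rw [inner_neg_left, inner_neg_left]; linarith⟩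
    set b : ℝ := inner ℝ l (z - c) with hbd
    set b' : ℝ := inner ℝ l (z - c') with hbd'
    have hsq : Real.sqrt (b ^ 2 + τ) ^ 2 = b ^ 2 + τ := Real.sq_sqrt (by positivity)
    set t := - b + Real.sqrt (b ^ 2 + τ) with htd
    have hq : t ^ 2 + 2 * b * t = τ := by simp only [t]; linear_combination hsq
    have ht0 : 0 < t := by
      have : b < Real.sqrt (b ^ 2 + τ) := by
        apply Real.lt_sqrt_of_sq_lt; linarith
      linarith
    apply hu
    refine ⟨z + t • l, ⟨(mem_pCircle_iff _ _ _).2 ⟨?_, line_inner _ _ _ _ hlw h1 t⟩,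
      (mem_pDisk_iff _ _ _).2 ⟨?_, line_inner _ _ _ _ hlw' h2 t⟩⟩, ?_⟩
    · rw [line_norm z l c hl t, ← hbd]; linarith
    · rw [line_norm z l c' hl t, ← hbd']; nlinarith
    · rintro y ⟨hy, hy'⟩
      rw [mem_pCircle_iff] at hy
      rw [mem_pDisk_iff] at hy'
      obtain ⟨s, hs⟩ := perp_unique (u := y - z) hpar hw hl hlw hlw'
        (by rw [show y - z = (y - c) - (z - c) by abel, inner_sub_left, hy.2, h1, sub_zero])
        (by rw [show y - z = (y - c') - (z - c') by abel, inner_sub_left, hy'.2, h2, sub_zero])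
      have hys : y = z + s • l := by rw [← hs]; abel
      rw [hys] at hy hy' ⊢
      rw [line_norm z l c hl s, ← hbd] at hy
      rw [line_norm z l c' hl s, ← hbd'] at hy'
      have e1 : s ^ 2 + 2 * b * s = τ := by linarith [hy.1]
      have e2 : s ^ 2 + 2 * b' * s ≤ τ := by linarith [hy'.1]
      have hs0 : 0 ≤ s := by
        by_contra h; rw [not_le] at h
        nlinarith
      have hfac : (s - t) * (s + t + 2 * b) = 0 := by linear_combination e1 - hq
      have hne : s + t + 2 * b ≠ 0 := by
        intro h
        have : s = - b - Real.sqrt (b ^ 2 + τ) := by linarith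
        have h' : -b < Real.sqrt (b ^ 2 + τ) := by
          apply Real.lt_sqrt_of_sq_lt; nlinarith
        linarith
      have : s = t := by
        rcases mul_eq_zero.1 hfac with h | h
        · linarith
        · exact absurd h hne
      rw [this]

/-- Parallel circles. -/
theorem parallel_unlinked {c c' e : E3} {s s' : ℝ} (he : ‖e‖ = 1) (hs : 0 < s) (hs' : 0 < s')
    (h : ∀ z : E3, inner ℝ (z - c) e = (0 : ℝ) → inner ℝ (z - c') e = (0 : ℝ) →
      ‖z - c‖ ^ 2 - s ^ 2 = ‖z - c'‖ ^ 2 - s' ^ 2 → 0 < ‖z - c‖ ^ 2 - s ^ 2) :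
    Disjoint (pCircle (c, s • e)) (pCircle (c', s' • e)) ∧ ¬ LinksOnce (c, s • e) (c', s' • e) := by
  have hn : ∀ s : ℝ, ‖s • e‖ ^ 2 = s ^ 2 := fun s => by rw [norm_smul, he, mul_one, Real.norm_eq_abs, sq_abs]
  have hC : ∀ (c x : E3) (s : ℝ), 0 < s → (x ∈ pCircle (c, s • e) ↔ ‖x - c‖ ^ 2 = s ^ 2 ∧ inner ℝ (x - c) e = (0 : ℝ)) := by
    intro c x s hs
    rw [mem_pCircle_iff, hn, inner_smul_right, mul_eq_zero, or_iff_right hs.ne']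
  have hD : ∀ (c x : E3) (s : ℝ), 0 < s → (x ∈ pDisk (c, s • e) ↔ ‖x - c‖ ^ 2 ≤ s ^ 2 ∧ inner ℝ (x - c) e = (0 : ℝ)) := by
    intro c x s hs
    rw [mem_pDisk_iff, hn, inner_smul_right, mul_eq_zero, or_iff_right hs.ne']
  constructor
  · rw [Set.disjoint_left]
    intro x hx hx'
    rw [hC _ _ _ hs] at hx
    rw [hC _ _ _ hs'] at hx'
    have := h x hx.2 hx'.2 (by rw [hx.1, hx'.1]; ring)
    rw [hx.1] at this; linarith
  · rintro ⟨x, ⟨hx, hx'⟩, huniq⟩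
    have hx0 := hx
    rw [hC _ _ _ hs] at hx
    rw [hD _ _ _ hs'] at hx'
    have hlt : ‖x - c'‖ ^ 2 < s' ^ 2 := by
      rcases hx'.1.eq_or_lt with h0 | h0
      · have := h x hx.2 hx'.2 (by rw [hx.1, h0]; ring)
        rw [hx.1] at this; linarith
      · exact h0
    obtain ⟨l, hl, hle, hlx⟩ := exists_perp2 e (x - c)
    let y : ℝ → E3 := fun ε => c + (Real.cos ε • (x - c) + (Real.sin ε * s) • l)
    have hyc : Continuous y := by fun_prop
    have hf : Continuous fun ε => ‖y ε - c'‖ ^ 2 := by fun_prop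
    have hy0 : y 0 = x := by simp [y]
    have hev : ∀ᶠ ε in 𝓝 (0 : ℝ), ‖y ε - c'‖ ^ 2 < s' ^ 2 :=
      (hf.tendsto 0).eventually_lt_const (by simpa only [hy0] using hlt)
    obtain ⟨r, hr, hball⟩ := Metric.eventually_nhds_iff.1 hev
    let ε := min (r / 2) 1
    have hε0 : 0 < ε := lt_min (by linarith) one_pos
    have hεr : ε < r := (min_le_left _ _).trans_lt (by linarith)
    have hε1 : ε ≤ 1 := min_le_right _ _
    have hlt' := hball (y := ε) (by rw [Real.dist_eq, sub_zero, abs_of_pos hε0]; exact hεr)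
    have hyv : y ε - c = Real.cos ε • (x - c) + (Real.sin ε * s) • l := by simp [y]
    have hyin : inner ℝ (y ε - c) e = (0 : ℝ) := by
      rw [hyv, inner_add_left, inner_smul_left, inner_smul_left, hx.2, hle]; simp
    have hyn : ‖y ε - c‖ ^ 2 = s ^ 2 := by
      rw [hyv, norm_add_sq_real, inner_smul_left, inner_smul_right, real_inner_comm, hlx, norm_smul,
        norm_smul, hl, mul_pow, hx.1]
      simp only [Real.norm_eq_abs, sq_abs, mul_one, mul_zero]
      linear_combination s ^ 2 * Real.sin_sq_add_cos_sq ε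
    have hcc : inner ℝ (c - c') e = (0 : ℝ) := by
      rw [show c - c' = (x - c') - (x - c) by abel, inner_sub_left, hx.2, hx'.2, sub_zero]
    have hyin' : inner ℝ (y ε - c') e = (0 : ℝ) := by
      rw [show y ε - c' = (y ε - c) + (c - c') by abel, inner_add_left, hyin, hcc, add_zero]
    have heq : y ε = x := huniq (y ε) ⟨(hC _ _ _ hs).2 ⟨hyn, hyin⟩, (hD _ _ _ hs').2 ⟨hlt'.le, hyin'⟩⟩
    have : inner ℝ l (y ε - c) = (0 : ℝ) := by rw [heq, hlx]
    rw [hyv, inner_add_right, inner_smul_right, inner_smul_right, hlx, real_inner_self_eq_norm_sq, hl] at this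
    have hsin : 0 < Real.sin ε := Real.sin_pos_of_pos_of_lt_pi hε0 (by linarith [Real.pi_gt_three])
    have := mul_pos hsin hs
    linarith

end PESec
end


noncomputable section
open CategoryTheory

namespace PESec
open scoped unitInterval Topology

theorem hdim3 : ∀ v : E3, ∃ l : E3, ‖l‖ = 1 ∧ inner ℝ l v = (0 : ℝ) := fun v => by
  obtain ⟨l, h, h', -⟩ := exists_perp2 v v
  exact ⟨l, h, h'⟩

def ringRho : ℤˣ →* Equiv.Perm (E3 × E3) where
  toFun a := { toFun := fun p => (p.1, ((a : ℤ) : ℝ) • p.2), invFun := fun p => (p.1, ((a : ℤ) : ℝ) • p.2)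
               left_inv := fun p => by rcases Int.units_eq_one_or a with rfl | rfl <;> simp
               right_inv := fun p => by rcases Int.units_eq_one_or a with rfl | rfl <;> simp }
  map_one' := by ext p <;> simp
  map_mul' := fun a b => by ext p <;> simp [mul_assoc]

theorem ringRho_apply (a : ℤˣ) (p : E3 × E3) : ringRho a p = (p.1, ((a : ℤ) : ℝ) • p.2) := rfl

theorem ringRho_circle (a : ℤˣ) (p : E3 × E3) : pCircle (ringRho a p) = pCircle p := by
  rw [ringRho_apply]
  rcases Int.units_eq_one_or a with rfl | rfl
  · simp
  · simpa using pCircle_neg p.1 p.2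

theorem ringRho_disk (a : ℤˣ) (p : E3 × E3) : pDisk (ringRho a p) = pDisk p := by
  rw [ringRho_apply]
  rcases Int.units_eq_one_or a with rfl | rfl
  · simp
  · simpa using pDisk_neg p.1 p.2

theorem ringRho_links (a b : ℤˣ) (p q : E3 × E3) :
    LinksOnce (ringRho a p) (ringRho b q) ↔ LinksOnce p q := by
  unfold LinksOnce
  rw [ringRho_circle, ringRho_disk]

theorem pCircle_nonempty (p : E3 × E3) : (pCircle p).Nonempty := by
  obtain ⟨l, hl, hlw⟩ := hdim3 p.2
  refine ⟨p.1 + ‖p.2‖ • l, mem_pCircle_of_perp (w := p.2) ?_ ?_⟩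
  · rw [inner_smul_left, hlw]; simp
  · rw [norm_smul, hl]; simp

theorem ring_cov (n : ℕ) : IsCoveringMap (Quotient.mk (ringSetoid n)) := by
  refine cov_tuple ringRho ?_ pCircle IsRingTuple ringRho_circle ?_ ?_ ?_ ?_ _ isQuotientMap_quotient_mk' ?_
  · intro a
    change Continuous fun p : E3 × E3 => (p.1, ((a : ℤ) : ℝ) • p.2)
    fun_prop
  · rintro g f ⟨h1, h2, h3⟩
    have hne : ∀ i j, i ≠ j → g.right⁻¹ i ≠ g.right⁻¹ j := fun i j h h' => h (g.right⁻¹.injective h')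
    refine ⟨fun i => ?_, fun i j hij => ?_, fun i j hij => ?_⟩
    · have := h1 (g.right⁻¹ i)
      simp only [hoAct, ringRho_apply]
      rcases Int.units_eq_one_or (g.left i) with h | h <;> rw [h] <;> simpa using this
    · simp only [hoAct, ringRho_circle]
      exact h2 _ _ (hne i j hij)
    · simp only [hoAct, UnlinkedPair, ringRho_links]
      exact h3 _ _ (hne i j hij)
  · intro f hf i j hij
    by_contra hne
    have := hf.2.1 i j hne
    simp only at hij
    rw [hij, disjoint_self] at this
    exact (pCircle_nonempty (f j)).ne_empty this
  · intro f hf i a h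
    rcases Int.units_eq_one_or a with rfl | rfl
    · rfl
    · exfalso
      have := congrArg Prod.snd h
      simp only [ringRho_apply] at this
      apply hf.1 i
      have h2 : - (f i).2 = (f i).2 := by simpa using this
      ext k
      have h3 := congrArg (fun v : E3 => v k) h2
      simp only [PiLp.neg_apply] at h3
      rw [PiLp.zero_apply]; linarith
  · intro f f' hf hf' i j h
    obtain ⟨h1, h2 | h2⟩ := pCircle_inj (hf.1 i) (hf'.1 j) h
    · exact ⟨1, by rw [map_one]; exact Prod.ext h1 h2⟩
    · exact ⟨-1, by rw [ringRho_apply]; exact Prod.ext h1 (by simpa using h2)⟩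
  · intro f f'
    exact Quotient.eq

def nuR : C(S3, E3) := ⟨fun w => ‖w.1‖⁻¹ • w.1, by
  refine Continuous.smul (Continuous.inv₀ (by fun_prop) fun w => norm_ne_zero_iff.2 w.2) (by fun_prop)⟩

theorem nuR_norm (s : S3) : ‖nuR s‖ = 1 := by
  change ‖‖s.1‖⁻¹ • s.1‖ = 1
  rw [norm_smul, norm_inv, norm_norm, inv_mul_cancel₀ (norm_ne_zero_iff.2 s.2)]

def e1 : E3 := !₂[1, 0, 0]
theorem e1_norm : ‖e1‖ = 1 := by simp [e1, EuclideanSpace.norm_eq, Fin.sum_univ_three]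
theorem e1_ne : e1 ≠ 0 := by intro h; have := e1_norm; rw [h] at this; simp at this
def e1S : S3 := ⟨e1, e1_ne⟩
def phR : C(Unit, S3) := ⟨fun _ => e1S, continuous_const⟩

theorem nuR_e1 (s : Unit) : nuR (phR s) = e1 := by
  change ‖e1‖⁻¹ • e1 = e1
  rw [e1_norm]; simp

def unitS (w : S3) : S3 := ⟨‖w.1‖⁻¹ • w.1, by
  have := nuR_norm w
  intro h
  change ‖‖w.1‖⁻¹ • w.1‖ = 1 at this
  rw [h] at this; simp at this⟩

theorem nuR_unitS (w : S3) : nuR (unitS w) = ‖w.1‖⁻¹ • w.1 := by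
  have := nuR_norm w
  change ‖‖w.1‖⁻¹ • w.1‖ = 1 at this
  change ‖‖w.1‖⁻¹ • w.1‖⁻¹ • (‖w.1‖⁻¹ • w.1) = _
  rw [this]; simp

theorem unitS_cont : Continuous unitS := Continuous.subtype_mk nuR.continuous _

theorem rt_ev {n : ℕ} (i : Fin n) : Continuous fun f : RingTuple n => f.1 i :=
  (continuous_apply i).comp continuous_subtype_val

theorem ring_isY {n : ℕ} (f : RingTuple n) : IsY nuR
    (fun i => ((f.1 i).1, ‖(f.1 i).2‖ ^ 2, unitS ⟨(f.1 i).2, f.2.1 i⟩)) := by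
  refine ⟨fun i => by have := norm_pos_iff.2 (f.2.1 i); simp only; positivity, fun i j hij z h1 h2 h3 => ?_⟩
  simp only [ht, pw, nuR_unitS, inner_smul_right, mul_eq_zero, inv_eq_zero, norm_eq_zero, f.2.1 i, f.2.1 j,
    false_or] at h1 h2 h3 ⊢
  exact dj_of_ring (f.2.1 i) (f.2.2.1 i j hij) (f.2.2.2 i j hij).1 z h1 h2 h3

def ringB (n : ℕ) : C(RingTuple n, YC nuR (Fin n)) :=
  ⟨fun f => ⟨_, ring_isY f⟩, by
    refine Continuous.subtype_mk (continuous_pi fun i => ?_) _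
    have h := rt_ev (n := n) i
    refine (continuous_fst.comp h).prodMk (Continuous.prodMk ?_ ?_)
    · exact (continuous_snd.comp h).norm.pow 2
    · exact unitS_cont.comp (Continuous.subtype_mk (continuous_snd.comp h) _)⟩

def ringTu (n : ℕ) : Set (RingTuple n) :=
  {f | ∀ i, (f.1 i).2 1 = 0 ∧ (f.1 i).2 2 = 0 ∧ 0 < (f.1 i).2 0}

theorem untw_eq {w : E3} (h1 : w 1 = 0) (h2 : w 2 = 0) : w = w 0 • e1 := by
  ext i; fin_cases i <;> simp [e1, h1, h2]

theorem untw_norm {w : E3} (h1 : w 1 = 0) (h2 : w 2 = 0) (h0 : 0 < w 0) : ‖w‖ = w 0 := by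
  conv_lhs => rw [untw_eq h1 h2]
  rw [norm_smul, e1_norm, mul_one, Real.norm_eq_abs, abs_of_pos h0]

theorem untw_unit {w : E3} (h1 : w 1 = 0) (h2 : w 2 = 0) (h0 : 0 < w 0) : ‖w‖⁻¹ • w = e1 := by
  rw [untw_norm h1 h2 h0]
  conv_lhs => rw [untw_eq h1 h2]
  rw [smul_smul]
  simp [e1, h0.ne']

theorem ringB_tu {n : ℕ} (f : ringTu n) : ∀ i, unitS ⟨(f.1.1 i).2, f.1.2.1 i⟩ = e1S := fun i =>
  Subtype.ext (untw_unit (f.2 i).1 (f.2 i).2.1 (f.2 i).2.2)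

def ringA (n : ℕ) : C(ringTu n, YC (nuR.comp phR) (Fin n)) :=
  ⟨fun f => ⟨fun i => ((f.1.1 i).1, ‖(f.1.1 i).2‖ ^ 2, ()), by
      have h := (ring_isY f.1)
      simp only [ringB_tu] at h
      exact h⟩, by
    refine Continuous.subtype_mk (continuous_pi fun i => ?_) _
    have h := (rt_ev (n := n) i).comp (continuous_subtype_val (p := (· ∈ ringTu n)))
    exact (continuous_fst.comp h).prodMk (Continuous.prodMk ((continuous_snd.comp h).norm.pow 2) continuous_const)⟩

theorem ringAB {n : ℕ} (f : ringTu n) : jY nuR phR (Fin n) (ringA n f) = ringB n f.1 := by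
  apply Subtype.ext
  funext i
  change ((f.1.1 i).1, ‖(f.1.1 i).2‖ ^ 2, e1S) = ((f.1.1 i).1, ‖(f.1.1 i).2‖ ^ 2, unitS ⟨(f.1.1 i).2, f.1.2.1 i⟩)
  rw [ringB_tu]

theorem ring_back {n : ℕ} (y : YC (nuR.comp phR) (Fin n)) :
    IsRingTuple (fun i => ((y.1 i).1, Real.sqrt (y.1 i).2.1 • e1)) := by
  have hs : ∀ i, 0 < Real.sqrt (y.1 i).2.1 := fun i => Real.sqrt_pos.2 (y.2.1 i)
  have hsq : ∀ i, Real.sqrt (y.1 i).2.1 ^ 2 = (y.1 i).2.1 := fun i => Real.sq_sqrt (y.2.1 i).le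
  have key : ∀ i j, i ≠ j → _ := fun i j hij => parallel_unlinked (c := (y.1 i).1) (c' := (y.1 j).1)
    e1_norm (hs i) (hs j) (by
      intro z h1 h2 h3
      rw [hsq, hsq] at h3
      rw [hsq]
      refine y.2.2 i j hij z ?_ ?_ h3
      · simp only [ht]
        rw [ContinuousMap.comp_apply, nuR_e1]; exact h1
      · simp only [ht]
        rw [ContinuousMap.comp_apply, nuR_e1]; exact h2)
  refine ⟨fun i => smul_ne_zero (hs i).ne' e1_ne, fun i j hij => (key i j hij).1, fun i j hij =>
    ⟨(key i j hij).2, (key j i hij.symm).2⟩⟩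

def ringR (n : ℕ) : C(YC (nuR.comp phR) (Fin n), ringTu n) :=
  ⟨fun y => ⟨⟨_, ring_back y⟩, fun i => by
      have hs : 0 < Real.sqrt (y.1 i).2.1 := Real.sqrt_pos.2 (y.2.1 i)
      simp [e1]; exact y.2.1 i⟩, by
    refine Continuous.subtype_mk (Continuous.subtype_mk (continuous_pi fun i => ?_) _) _
    have h := YC.ev (nuR.comp phR) (β := Fin n) i
    exact (continuous_fst.comp h).prodMk
      ((Real.continuous_sqrt.comp (continuous_fst.comp (continuous_snd.comp h))).smul continuous_const)⟩

theorem ringRA {n : ℕ} (f : ringTu n) : ringR n (ringA n f) = f := by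
  apply Subtype.ext
  apply Subtype.ext
  funext i
  refine Prod.ext rfl ?_
  change Real.sqrt (‖(f.1.1 i).2‖ ^ 2) • e1 = (f.1.1 i).2
  rw [Real.sqrt_sq (norm_nonneg _), untw_norm (f.2 i).1 (f.2 i).2.1 (f.2 i).2.2,
    ← untw_eq (f.2 i).1 (f.2 i).2.1]

theorem PE_ring (n : ℕ) : PE (jY nuR phR (Fin n)) := by
  have := simplyConnected_S3
  exact PE_jY_all nuR phR nuR_norm hdim3 e1 e1_norm nuR_e1 _ (Fin n) rfl

theorem faith_of {X A B : Type} [TopologicalSpace A] [TopologicalSpace B] [TopologicalSpace X]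
    {j : C(A, B)} (hj : PE j) (F : C(X, A)) (R : C(A, X)) (hR : ∀ x, R (F x) = x)
    (a b : X) (δ δ' : Path a b)
    (h : ((δ.map F.continuous).map j.continuous).Homotopic ((δ'.map F.continuous).map j.continuous)) :
    δ.Homotopic δ' := by
  have h1 := (pe_iff.1 hj).2.2 _ _ _ _ h
  have h2 := h1.map R
  have e : ∀ δ : Path a b, δ = ((δ.map F.continuous).map R.continuous).cast (hR a).symm (hR b).symm := by
    intro δ; ext t; exact (hR _).symm
  rw [e δ, e δ']
  exact h2

theorem ring_faith (n : ℕ) (a b : ringTu n) (δ δ' : Path a b)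
    (h : (δ.map continuous_subtype_val).Homotopic (δ'.map continuous_subtype_val)) : δ.Homotopic δ' := by
  refine faith_of (PE_ring n) (ringA n) (ringR n) ringRA a b δ δ' ?_
  have h2 := h.map (ringB n)
  have e : ∀ δ : Path a b, ((δ.map (ringA n).continuous).map (jY nuR phR (Fin n)).continuous) =
      ((δ.map continuous_subtype_val).map (ringB n).continuous).cast (ringAB a) (ringAB b) := by
    intro δ; ext1; funext t; exact ringAB _
  rw [e δ, e δ']
  exact h2

theorem pos_of_path (g : I → ℝ) (hg : Continuous g) (h0 : 0 < g 0) (hne : ∀ t, g t ≠ 0) (t : I) : 0 < g t := by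
  by_contra h
  rw [not_lt] at h
  obtain ⟨s, hs⟩ := mem_range_of_exists_le_of_exists_ge hg ⟨t, h⟩ ⟨0, h0.le⟩
  exact hne s hs

theorem ring_untw {n : ℕ} (f : RingTuple n) (h : Quotient.mk (ringSetoid n) f ∈ URConf n) : IsUntwistedTuple f := by
  obtain ⟨g, hg, hu⟩ := h
  have hr : (Set.range fun i => pCircle (g.1 i)) = Set.range fun i => pCircle (f.1 i) := Quotient.exact hg
  intro i
  have : pCircle (f.1 i) ∈ Set.range fun i => pCircle (g.1 i) := by rw [hr]; exact ⟨i, rfl⟩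
  obtain ⟨j, hj⟩ := this
  obtain ⟨-, h2 | h2⟩ := pCircle_inj (f.2.1 i) (g.2.1 j) hj.symm
  · rw [h2]; exact hu j
  · rw [h2]; simpa using hu j

theorem untw_ne {w : E3} (hw : w ≠ 0) (h1 : w 1 = 0) (h2 : w 2 = 0) : w 0 ≠ 0 := by
  intro h; apply hw; rw [untw_eq h1 h2, h, zero_smul]

theorem ring_main (n : ℕ) (x : URConf n) (γ γ' : Path x x)
    (h : (γ.map continuous_subtype_val).Homotopic (γ'.map continuous_subtype_val)) : γ.Homotopic γ' := by
  refine covering_inj (ring_cov n) (URConf n) (ringTu n) ?_ ?_ ?_ (ring_faith n) x γ γ' h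
  · intro f hf
    exact ⟨f, rfl, fun i => ⟨(hf i).1, (hf i).2.1⟩⟩
  · rintro x ⟨f, rfl, hf⟩
    have hne := fun i => untw_ne (f.2.1 i) (hf i).1 (hf i).2
    let sg : Fin n → ℤˣ := fun i => if 0 < (f.1 i).2 0 then 1 else -1
    let g : Fin n → E3 × E3 := fun i => ringRho (sg i) (f.1 i)
    have hg : IsRingTuple g := by
      refine ⟨fun i => ?_, fun i j hij => ?_, fun i j hij => ?_⟩
      · have := f.2.1 i
        simp only [g, ringRho_apply]
        rcases Int.units_eq_one_or (sg i) with h | h <;> rw [h] <;> simpa using this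
      · simp only [g, ringRho_circle]; exact f.2.2.1 i j hij
      · simp only [g, UnlinkedPair, ringRho_links]; exact f.2.2.2 i j hij
    refine ⟨⟨g, hg⟩, fun i => ?_, ?_⟩
    · have h1 := (hf i).1
      have h2 := (hf i).2
      simp only [g, ringRho_apply, PiLp.smul_apply, smul_eq_mul, h1, h2, mul_zero, true_and]
      rcases lt_or_gt_of_ne (hne i) with h | h
      · have : sg i = -1 := by simp only [sg]; rw [if_neg (by linarith)]
        rw [this]; simp; linarith
      · have : sg i = 1 := by simp only [sg]; rw [if_pos h]
        rw [this]; simpa using h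
    · apply Quotient.sound
      change (Set.range fun i => pCircle (g i)) = _
      simp only [g, ringRho_circle]
  · intro Γ h0 hU t i
    have hu := fun t => ring_untw (Γ t) (hU t) i
    refine ⟨(hu t).1, (hu t).2, ?_⟩
    refine pos_of_path (fun t => ((Γ t).1 i).2 0) ?_ (h0 i).2.2 ?_ t
    · have hc : Continuous fun t => ((Γ t).1 i).2 := continuous_snd.comp ((rt_ev i).comp Γ.continuous)
      fun_prop
    · intro t; exact untw_ne ((Γ t).2.1 i) (hu t).1 (hu t).2

theorem ring_inj (n : ℕ) (x : URConf n) : Function.Injective (pi1Map (inclURtoR n) x) :=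
  pi1Map_inj _ _ fun γ γ' h => ring_main n x γ γ' h

theorem ringV_inj (n : ℕ) (x : URConf n) : Function.Injective (pi1Map (inclURtoVR n) x) :=
  pi1Map_inj _ _ fun γ γ' h => ring_main n x γ γ' (h.map ⟨Subtype.val, continuous_subtype_val⟩)

end PESec
end


noncomputable section
open CategoryTheory

namespace PESec
open scoped unitInterval Topology

def wD (p : E2 × E2) : ℝ := (p.2 0 - p.1 0) ^ 2 + (p.2 1 - p.1 1) ^ 2

theorem wD_pos {p : E2 × E2} (h : p.1 ≠ p.2) : 0 < wD p := by
  by_contra hn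
  apply h
  have h1 : 0 ≤ (p.2 0 - p.1 0) ^ 2 := sq_nonneg _
  have h2 : 0 ≤ (p.2 1 - p.1 1) ^ 2 := sq_nonneg _
  unfold wD at hn
  have h3 : p.2 0 - p.1 0 = 0 := pow_eq_zero_iff (two_ne_zero) |>.1 (by linarith)
  have h4 : p.2 1 - p.1 1 = 0 := pow_eq_zero_iff (two_ne_zero) |>.1 (by linarith)
  ext i; fin_cases i
  · simp; linarith
  · simp; linarith

theorem mem_wicket (a b : E2) (x : E3) : x ∈ wicket a b ↔
    0 ≤ x 2 ∧ (x 0 - (a 0 + b 0) / 2) ^ 2 + (x 1 - (a 1 + b 1) / 2) ^ 2 + x 2 ^ 2 = wD (a, b) / 4 ∧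
    ∃ t : ℝ, x 0 = a 0 + t * (b 0 - a 0) ∧ x 1 = a 1 + t * (b 1 - a 1) := by
  have e1 : dist x (e3mk ((a 0 + b 0) / 2) ((a 1 + b 1) / 2) 0) =
      Real.sqrt ((x 0 - (a 0 + b 0) / 2) ^ 2 + (x 1 - (a 1 + b 1) / 2) ^ 2 + x 2 ^ 2) := by
    rw [EuclideanSpace.dist_eq, Fin.sum_univ_three]
    simp [e3mk, Real.dist_eq, sq_abs]
  have e2 : dist a b / 2 = Real.sqrt (wD (a, b) / 4) := by
    rw [EuclideanSpace.dist_eq, Fin.sum_univ_two, Real.sqrt_div' _ (by norm_num)]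
    have : Real.sqrt 4 = 2 := by
      rw [show (4 : ℝ) = 2 ^ 2 by norm_num]; exact Real.sqrt_sq (by norm_num)
    rw [this]
    simp only [Real.dist_eq, sq_abs, wD]
    congr 2; ring
  unfold wicket
  simp only [Set.mem_ofPred_eq]
  rw [e1, e2, Real.sqrt_inj (by positivity) (by unfold wD; positivity)]

theorem wicket_swap (a b : E2) : wicket a b = wicket b a := by
  have : ∀ a b : E2, wicket a b ⊆ wicket b a := by
    intro a b x hx
    rw [mem_wicket] at hx ⊢
    obtain ⟨h1, h2, t, h3, h4⟩ := hx
    refine ⟨h1, ?_, 1 - t, ?_, ?_⟩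
    · unfold wD at h2 ⊢
      simp only at h2 ⊢
      rw [add_comm (b 0), add_comm (b 1), h2]; ring
    · rw [h3]; ring
    · rw [h4]; ring
  exact Set.Subset.antisymm (this a b) (this b a)

theorem mem_wicket_zero {a b z : E2} (hab : a ≠ b) :
    e3mk (z 0) (z 1) 0 ∈ wicket a b ↔ z = a ∨ z = b := by
  rw [mem_wicket]
  simp only [e3mk, Equiv.symm, WithLp.equiv]
  simp only [Equiv.coe_fn_mk, Matrix.cons_val]
  constructor
  · rintro ⟨-, h2, t, h3, h4⟩
    have hp := wD_pos (p := (a, b)) hab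
    have : wD (a, b) * (t * (t - 1)) = 0 := by
      rw [h3, h4] at h2
      unfold wD at h2 ⊢
      simp only at h2 ⊢
      linarith
    rcases mul_eq_zero.1 this with h | h
    · exact absurd h hp.ne'
    · rcases mul_eq_zero.1 h with h | h
      · left
        ext i; fin_cases i
        · simpa [h] using h3
        · simpa [h] using h4
      · right
        have h : t = 1 := by linarith
        ext i; fin_cases i
        · simpa [h] using h3
        · simpa [h] using h4
  · rintro (rfl | rfl)
    · refine ⟨le_rfl, ?_, 0, by ring, by ring⟩
      simp only [wD]; ring
    · refine ⟨le_rfl, ?_, 1, by ring, by ring⟩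
      simp only [wD]; ring

theorem wicket_nonempty {a b : E2} (hab : a ≠ b) : (wicket a b).Nonempty :=
  ⟨_, (mem_wicket_zero (z := a) hab).2 (Or.inl rfl)⟩

theorem wicket_inj {p q : E2 × E2} (hp : p.1 ≠ p.2) (hq : q.1 ≠ q.2)
    (h : wicket p.1 p.2 = wicket q.1 q.2) : p = q ∨ p = q.swap := by
  have key : ∀ z : E2, (z = p.1 ∨ z = p.2) ↔ (z = q.1 ∨ z = q.2) := by
    intro z
    rw [← mem_wicket_zero hp, ← mem_wicket_zero hq, h]
  rcases (key p.1).1 (Or.inl rfl) with h1 | h1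
  · rcases (key p.2).1 (Or.inr rfl) with h2 | h2
    · exact absurd (h1.trans h2.symm) hp
    · left; exact Prod.ext h1 h2
  · rcases (key p.2).1 (Or.inr rfl) with h2 | h2
    · right; exact Prod.ext h1 h2
    · exact absurd (h1.trans h2.symm) hp

def wickRho : ℤˣ →* Equiv.Perm (E2 × E2) where
  toFun a := { toFun := fun p => if a = 1 then p else p.swap, invFun := fun p => if a = 1 then p else p.swap
               left_inv := fun p => by rcases Int.units_eq_one_or a with rfl | rfl <;> simp
               right_inv := fun p => by rcases Int.units_eq_one_or a with rfl | rfl <;> simp }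
  map_one' := by ext p <;> simp
  map_mul' := fun a b => by
    apply Equiv.ext; intro p
    rcases Int.units_eq_one_or a with rfl | rfl <;> rcases Int.units_eq_one_or b with rfl | rfl <;> simp

theorem wickRho_apply (a : ℤˣ) (p : E2 × E2) : wickRho a p = if a = 1 then p else p.swap := rfl

theorem wickRho_or (a : ℤˣ) (p : E2 × E2) : wickRho a p = p ∨ wickRho a p = p.swap := by
  rw [wickRho_apply]; split_ifs <;> simp

theorem wickRho_wicket (a : ℤˣ) (p : E2 × E2) :
    wicket (wickRho a p).1 (wickRho a p).2 = wicket p.1 p.2 := by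
  rcases wickRho_or a p with h | h <;> rw [h]
  exact wicket_swap _ _

theorem wickRho_ne (a : ℤˣ) {p : E2 × E2} (hp : p.1 ≠ p.2) : (wickRho a p).1 ≠ (wickRho a p).2 := by
  rcases wickRho_or a p with h | h <;> rw [h]
  · exact hp
  · exact hp.symm

theorem wick_cov (n : ℕ) : IsCoveringMap (Quotient.mk (wicketSetoid n)) := by
  refine cov_tuple wickRho ?_ (fun p => wicket p.1 p.2) IsWicketTuple wickRho_wicket ?_ ?_ ?_ ?_ _
    isQuotientMap_quotient_mk' ?_
  · intro a
    change Continuous fun p : E2 × E2 => if a = 1 then p else p.swap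
    split_ifs
    · exact continuous_id
    · exact continuous_swap
  · rintro g f ⟨h1, h2⟩
    have hne : ∀ i j, i ≠ j → g.right⁻¹ i ≠ g.right⁻¹ j := fun i j h h' => h (g.right⁻¹.injective h')
    refine ⟨fun i => wickRho_ne _ (h1 _), fun i j hij => ?_⟩
    simp only [hoAct, wickRho_wicket]
    exact h2 _ _ (hne i j hij)
  · intro f hf i j hij
    by_contra hne
    have := hf.2 i j hne
    simp only at hij
    rw [hij, disjoint_self] at this
    exact (wicket_nonempty (hf.1 j)).ne_empty this
  · intro f hf i a h
    rcases Int.units_eq_one_or a with rfl | rfl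
    · rfl
    · exfalso
      have := congrArg Prod.fst h
      rw [wickRho_apply, if_neg (by decide)] at this
      exact hf.1 i this.symm
  · intro f f' hf hf' i j h
    rcases wicket_inj (hf.1 i) (hf'.1 j) h with h | h
    · exact ⟨1, by rw [map_one]; exact h⟩
    · exact ⟨-1, by rw [wickRho_apply, if_neg (by decide)]; exact h⟩
  · intro f f'
    exact Quotient.eq

def nuW : C(ℝ, E2) := ⟨fun s => !₂[Real.cos s, Real.sin s], by
  refine (PiLp.continuous_toLp 2 _).comp (continuous_pi fun i => ?_)
  fin_cases i
  · exact Real.continuous_cos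
  · exact Real.continuous_sin⟩

theorem nuW_norm (s : ℝ) : ‖nuW s‖ = 1 := by
  simp [nuW, EuclideanSpace.norm_eq, Fin.sum_univ_two]

theorem hdim2 : ∀ v : E2, ∃ l : E2, ‖l‖ = 1 ∧ inner ℝ l v = (0 : ℝ) := fun v => by
  by_cases hv : v = 0
  · exact ⟨nuW 0, nuW_norm 0, by simp [hv]⟩
  have hn : ‖(!₂[- v 1, v 0] : E2)‖ = ‖v‖ := by
    simp [EuclideanSpace.norm_eq, Fin.sum_univ_two, add_comm]
  refine ⟨‖v‖⁻¹ • !₂[- v 1, v 0], ?_, ?_⟩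
  · rw [norm_smul, norm_inv, norm_norm, hn, inv_mul_cancel₀ (norm_ne_zero_iff.2 hv)]
  · rw [inner_smul_left]
    simp [PiLp.inner_apply, Fin.sum_univ_two]
    right; ring

def phW : C(Unit, ℝ) := ⟨fun _ => 0, continuous_const⟩

theorem nuW_ph (s : Unit) : nuW (phW s) = nuW 0 := rfl

theorem PE_wick (n : ℕ) : PE (jY nuW phW (Fin n)) :=
  PE_jY_all nuW phW nuW_norm hdim2 (nuW 0) (nuW_norm 0) nuW_ph _ (Fin n) rfl

def wMid (p : E2 × E2) : E2 := (1 / 2 : ℝ) • (p.1 + p.2)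

theorem inner_E2 (x y : E2) : inner ℝ x y = x 0 * y 0 + x 1 * y 1 := by
  simp [PiLp.inner_apply, Fin.sum_univ_two]; ring

theorem normsq_E2 (x : E2) : ‖x‖ ^ 2 = x 0 ^ 2 + x 1 ^ 2 := by
  rw [EuclideanSpace.norm_sq_eq, Fin.sum_univ_two]; simp [sq_abs]

/-- angle compatibility -/
def Ang (p : E2 × E2) (s : ℝ) : Prop :=
  ∃ r : ℝ, r * Real.cos s = p.2 1 - p.1 1 ∧ r * Real.sin s = - (p.2 0 - p.1 0)

theorem mem_of_ht {p : E2 × E2} (hp : p.1 ≠ p.2) {s : ℝ} (hs : Ang p s) {z : E2}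
    (h1 : inner ℝ (z - wMid p) (nuW s) = (0 : ℝ)) {τ : ℝ} (hτ : 0 ≤ τ)
    (h2 : ‖z - wMid p‖ ^ 2 - wD p / 4 = - τ) :
    e3mk (z 0) (z 1) (Real.sqrt τ) ∈ wicket p.1 p.2 := by
  obtain ⟨r, hc, hsn⟩ := hs
  have hD := wD_pos hp
  rw [mem_wicket]
  simp only [e3mk, Equiv.symm, WithLp.equiv]
  simp only [Equiv.coe_fn_mk, Matrix.cons_val]
  rw [inner_E2] at h1
  rw [normsq_E2] at h2
  simp only [nuW, ContinuousMap.coe_mk, wMid, PiLp.sub_apply, PiLp.smul_apply, PiLp.add_apply, smul_eq_mul,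
    Matrix.cons_val] at h1 h2
  have h1' : (z 0 - 1 / 2 * (p.1 0 + p.2 0)) * (p.2 1 - p.1 1) -
      (z 1 - 1 / 2 * (p.1 1 + p.2 1)) * (p.2 0 - p.1 0) = 0 := by
    linear_combination r * h1 - (z 0 - 1 / 2 * (p.1 0 + p.2 0)) * hc - (z 1 - 1 / 2 * (p.1 1 + p.2 1)) * hsn
  refine ⟨Real.sqrt_nonneg _, ?_, 1 / 2 + ((z 0 - 1 / 2 * (p.1 0 + p.2 0)) * (p.2 0 - p.1 0) +
      (z 1 - 1 / 2 * (p.1 1 + p.2 1)) * (p.2 1 - p.1 1)) / wD p, ?_, ?_⟩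
  · rw [Real.sq_sqrt hτ]; linear_combination h2
  · field_simp
    unfold wD
    linear_combination 2 * (p.2 1 - p.1 1) * h1'
  · field_simp
    unfold wD
    linear_combination - 2 * (p.2 0 - p.1 0) * h1'

theorem wick_isY {n : ℕ} (f : WicketTuple n) (s : Fin n → ℝ) (hs : ∀ i, Ang (f.1 i) (s i)) : IsY nuW
    (fun i => (wMid (f.1 i), wD (f.1 i) / 4, s i)) := by
  refine ⟨fun i => by have := wD_pos (f.2.1 i); simp only; positivity, fun i j hij z h1 h2 h3 => ?_⟩
  simp only [ht, pw] at h1 h2 h3 ⊢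
  by_contra hn
  have m1 := mem_of_ht (f.2.1 i) (hs i) h1 (τ := -(‖z - wMid (f.1 i)‖ ^ 2 - wD (f.1 i) / 4)) (by linarith) (by ring)
  have m2 := mem_of_ht (f.2.1 j) (hs j) h2 (τ := -(‖z - wMid (f.1 i)‖ ^ 2 - wD (f.1 i) / 4)) (by linarith)
    (by rw [h3]; ring)
  exact Set.disjoint_left.1 (f.2.2 i j hij) m1 m2

theorem wt_ev {n : ℕ} (i : Fin n) : Continuous fun f : WicketTuple n => f.1 i :=
  (continuous_apply i).comp continuous_subtype_val

theorem wMid_cont : Continuous wMid := by unfold wMid; fun_prop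
theorem wD_cont : Continuous wD := by unfold wD; fun_prop

def wickTu (n : ℕ) : Set (WicketTuple n) :=
  {f | ∀ i, (f.1 i).1 0 = (f.1 i).2 0 ∧ (f.1 i).1 1 < (f.1 i).2 1}

theorem wick_ang0 {n : ℕ} (f : wickTu n) (i : Fin n) : Ang (f.1.1 i) 0 :=
  ⟨(f.1.1 i).2 1 - (f.1.1 i).1 1, by simp, by have := (f.2 i).1; simp [this]⟩

def wickA (n : ℕ) : C(wickTu n, YC (nuW.comp phW) (Fin n)) :=
  ⟨fun f => ⟨fun i => (wMid (f.1.1 i), wD (f.1.1 i) / 4, ()), wick_isY f.1 (fun _ => 0) (wick_ang0 f)⟩, by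
    refine Continuous.subtype_mk (continuous_pi fun i => ?_) _
    have h := (wt_ev (n := n) i).comp (continuous_subtype_val (p := (· ∈ wickTu n)))
    exact (wMid_cont.comp h).prodMk (Continuous.prodMk ((wD_cont.comp h).div_const _) continuous_const)⟩

def e2W : E2 := !₂[0, 1]

theorem wick_ht0 {p : E2 × E2} (hp : p.1 0 = p.2 0) {x : E3} (hx : x ∈ wicket p.1 p.2) :
    inner ℝ ((!₂[x 0, x 1] : E2) - wMid p) (nuW 0) = (0 : ℝ) ∧
    ‖(!₂[x 0, x 1] : E2) - wMid p‖ ^ 2 - wD p / 4 = - x 2 ^ 2 := by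
  rw [mem_wicket] at hx
  obtain ⟨h1, h2, t, h3, h4⟩ := hx
  rw [inner_E2, normsq_E2]
  simp only [nuW, ContinuousMap.coe_mk, wMid, PiLp.sub_apply, PiLp.smul_apply, PiLp.add_apply, smul_eq_mul,
    Matrix.cons_val, Real.cos_zero, Real.sin_zero]
  constructor
  · rw [h3, hp]; ring
  · linear_combination h2

def wBk (o : E2 × ℝ × Unit) : E2 × E2 := (o.1 - Real.sqrt o.2.1 • e2W, o.1 + Real.sqrt o.2.1 • e2W)

theorem wBk_props {o : E2 × ℝ × Unit} (ho : 0 < o.2.1) : (wBk o).1 ≠ (wBk o).2 ∧ (wBk o).1 0 = (wBk o).2 0 ∧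
    (wBk o).1 1 < (wBk o).2 1 ∧ wMid (wBk o) = o.1 ∧ wD (wBk o) / 4 = o.2.1 := by
  have hs : 0 < Real.sqrt o.2.1 := Real.sqrt_pos.2 ho
  have hlt : (wBk o).1 1 < (wBk o).2 1 := by simp [wBk, e2W]; linarith
  refine ⟨fun h => by rw [h] at hlt; exact lt_irrefl _ hlt, by simp [wBk, e2W], hlt, ?_, ?_⟩
  · ext i
    simp [wBk, wMid]; ring
  · have := Real.sq_sqrt ho.le
    simp [wBk, wD, e2W]
    linear_combination this

theorem wick_back {n : ℕ} (y : YC (nuW.comp phW) (Fin n)) :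
    IsWicketTuple (fun i => wBk (y.1 i)) := by
  have hp := fun i => wBk_props (y.2.1 i)
  refine ⟨fun i => (hp i).1, fun i j hij => ?_⟩
  rw [Set.disjoint_left]
  intro x h1 h2
  obtain ⟨a1, a2⟩ := wick_ht0 (hp i).2.1 h1
  obtain ⟨b1, b2⟩ := wick_ht0 (hp j).2.1 h2
  rw [(hp i).2.2.2.1] at a1 a2
  rw [(hp i).2.2.2.2] at a2
  rw [(hp j).2.2.2.1] at b1 b2
  rw [(hp j).2.2.2.2] at b2
  have := y.2.2 i j hij _ a1 b1 (a2.trans b2.symm)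
  have h3 : 0 < - x 2 ^ 2 := by rw [← a2]; exact this
  nlinarith [sq_nonneg (x 2)]

def wickR (n : ℕ) : C(YC (nuW.comp phW) (Fin n), wickTu n) :=
  ⟨fun y => ⟨⟨_, wick_back y⟩, fun i => ⟨(wBk_props (y.2.1 i)).2.1, (wBk_props (y.2.1 i)).2.2.1⟩⟩, by
    refine Continuous.subtype_mk (Continuous.subtype_mk (continuous_pi fun i => ?_) _) _
    have h := YC.ev (nuW.comp phW) (β := Fin n) i
    have hc : Continuous wBk := by unfold wBk; fun_prop
    exact hc.comp h⟩

theorem wickRA {n : ℕ} (f : wickTu n) : wickR n (wickA n f) = f := by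
  apply Subtype.ext
  apply Subtype.ext
  funext i
  obtain ⟨h1, h2⟩ := f.2 i
  have e : Real.sqrt (wD (f.1.1 i) / 4) = ((f.1.1 i).2 1 - (f.1.1 i).1 1) / 2 := by
    rw [show wD (f.1.1 i) / 4 = (((f.1.1 i).2 1 - (f.1.1 i).1 1) / 2) ^ 2 by unfold wD; rw [h1]; ring]
    exact Real.sqrt_sq (by linarith)
  change (wMid (f.1.1 i) - Real.sqrt (wD (f.1.1 i) / 4) • e2W,
    wMid (f.1.1 i) + Real.sqrt (wD (f.1.1 i) / 4) • e2W) = f.1.1 i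
  rw [e]
  refine Prod.ext ?_ ?_
  · ext k; fin_cases k
    · simp [wMid, e2W]; linarith
    · simp [wMid, e2W]; linarith
  · ext k; fin_cases k
    · simp [wMid, e2W]; linarith
    · simp [wMid, e2W]; linarith

theorem wick_unt {n : ℕ} (f : WicketTuple n) (h : Quotient.mk (wicketSetoid n) f ∈ UWConf n) : IsUWTuple f := by
  obtain ⟨g, hg, hu⟩ := h
  have hr : (Set.range fun i => wicket (g.1 i).1 (g.1 i).2) = Set.range fun i => wicket (f.1 i).1 (f.1 i).2 :=
    Quotient.exact hg
  intro i
  have : wicket (f.1 i).1 (f.1 i).2 ∈ Set.range fun i => wicket (g.1 i).1 (g.1 i).2 := by rw [hr]; exact ⟨i, rfl⟩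
  obtain ⟨j, hj⟩ := this
  rcases wicket_inj (f.2.1 i) (g.2.1 j) hj.symm with h2 | h2
  · rw [h2]; exact hu j
  · rw [h2]; exact (hu j).symm

theorem wne {p : E2 × E2} (hp : p.1 ≠ p.2) (h : p.1 0 = p.2 0) : p.2 1 - p.1 1 ≠ 0 := by
  intro h'
  apply hp
  ext k; fin_cases k
  · exact h
  · simp; linarith

end PESec
end


noncomputable section
open CategoryTheory

namespace PESec
open scoped unitInterval Topology

def wz (p : E2 × E2) : ℂ := ⟨p.2 1 - p.1 1, - (p.2 0 - p.1 0)⟩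

theorem wz_ne {p : E2 × E2} (hp : p.1 ≠ p.2) : wz p ≠ 0 := by
  intro h
  have h0 : - (p.2 0 - p.1 0) = 0 := congrArg Complex.im h
  have h1 : p.2 1 - p.1 1 = 0 := congrArg Complex.re h
  have := wD_pos hp
  unfold wD at this
  rw [h1, show p.2 0 - p.1 0 = 0 by linarith] at this
  simp at this

theorem wz_cont : Continuous wz := by
  have : wz = fun p => ((p.2 1 - p.1 1 : ℝ) : ℂ) + ((- (p.2 0 - p.1 0) : ℝ) : ℂ) * Complex.I := by
    funext p; exact Complex.mk_eq_add_mul_I _ _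
  rw [this]; fun_prop

theorem wdir_norm {p : E2 × E2} (hp : p.1 ≠ p.2) : ‖wz p / (‖wz p‖ : ℂ)‖ = 1 := by
  rw [norm_div, Complex.norm_real, norm_norm, div_self (norm_ne_zero_iff.2 (wz_ne hp))]

def wdir {n : ℕ} (i : Fin n) : C(WicketTuple n, Circle) :=
  ⟨fun f => ⟨wz (f.1 i) / (‖wz (f.1 i)‖ : ℂ), mem_sphere_zero_iff_norm.2 (wdir_norm (f.2.1 i))⟩, by
    refine Continuous.subtype_mk ?_ _
    have h := wz_cont.comp (wt_ev (n := n) i)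
    exact Continuous.div h (Complex.continuous_ofReal.comp h.norm)
      fun f => Complex.ofReal_ne_zero.2 (norm_ne_zero_iff.2 (wz_ne (f.2.1 i)))⟩

theorem ang_of_exp {n : ℕ} (i : Fin n) (f : WicketTuple n) (s : ℝ) (h : Circle.exp s = wdir i f) : Ang (f.1 i) s := by
  have h1 : Complex.exp (s * Complex.I) = wz (f.1 i) / (‖wz (f.1 i)‖ : ℂ) := congrArg Subtype.val h
  have hn : (‖wz (f.1 i)‖ : ℂ) ≠ 0 := Complex.ofReal_ne_zero.2 (norm_ne_zero_iff.2 (wz_ne (f.2.1 i)))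
  rw [eq_div_iff hn, mul_comm] at h1
  refine ⟨‖wz (f.1 i)‖, ?_, ?_⟩
  · have := congrArg Complex.re h1
    rw [Complex.re_ofReal_mul, Complex.exp_ofReal_mul_I_re] at this
    exact this
  · have := congrArg Complex.im h1
    rw [Complex.im_ofReal_mul, Complex.exp_ofReal_mul_I_im] at this
    exact this

theorem wdir_tu {n : ℕ} (i : Fin n) (f : wickTu n) : wdir i f.1 = 1 := by
  obtain ⟨h1, h2⟩ := f.2 i
  apply Subtype.ext
  change wz (f.1.1 i) / (‖wz (f.1.1 i)‖ : ℂ) = 1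
  have : wz (f.1.1 i) = (((f.1.1 i).2 1 - (f.1.1 i).1 1 : ℝ) : ℂ) := by
    apply Complex.ext
    · rfl
    · change -((f.1.1 i).2 0 - (f.1.1 i).1 0) = 0
      rw [h1]; ring
  rw [this, Complex.norm_real, Real.norm_eq_abs, abs_of_pos (by linarith)]
  exact div_self (Complex.ofReal_ne_zero.2 (by linarith))

theorem exp_lift {f₀ f₁ : C(I, Circle)} (F : f₀.HomotopyRel f₁ {0, 1}) (h0 : ∀ t, f₀ t = 1) (h1 : ∀ t, f₁ t = 1) :
    ∃ L : C(I × I, ℝ), (∀ x, Circle.exp (L x) = F x) ∧ (∀ t, L (0, t) = 0) ∧ (∀ t, L (1, t) = 0) ∧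
      (∀ t, L (t, 0) = 0) ∧ (∀ t, L (t, 1) = 0) := by
  have cov := Circle.isCoveringMap_exp
  let z : C(I, ℝ) := ContinuousMap.const _ 0
  have e0 : Circle.exp ∘ z = f₀ := by funext t; simp [z, h0]
  have e1 : Circle.exp ∘ z = f₁ := by funext t; simp [z, h1]
  let L := cov.liftHomotopyRel F (f₀' := z) (f₁' := z) ⟨0, Or.inl rfl, rfl⟩ e0 e1
  refine ⟨L.toContinuousMap, fun x => ?_, fun t => L.apply_zero t, fun t => L.apply_one t,
    fun t => L.eq_fst t (Or.inl rfl), fun t => L.eq_fst t (Or.inr rfl)⟩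
  exact congrFun (cov.liftHomotopy_lifts F.toContinuousMap z
    (fun a => (F.apply_zero a).trans (congrFun e0 a).symm)) x

theorem wick_faith (n : ℕ) (a b : wickTu n) (δ δ' : Path a b)
    (h : (δ.map continuous_subtype_val).Homotopic (δ'.map continuous_subtype_val)) : δ.Homotopic δ' := by
  refine faith_of (PE_wick n) (wickA n) (wickR n) wickRA a b δ δ' ?_
  obtain ⟨H⟩ := h
  have key : ∀ i : Fin n, ∃ L : C(I × I, ℝ), (∀ x, Circle.exp (L x) = wdir i (H x)) ∧ (∀ t, L (0, t) = 0) ∧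
      (∀ t, L (1, t) = 0) ∧ (∀ t, L (t, 0) = 0) ∧ (∀ t, L (t, 1) = 0) := fun i =>
    exp_lift (ContinuousMap.HomotopyRel.compContinuousMap H (wdir i)) (fun t => wdir_tu i (δ t)) (fun t => wdir_tu i (δ' t))
  choose L hL l0 l1 r0 r1 using key
  have h0 : ∀ t, H (0, t) = (δ t).1 := fun t => H.apply_zero t
  have h1 : ∀ t, H (1, t) = (δ' t).1 := fun t => H.apply_one t
  have g0 : ∀ s, H (s, 0) = a.1 := fun s => H.source s
  have g1 : ∀ s, H (s, 1) = b.1 := fun s => H.target s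
  let K : C(I × I, YC nuW (Fin n)) :=
    ⟨fun x => ⟨_, wick_isY (H x) (fun i => L i x) (fun i => ang_of_exp i _ _ (hL i x))⟩, by
      refine Continuous.subtype_mk (continuous_pi fun i => ?_) _
      have h := (wt_ev (n := n) i).comp H.continuous
      exact (wMid_cont.comp h).prodMk (((wD_cont.comp h).div_const _).prodMk (L i).continuous)⟩
  have hK : ∀ x (f : wickTu n), H x = f.1 → (∀ i, L i x = 0) → K x = jY nuW phW (Fin n) (wickA n f) := by
    intro x f hf hl
    apply Subtype.ext
    funext i
    change (wMid ((H x).1 i), wD ((H x).1 i) / 4, L i x) = (wMid (f.1.1 i), wD (f.1.1 i) / 4, (0 : ℝ))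
    rw [hf, hl]
  refine ⟨{ toContinuousMap := K, map_zero_left := fun t => ?_, map_one_left := fun t => ?_, prop' := ?_ }⟩
  · exact hK _ (δ t) (h0 t) fun i => l0 i t
  · exact hK _ (δ' t) (h1 t) fun i => l1 i t
  · rintro s t (rfl | rfl)
    · exact (hK (s, 0) a (g0 s) fun i => r0 i s).trans (Path.source _).symm
    · exact (hK (s, 1) b (g1 s) fun i => r1 i s).trans (Path.target _).symm

theorem wick_main (n : ℕ) (x : UWConf n) (γ γ' : Path x x)
    (h : (γ.map continuous_subtype_val).Homotopic (γ'.map continuous_subtype_val)) : γ.Homotopic γ' := by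
  refine covering_inj (wick_cov n) (UWConf n) (wickTu n) ?_ ?_ ?_ (wick_faith n) x γ γ' h
  · intro f hf
    exact ⟨f, rfl, fun i => (hf i).1⟩
  · rintro x ⟨f, rfl, hf⟩
    have hne := fun i => wne (f.2.1 i) (hf i)
    let sg : Fin n → ℤˣ := fun i => if 0 < (f.1 i).2 1 - (f.1 i).1 1 then 1 else -1
    let g : Fin n → E2 × E2 := fun i => wickRho (sg i) (f.1 i)
    have hg : IsWicketTuple g := by
      refine ⟨fun i => wickRho_ne _ (f.2.1 i), fun i j hij => ?_⟩
      simp only [g, wickRho_wicket]; exact f.2.2 i j hij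
    refine ⟨⟨g, hg⟩, fun i => ?_, ?_⟩
    · rcases lt_or_gt_of_ne (hne i) with h | h
      · have : sg i = -1 := by simp only [sg]; rw [if_neg (by linarith)]
        simp only [g, this, wickRho_apply]
        rw [if_neg (by decide)]
        exact ⟨(hf i).symm, by simp only [Prod.fst_swap, Prod.snd_swap]; linarith⟩
      · have : sg i = 1 := by simp only [sg]; rw [if_pos h]
        simp only [g, this, wickRho_apply]
        rw [if_pos trivial]
        exact ⟨hf i, by linarith⟩
    · apply Quotient.sound
      change (Set.range fun i => wicket (g i).1 (g i).2) = _
      simp only [g, wickRho_wicket]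
  · intro Γ h0 hU t i
    have hu := fun t => wick_unt (Γ t) (hU t) i
    refine ⟨hu t, ?_⟩
    have := pos_of_path (fun t => ((Γ t).1 i).2 1 - ((Γ t).1 i).1 1) ?_ (by have := (h0 i).2; linarith) ?_ t
    · simp only at this; linarith
    · have hc : Continuous fun t => (Γ t).1 i := (wt_ev i).comp Γ.continuous
      fun_prop
    · intro t; exact wne ((Γ t).2.1 i) (hu t)

theorem wick_inj (n : ℕ) (x : UWConf n) : Function.Injective (pi1Map (inclUWtoW n) x) :=
  pi1Map_inj _ _ fun γ γ' h => wick_main n x γ γ' h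

end PESec
end

/-- The homomorphisms on fundamental groups induced by the inclusions `𝒰ℛ_n ↪ ℛ_n`,
`𝒰ℛ_n ↪ 𝒱ℛ_n` and `𝒰𝒲_n ↪ 𝒲_n` are all injective. -/
theorem statement6 (n : ℕ) :
    (∀ x : ↥(URConf n), Function.Injective (pi1Map (inclURtoR n) x)) ∧
    (∀ x : ↥(URConf n), Function.Injective (pi1Map (inclURtoVR n) x)) ∧
    (∀ x : ↥(UWConf n), Function.Injective (pi1Map (inclUWtoW n) x)) := by
  exact ⟨fun x => PESec.ring_inj n x, fun x => PESec.ringV_inj n x, fun x => PESec.wick_inj n x⟩
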